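/- Let v₀ be a harmonic function on the open unit ball B ⊂ ℝⁿ that is not identically zero, and set Z = Z(v₀). Then there exist constants A > 0 and R > 0, depending only on Z (and the dimension n), such that for all harmonic functions u, v on B with Z(u) = Z(v) = Z and every multi-index α ∈ ℕⁿ one has sup_{x ∈ B_{1/2} ∖ Z} |∂^α(u/v)(x)| ≤ α! · A · R^{|α|} · inf_{x ∈ B_{1/2} ∖ Z} |u(x)/v(x)|, where ∂^α denotes the partial derivative of the smooth function u/v on B ∖ Z corresponding to α and |α| is the order of α. -/

import Mathlib

open Metric Set Filter

noncomputable section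

abbrev En (n : ℕ) : Type := EuclideanSpace ℝ (Fin n)

/-- The Laplacian of `u` at `x`, computed from the second iterated Fréchet derivative. -/
def laplacianAt {n : ℕ} (u : En n → ℝ) (x : En n) : ℝ :=
  ∑ i : Fin n, iteratedFDeriv ℝ 2 u x ![EuclideanSpace.single i 1, EuclideanSpace.single i 1]

/-- `u` is harmonic on `Ω`: twice continuously differentiable with vanishing Laplacian. -/
def HarmonicOnSet {n : ℕ} (u : En n → ℝ) (Ω : Set (En n)) : Prop :=
  ContDiffOn ℝ 2 u Ω ∧ ∀ x ∈ Ω, laplacianAt u x = 0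

/-- The zero set of `u` within `Ω`. -/
def zeroSet {n : ℕ} (u : En n → ℝ) (Ω : Set (En n)) : Set (En n) :=
  {x ∈ Ω | u x = 0}

/-- The collection of nodal domains of `u` in `Ω`, i.e. the connected components of
`Ω \ Z(u)`. -/
def nodalComponents {n : ℕ} (u : En n → ℝ) (Ω : Set (En n)) : Set (Set (En n)) :=
  {C | ∃ x ∈ Ω \ zeroSet u Ω, C = connectedComponentIn (Ω \ zeroSet u Ω) x}

/-- The partial derivative of `f` in the `i`-th coordinate direction. -/
def partialDeriv1 {n : ℕ} (i : Fin n) (f : En n → ℝ) : En n → ℝ :=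
  fun x => fderiv ℝ f x (EuclideanSpace.single i 1)

/-- The partial derivative `D^α f` corresponding to the multi-index `α`. -/
def multiPartialDeriv {n : ℕ} (α : Fin n → ℕ) (f : En n → ℝ) : En n → ℝ :=
  (List.finRange n).foldr (fun i g => (partialDeriv1 i)^[α i] g) f

section nodal_ratio

open MeasureTheory Topology ContDiff

/-! ### Radial weights and integration by parts -/

theorem fderiv_apply_eq_sum_partialDeriv1 {n : ℕ} (f : En n → ℝ) (x v : En n) :
    fderiv ℝ f x v = ∑ i, v i * partialDeriv1 i f x := by
  have hv : v = ∑ i, v i • EuclideanSpace.single i (1 : ℝ) := by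
    ext j
    simp [Finset.sum_apply, Pi.single_apply]
  conv_lhs => rw [hv]
  simp [partialDeriv1, map_sum]

theorem integrable_mul_of_eq_zero_off_compact {n : ℕ} {f g : En n → ℝ} {K : Set (En n)}
    (hK : IsCompact K) (hf : ContinuousOn f K) (hg : Continuous g) (h0 : ∀ x ∉ K, g x = 0) :
    Integrable (fun x => f x * g x) := by
  have h1 : IntegrableOn (fun x => f x * g x) K :=
    (hf.mul hg.continuousOn).integrableOn_compact hK
  rwa [integrableOn_iff_integrable_of_support_subset] at h1
  intro x hx
  by_contra hxK
  exact hx (by simp [h0 x hxK])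

/-- `η` is a continuous profile vanishing on `[S, ∞)`. -/
structure IsRadialProfile (η : ℝ → ℝ) (S : ℝ) : Prop where
  continuous : Continuous η
  eq_zero : ∀ s, S ≤ s → η s = 0

/-- The antiderivative `s ↦ ∫ₛ^S η`. -/
def profileTail (η : ℝ → ℝ) (S : ℝ) : ℝ → ℝ := fun s => ∫ t in s..S, η t

theorem IsRadialProfile.hasDerivAt_tail {η : ℝ → ℝ} {S : ℝ} (h : IsRadialProfile η S) (s : ℝ) :
    HasDerivAt (profileTail η S) (-η s) s :=
  intervalIntegral.integral_hasDerivAt_left (h.continuous.intervalIntegrable _ _)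
    (h.continuous.stronglyMeasurableAtFilter _ _) h.continuous.continuousAt

theorem IsRadialProfile.tail {η : ℝ → ℝ} {S : ℝ} (h : IsRadialProfile η S) :
    IsRadialProfile (profileTail η S) S := by
  refine ⟨continuous_iff_continuousAt.2 fun s => (h.hasDerivAt_tail s).continuousAt, ?_⟩
  intro s hs
  unfold profileTail
  rw [intervalIntegral.integral_symm, intervalIntegral.integral_congr (g := fun _ => 0)]
  · simp
  · intro t ht
    rw [uIcc_of_le hs] at ht
    exact h.eq_zero t ht.1

/-- The radial function `y ↦ η (‖y‖²)`. -/
def radial {n : ℕ} (η : ℝ → ℝ) : En n → ℝ := fun y => η (‖y‖ ^ 2)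

theorem IsRadialProfile.continuous_radial {n : ℕ} {η : ℝ → ℝ} {S : ℝ} (h : IsRadialProfile η S) :
    Continuous (radial η : En n → ℝ) :=
  h.continuous.comp (by fun_prop)

theorem IsRadialProfile.radial_eq_zero {n : ℕ} {η : ℝ → ℝ} {ρ : ℝ} (hρ : 0 ≤ ρ)
    (h : IsRadialProfile η (ρ ^ 2)) (x : En n) (hx : x ∉ ball (0 : En n) ρ) : radial η x = 0 := by
  apply h.eq_zero
  have : ρ ≤ ‖x‖ := by simpa using hx
  gcongr

theorem IsRadialProfile.hasFDerivAt_radial_tail {n : ℕ} {η : ℝ → ℝ} {S : ℝ}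
    (h : IsRadialProfile η S) (x : En n) :
    HasFDerivAt (radial (profileTail η S)) ((-η (‖x‖ ^ 2)) • (2 • innerSL ℝ x)) x :=
  (h.hasDerivAt_tail (‖x‖ ^ 2)).comp_hasFDerivAt x (hasStrictFDerivAt_norm_sq x).hasFDerivAt

theorem IsRadialProfile.integral_partialDeriv1_mul_tail {n : ℕ} {η : ℝ → ℝ} {ρ : ℝ} (hρ : 0 ≤ ρ)
    (h : IsRadialProfile η (ρ ^ 2)) {f : En n → ℝ} {U : Set (En n)} (hU : IsOpen U)
    (hf : ContDiffOn ℝ 1 f U) (hρU : closedBall 0 ρ ⊆ U) (i : Fin n) :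
    ∫ y, partialDeriv1 i f y * radial (profileTail η (ρ ^ 2)) y
      = 2 * ∫ y, f y * y i * radial η y := by
  have hz : ∀ x ∉ closedBall (0 : En n) ρ, radial (profileTail η (ρ ^ 2)) x = 0 := fun x hx =>
    h.tail.radial_eq_zero hρ x fun hx' => hx (ball_subset_closedBall hx')
  have hz' : ∀ x ∉ closedBall (0 : En n) ρ, radial η x = 0 := fun x hx =>
    h.radial_eq_zero hρ x fun hx' => hx (ball_subset_closedBall hx')
  have hK := isCompact_closedBall (0 : En n) ρ
  have hfd : ∀ x, fderiv ℝ (radial (profileTail η (ρ ^ 2))) x (EuclideanSpace.single i 1)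
      = (-2) * (x i * radial η x) := by
    intro x
    rw [(h.hasFDerivAt_radial_tail x).fderiv]
    simp [radial, EuclideanSpace.inner_single_right]
    ring
  have hfc : ContinuousOn f (closedBall 0 ρ) := hf.continuousOn.mono hρU
  have hf'c : ContinuousOn (fun x => fderiv ℝ f x (EuclideanSpace.single i 1)) (closedBall 0 ρ) :=
    ((hf.continuousOn_fderiv_of_isOpen hU le_rfl).mono hρU).clm_apply continuousOn_const
  have key := integral_mul_fderiv_eq_neg_fderiv_mul_of_integrable (μ := volume)
    (f := f) (g := radial (profileTail η (ρ ^ 2))) (v := EuclideanSpace.single i (1 : ℝ))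
    (integrable_mul_of_eq_zero_off_compact hK hf'c h.tail.continuous_radial hz)
    (by
      simp_rw [hfd]
      refine integrable_mul_of_eq_zero_off_compact hK hfc ?_ ?_
      · have := h.continuous_radial (n := n); fun_prop
      · intro x hx; simp [hz' x hx])
    (integrable_mul_of_eq_zero_off_compact hK hfc h.tail.continuous_radial hz)
    (by
      intro x hx
      have : x ∈ closedBall (0 : En n) ρ := by
        refine (closure_minimal ?_ isClosed_closedBall) hx
        intro y hy
        by_contra hy'
        exact hy (hz y hy')
      exact (hf.differentiableOn one_ne_zero).differentiableAt (hU.mem_nhds (hρU this)))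
    (fun x _ => (h.hasFDerivAt_radial_tail x).differentiableAt)
  have e1 : ∀ y, partialDeriv1 i f y = fderiv ℝ f y (EuclideanSpace.single i 1) := fun _ => rfl
  simp_rw [hfd] at key
  simp_rw [e1]
  have : ∫ y, f y * (-2 * (y i * radial η y)) = -2 * ∫ y, f y * y i * radial η y := by
    rw [← integral_const_mul]
    congr 1; ext y; ring
  linarith [key, this]

/-! ### The mean value property -/

theorem partialDeriv1_congr {n : ℕ} {U : Set (En n)} (hU : IsOpen U) {f g : En n → ℝ}
    (h : EqOn f g U) (i : Fin n) : EqOn (partialDeriv1 i f) (partialDeriv1 i g) U := by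
  intro x hx
  unfold partialDeriv1
  rw [(h.eventuallyEq_of_mem (hU.mem_nhds hx)).fderiv_eq]

theorem partialDeriv1_comp_add {n : ℕ} (f : En n → ℝ) (a : En n) (i : Fin n) :
    partialDeriv1 i (fun x => f (a + x)) = fun x => partialDeriv1 i f (a + x) := by
  ext x
  simp [partialDeriv1, fderiv_comp_add_left]

theorem partialDeriv1_comp_smul {n : ℕ} {f : En n → ℝ} (t : ℝ) (i : Fin n) {x : En n}
    (hf : DifferentiableAt ℝ f (t • x)) :
    partialDeriv1 i (fun x => f (t • x)) x = t * partialDeriv1 i f (t • x) := by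
  have h := hf.hasFDerivAt.comp x ((hasFDerivAt_id x).const_smul t)
  have h' : HasFDerivAt (fun x => f (t • x)) _ x := h
  simp [partialDeriv1, h'.fderiv]

theorem ContDiffOn.partialDeriv1 {n : ℕ} {U : Set (En n)} (hU : IsOpen U) {f : En n → ℝ}
    {k m : WithTop ℕ∞} (hf : ContDiffOn ℝ k f U) (hm : m + 1 ≤ k) (i : Fin n) :
    ContDiffOn ℝ m (partialDeriv1 i f) U :=
  (hf.fderiv_of_isOpen hU hm).clm_apply contDiffOn_const

theorem partialDeriv1_comm {n : ℕ} {U : Set (En n)} (hU : IsOpen U) {f : En n → ℝ}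
    (hf : ContDiffOn ℝ 2 f U) (i j : Fin n) :
    EqOn (partialDeriv1 i (partialDeriv1 j f)) (partialDeriv1 j (partialDeriv1 i f)) U := by
  intro x hx
  have h := (hf.contDiffAt (hU.mem_nhds hx)).isSymmSndFDerivAt (by simp)
  have hd : DifferentiableAt ℝ (fderiv ℝ f) x :=
    ((hf.fderiv_of_isOpen hU (m := 1) (by norm_num)).differentiableOn
      one_ne_zero).differentiableAt (hU.mem_nhds hx)
  have e : ∀ a b : Fin n, partialDeriv1 a (partialDeriv1 b f) x
      = fderiv ℝ (fderiv ℝ f) x (EuclideanSpace.single a 1) (EuclideanSpace.single b 1) := by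
    intro a b
    have h2 := hd.hasFDerivAt.clm_apply
      (hasFDerivAt_const (EuclideanSpace.single b (1 : ℝ)) x)
    have h3 : HasFDerivAt (partialDeriv1 b f) _ x := h2
    rw [partialDeriv1, h3.fderiv]
    simp
  rw [e, e]
  exact h _ _

/-- The Laplacian as a sum of iterated partial derivatives. -/
theorem laplacianAt_eq_sum {n : ℕ} {U : Set (En n)} (hU : IsOpen U) {f : En n → ℝ}
    (hf : ContDiffOn ℝ 2 f U) {x : En n} (hx : x ∈ U) :
    laplacianAt f x = ∑ i, partialDeriv1 i (partialDeriv1 i f) x := by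
  have hd : DifferentiableAt ℝ (fderiv ℝ f) x :=
    ((hf.fderiv_of_isOpen hU (m := 1) (by norm_num)).differentiableOn
      one_ne_zero).differentiableAt (hU.mem_nhds hx)
  unfold laplacianAt
  refine Finset.sum_congr rfl fun i _ => ?_
  rw [iteratedFDeriv_two_apply]
  have h2 := hd.hasFDerivAt.clm_apply
    (hasFDerivAt_const (EuclideanSpace.single i (1 : ℝ)) x)
  have h3 : HasFDerivAt (partialDeriv1 i f) _ x := h2
  rw [partialDeriv1, h3.fderiv]
  simp

theorem integrable_continuousOn_mul_radial {n : ℕ} {η : ℝ → ℝ} {ρ : ℝ} (hρ : 0 ≤ ρ)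
    (h : IsRadialProfile η (ρ ^ 2)) {f : En n → ℝ} (hf : ContinuousOn f (closedBall 0 ρ)) :
    Integrable fun y => f y * radial η y :=
  integrable_mul_of_eq_zero_off_compact (isCompact_closedBall (0 : En n) ρ) hf
    h.continuous_radial fun x hx => h.radial_eq_zero hρ x fun hx' => hx (ball_subset_closedBall hx')

theorem IsRadialProfile.integrable_radial {n : ℕ} {η : ℝ → ℝ} {ρ : ℝ} (hρ : 0 ≤ ρ)
    (h : IsRadialProfile η (ρ ^ 2)) : Integrable (radial η : En n → ℝ) := by
  simpa using integrable_continuousOn_mul_radial (f := fun _ => (1 : ℝ)) hρ h continuousOn_const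

theorem integral_mul_radial_of_harmonic {n : ℕ} {η : ℝ → ℝ} {ρ R : ℝ} (hρ : 0 < ρ) (hR : ρ < R)
    (h : IsRadialProfile η (ρ ^ 2)) {u : En n → ℝ} (hu : ContDiffOn ℝ 2 u (ball 0 R))
    (hlap : ∀ x ∈ ball (0 : En n) R, ∑ i, partialDeriv1 i (partialDeriv1 i u) x = 0) :
    ∫ y, u y * radial η y = u 0 * ∫ y : En n, radial η y := by
  obtain ⟨T, hT1, hT2⟩ : ∃ T : ℝ, 1 < T ∧ T * ρ < R := by
    obtain ⟨c, hc1, hc2⟩ := exists_between hR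
    exact ⟨c / ρ, by rwa [one_lt_div hρ], by rwa [div_mul_cancel₀ _ hρ.ne']⟩
  have hmem : ∀ t ∈ Ioo (-T) T, ∀ y ∈ closedBall (0 : En n) ρ,
      t • y ∈ closedBall (0 : En n) (T * ρ) := by
    intro t ht y hy
    simp only [mem_closedBall_zero_iff, norm_smul, Real.norm_eq_abs] at hy ⊢
    have := abs_lt.2 ht
    gcongr
  have hsub : closedBall (0 : En n) (T * ρ) ⊆ ball 0 R := closedBall_subset_ball hT2
  have hK := isCompact_closedBall (0 : En n) (T * ρ)
  have hfd : ContinuousOn (fderiv ℝ u) (ball 0 R) :=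
    hu.continuousOn_fderiv_of_isOpen isOpen_ball (by norm_num)
  obtain ⟨C, hC⟩ := hK.exists_bound_of_continuousOn (hfd.mono hsub)
  have hz : ∀ x ∉ closedBall (0 : En n) ρ, radial η x = 0 := fun x hx =>
    h.radial_eq_zero hρ.le x fun hx' => hx (ball_subset_closedBall hx')
  have hscale : ∀ {g : En n → ℝ}, ContinuousOn g (ball 0 R) → ∀ t ∈ Ioo (-T) T,
      ContinuousOn (fun y : En n => g (t • y)) (closedBall 0 ρ) := by
    intro g hg t ht
    exact hg.comp (by fun_prop) fun y hy => hsub (hmem t ht y hy)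
  have hcont : ∀ t ∈ Ioo (-T) T, ContinuousOn (fun y : En n => u (t • y)) (closedBall 0 ρ) :=
    fun t ht => hscale hu.continuousOn t ht
  have hp : ∀ i, ContDiffOn ℝ 1 (partialDeriv1 i u) (ball 0 R) := fun i =>
    hu.partialDeriv1 isOpen_ball (by norm_num) i
  have hintg : ∀ t ∈ Ioo (-T) T, ∀ i : Fin n,
      Integrable fun y : En n => partialDeriv1 i u (t • y) * y i * radial η y := by
    intro t ht i
    refine integrable_continuousOn_mul_radial hρ.le h ?_
    exact (hscale (hp i).continuousOn t ht).mul (by fun_prop)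
  have hderiv : ∀ t ∈ Ioo (-T) T,
      HasDerivAt (fun s : ℝ => ∫ y : En n, u (s • y) * radial η y) 0 t := by
    intro t ht
    have key := hasDerivAt_integral_of_dominated_loc_of_deriv_le (μ := volume)
      (F := fun (s : ℝ) (y : En n) => u (s • y) * radial η y)
      (F' := fun (s : ℝ) (y : En n) => ∑ i, partialDeriv1 i u (s • y) * y i * radial η y)
      (x₀ := t) (s := Ioo (-T) T) (bound := fun y => C * ρ * |radial η y|)
      (isOpen_Ioo.mem_nhds ht) ?_ ?_ ?_ ?_ ?_ ?_
    · have e0 : ∫ y : En n, ∑ i, partialDeriv1 i u (t • y) * y i * radial η y = 0 := by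
        rw [integral_finsetSum _ fun i _ => hintg t ht i]
        have e1 : ∀ i : Fin n, 2 * ∫ y : En n, partialDeriv1 i u (t • y) * y i * radial η y
            = ∫ y : En n, t * partialDeriv1 i (partialDeriv1 i u) (t • y)
                * radial (profileTail η (ρ ^ 2)) y := by
          intro i
          have hV : IsOpen {y : En n | t • y ∈ ball (0 : En n) R} :=
            isOpen_ball.preimage (by fun_prop)
          have hsubV : closedBall (0 : En n) ρ ⊆ {y : En n | t • y ∈ ball (0 : En n) R} :=
            fun y hy => hsub (hmem t ht y hy)
          rw [← h.integral_partialDeriv1_mul_tail hρ.le hV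
            (f := fun y => partialDeriv1 i u (t • y))
            ((hp i).comp (contDiff_const_smul t).contDiffOn fun y hy => hy) hsubV]
          congr 1
          ext y
          by_cases hy : y ∈ closedBall (0 : En n) ρ
          · rw [partialDeriv1_comp_smul]
            exact ((hp i).differentiableOn one_ne_zero).differentiableAt
              (isOpen_ball.mem_nhds (hsubV hy))
          · rw [h.tail.radial_eq_zero hρ.le y fun hy' => hy (ball_subset_closedBall hy')]
            simp
        have e2 : 2 * ∑ i : Fin n, ∫ y : En n, partialDeriv1 i u (t • y) * y i * radial η y = 0 := by
          rw [Finset.mul_sum, Finset.sum_congr rfl fun i _ => e1 i]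
          rw [← integral_finsetSum]
          · rw [← integral_zero (En n) ℝ]
            congr 1
            ext y
            by_cases hy : y ∈ closedBall (0 : En n) ρ
            · rw [← Finset.sum_mul, ← Finset.mul_sum, hlap _ (hsub (hmem t ht y hy))]
              simp
            · rw [h.tail.radial_eq_zero hρ.le y fun hy' => hy (ball_subset_closedBall hy')]
              simp
          · intro i _
            refine integrable_continuousOn_mul_radial hρ.le h.tail ?_
            refine continuousOn_const.mul (hscale (g := partialDeriv1 i (partialDeriv1 i u)) ?_ t ht)
            exact ((hp i).partialDeriv1 isOpen_ball (m := 0) (by norm_num) i).continuousOn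
        linarith
      rw [← e0]
      exact key.2
    · filter_upwards [isOpen_Ioo.mem_nhds ht] with s hs
      exact (integrable_continuousOn_mul_radial hρ.le h (hcont s hs)).aestronglyMeasurable
    · exact integrable_continuousOn_mul_radial hρ.le h (hcont t ht)
    · exact (integrable_finsetSum _ fun i _ => hintg t ht i).aestronglyMeasurable
    · refine ae_of_all _ fun y s hs => ?_
      by_cases hy : y ∈ closedBall (0 : En n) ρ
      · have : ∑ i, partialDeriv1 i u (s • y) * y i * radial η y
            = fderiv ℝ u (s • y) y * radial η y := by
          rw [fderiv_apply_eq_sum_partialDeriv1, Finset.sum_mul]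
          exact Finset.sum_congr rfl fun i _ => by ring
        rw [this, norm_mul, Real.norm_eq_abs (radial η y)]
        gcongr
        refine ((fderiv ℝ u (s • y)).le_opNorm y).trans ?_
        have h1 := hC _ (hmem s hs y hy)
        have h2 : ‖y‖ ≤ ρ := by simpa using hy
        have h3 : 0 ≤ C := (norm_nonneg _).trans h1
        gcongr
      · simp [hz y hy]
    · exact (h.integrable_radial hρ.le).abs.const_mul _
    · refine ae_of_all _ fun y s hs => ?_
      by_cases hy : y ∈ closedBall (0 : En n) ρ
      · have hd : HasFDerivAt u (fderiv ℝ u (s • y)) (s • y) :=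
          ((hu.differentiableOn two_ne_zero).differentiableAt
            (isOpen_ball.mem_nhds (hsub (hmem s hs y hy)))).hasFDerivAt
        have hs' : HasDerivAt (fun s : ℝ => s • y) y s := by
          simpa using (hasDerivAt_id s).smul_const y
        have h4 := (hd.comp_hasDerivAt s hs').mul_const (radial η y)
        have h5 : fderiv ℝ u (s • y) y * radial η y
            = ∑ i, partialDeriv1 i u (s • y) * y i * radial η y := by
          rw [fderiv_apply_eq_sum_partialDeriv1, Finset.sum_mul]
          exact Finset.sum_congr rfl fun i _ => by ring
        rw [h5] at h4
        exact h4
      · simp only [hz y hy, mul_zero, Finset.sum_const_zero]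
        exact hasDerivAt_const _ _
  have hconst := isOpen_Ioo.is_const_of_deriv_eq_zero isPreconnected_Ioo
    (fun t ht => (hderiv t ht).differentiableAt.differentiableWithinAt)
    (fun t ht => (hderiv t ht).deriv) (x := 1) (y := 0) ⟨by linarith, hT1⟩
    ⟨by linarith, by linarith⟩
  simpa [integral_const_mul] using hconst

/-! ### Smoothness of harmonic functions and derivative estimates -/

/-- Smooth harmonic functions on an open set, in terms of iterated partial derivatives. -/
structure IsHarm {n : ℕ} (u : En n → ℝ) (U : Set (En n)) : Prop where
  isOpen : IsOpen U
  contDiffOn : ContDiffOn ℝ ∞ u U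
  lap : ∀ x ∈ U, ∑ i, partialDeriv1 i (partialDeriv1 i u) x = 0

/-- A smooth profile equal to `1` on `(-∞, ρ² / 2]` and vanishing on `[ρ², ∞)`. -/
def bumpProfile (ρ : ℝ) : ℝ → ℝ := fun s => Real.smoothTransition (2 - 2 * s / ρ ^ 2)

theorem contDiff_bumpProfile (ρ : ℝ) : ContDiff ℝ ∞ (bumpProfile ρ) :=
  Real.smoothTransition.contDiff.comp (by fun_prop)

theorem isRadialProfile_bumpProfile {ρ : ℝ} (hρ : 0 < ρ) :
    IsRadialProfile (bumpProfile ρ) (ρ ^ 2) := by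
  refine ⟨(contDiff_bumpProfile ρ).continuous, fun s hs => ?_⟩
  apply Real.smoothTransition.zero_of_nonpos
  have : 1 ≤ s / ρ ^ 2 := by rwa [one_le_div (by positivity)]
  rw [mul_div_assoc]
  linarith

theorem bumpProfile_eq_one {ρ s : ℝ} (hρ : 0 < ρ) (hs : s ≤ ρ ^ 2 / 2) : bumpProfile ρ s = 1 := by
  apply Real.smoothTransition.one_of_one_le
  have : s / ρ ^ 2 ≤ 1 / 2 := by rw [div_le_iff₀ (by positivity)]; linarith
  rw [mul_div_assoc]
  linarith

theorem bumpProfile_nonneg (ρ s : ℝ) : 0 ≤ bumpProfile ρ s := Real.smoothTransition.nonneg _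

theorem bumpProfile_le_one (ρ s : ℝ) : bumpProfile ρ s ≤ 1 := Real.smoothTransition.le_one _

theorem radial_bumpProfile_eq_one {n : ℕ} {ρ : ℝ} (hρ : 0 < ρ) {y : En n} (hy : ‖y‖ ≤ ρ / 2) :
    radial (bumpProfile ρ) y = 1 := by
  refine bumpProfile_eq_one hρ ?_
  calc ‖y‖ ^ 2 ≤ (ρ / 2) ^ 2 := by gcongr
    _ ≤ ρ ^ 2 / 2 := by nlinarith [sq_nonneg ρ]

/-- The volume of the unit ball. -/
def unitBallVol (n : ℕ) : ℝ := volume.real (ball (0 : En n) 1)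

theorem unitBallVol_pos (n : ℕ) : 0 < unitBallVol n :=
  ENNReal.toReal_pos (measure_ball_pos _ _ one_pos).ne' measure_ball_lt_top.ne

theorem volume_real_ball {n : ℕ} (x : En n) {r : ℝ} (hr : 0 < r) :
    volume.real (ball x r) = r ^ n * unitBallVol n := by
  unfold unitBallVol Measure.real
  rw [Measure.addHaar_ball_of_pos _ _ hr, ENNReal.toReal_mul,
    ENNReal.toReal_ofReal (by positivity), finrank_euclideanSpace_fin]

theorem integral_indicator_ball {n : ℕ} (x : En n) {r : ℝ} (hr : 0 < r) (c : ℝ) :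
    ∫ y, (ball x r).indicator (fun _ => c) y = c * (r ^ n * unitBallVol n) := by
  rw [integral_indicator isOpen_ball.measurableSet, setIntegral_const, volume_real_ball x hr,
    smul_eq_mul, mul_comm]

theorem integrable_indicator_ball {n : ℕ} (x : En n) (r : ℝ) (c : ℝ) :
    Integrable ((ball x r).indicator (fun _ => c)) :=
  (integrable_indicator_iff isOpen_ball.measurableSet).2
    (integrableOn_const measure_ball_lt_top.ne)

theorem integral_bump_le {n : ℕ} {ρ : ℝ} (hρ : 0 < ρ) :
    ∫ y : En n, radial (bumpProfile ρ) y ≤ ρ ^ n * unitBallVol n := by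
  have hη := isRadialProfile_bumpProfile hρ
  rw [← one_mul (ρ ^ n * _), ← integral_indicator_ball 0 hρ 1]
  refine integral_mono (hη.integrable_radial hρ.le) (integrable_indicator_ball _ _ _) fun y => ?_
  by_cases hy : y ∈ ball (0 : En n) ρ
  · rw [indicator_of_mem hy]
    exact bumpProfile_le_one _ _
  · rw [indicator_of_notMem hy, hη.radial_eq_zero hρ.le y hy]

theorem le_integral_bump {n : ℕ} {ρ : ℝ} (hρ : 0 < ρ) :
    (ρ / 2) ^ n * unitBallVol n ≤ ∫ y : En n, radial (bumpProfile ρ) y := by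
  have hη := isRadialProfile_bumpProfile hρ
  rw [← one_mul ((ρ / 2) ^ n * _), ← integral_indicator_ball 0 (half_pos hρ) 1]
  refine integral_mono (integrable_indicator_ball _ _ _) (hη.integrable_radial hρ.le) fun y => ?_
  by_cases hy : y ∈ ball (0 : En n) (ρ / 2)
  · rw [indicator_of_mem hy, radial_bumpProfile_eq_one hρ (by simpa using (mem_ball.1 hy).le)]
  · rw [indicator_of_notMem hy]
    exact bumpProfile_nonneg _ _

theorem integral_bump_pos {n : ℕ} {ρ : ℝ} (hρ : 0 < ρ) :
    0 < ∫ y : En n, radial (bumpProfile ρ) y :=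
  lt_of_lt_of_le (by have := unitBallVol_pos n; positivity) (le_integral_bump hρ)

theorem ContDiffOn.comp_add_left {n : ℕ} {k : WithTop ℕ∞} {u : En n → ℝ} {U : Set (En n)}
    (hu : ContDiffOn ℝ k u U) (a : En n) : ContDiffOn ℝ k (fun y => u (a + y)) {y | a + y ∈ U} :=
  hu.comp (by fun_prop) fun _ hy => hy

theorem integral_translate_mul_radial {n : ℕ} {η : ℝ → ℝ} {ρ R : ℝ} (hρ : 0 < ρ) (hR : ρ < R)
    (h : IsRadialProfile η (ρ ^ 2)) {u : En n → ℝ} {x : En n} (hu : ContDiffOn ℝ 2 u (ball x R))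
    (hlap : ∀ y ∈ ball x R, ∑ i, partialDeriv1 i (partialDeriv1 i u) y = 0) :
    ∫ y, u (x + y) * radial η y = u x * ∫ y : En n, radial η y := by
  have hb : ∀ y ∈ ball (0 : En n) R, x + y ∈ ball x R := by
    intro y hy
    simpa [mem_ball, dist_eq_norm] using hy
  have := integral_mul_radial_of_harmonic (u := fun y => u (x + y)) hρ hR h
    ((hu.comp_add_left x).mono hb) ?_
  · simpa using this
  · intro y hy
    simp only [partialDeriv1_comp_add]
    exact hlap _ (hb y hy)

theorem contDiff_radial_bumpProfile {n : ℕ} (ρ : ℝ) :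
    ContDiff ℝ ∞ (radial (bumpProfile ρ) : En n → ℝ) :=
  (contDiff_bumpProfile ρ).comp (contDiff_norm_sq ℝ)

theorem contDiffOn_top_of_harmonic {n : ℕ} {u : En n → ℝ} {U : Set (En n)} (hU : IsOpen U)
    (hu : ContDiffOn ℝ 2 u U)
    (hlap : ∀ y ∈ U, ∑ i, partialDeriv1 i (partialDeriv1 i u) y = 0) : ContDiffOn ℝ ∞ u U := by
  intro x hx
  obtain ⟨ε, hε, hεU⟩ := Metric.isOpen_iff.1 hU x hx
  have hη := isRadialProfile_bumpProfile (ρ := ε / 4) (by positivity)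
  set K : En n → ℝ := radial (bumpProfile (ε / 4)) with hK
  set f : En n → ℝ := (closedBall x (ε / 2)).indicator u with hf
  have hKs : HasCompactSupport K := by
    refine HasCompactSupport.of_support_subset_isCompact (isCompact_closedBall (0 : En n) (ε / 4)) ?_
    intro y hy
    by_contra hy'
    exact hy (hη.radial_eq_zero (by positivity) y fun h => hy' (ball_subset_closedBall h))
  have hfi : LocallyIntegrable f := by
    refine Integrable.locallyIntegrable ?_
    rw [hf, integrable_indicator_iff isClosed_closedBall.measurableSet]
    refine (hu.continuousOn.mono ?_).integrableOn_compact (isCompact_closedBall _ _)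
    exact (closedBall_subset_ball (by linarith)).trans hεU
  have hconv := hKs.contDiff_convolution_right (μ := volume) (n := ⊤)
    (ContinuousLinearMap.mul ℝ ℝ) hfi (contDiff_radial_bumpProfile (ε / 4))
  have heq : ∀ z ∈ ball x (ε / 4),
      convolution f K (ContinuousLinearMap.mul ℝ ℝ) volume z = u z * ∫ y : En n, K y := by
    intro z hz
    have hsub : ball z (ε / 2) ⊆ U := by
      refine Subset.trans (ball_subset_ball' ?_) hεU
      have := mem_ball.1 hz
      linarith
    rw [hK, ← integral_translate_mul_radial (R := ε / 2) (by positivity) (by linarith) hη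
      (hu.mono hsub) fun y hy => hlap y (hsub hy), convolution_def,
      ← integral_add_left_eq_self _ z]
    congr 1
    ext y
    have hsymm : radial (bumpProfile (ε / 4)) (z - (z + y)) = radial (bumpProfile (ε / 4)) y := by
      simp [radial]
    simp only [ContinuousLinearMap.mul_apply', hsymm]
    by_cases hy : y ∈ ball (0 : En n) (ε / 4)
    · rw [hf, indicator_of_mem]
      rw [mem_closedBall, dist_eq_norm]
      have h1 := mem_ball_iff_norm.1 hz
      have h2 := mem_ball_zero_iff.1 hy
      calc ‖z + y - x‖ = ‖(z - x) + y‖ := by congr 1; abel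
        _ ≤ ‖z - x‖ + ‖y‖ := norm_add_le _ _
        _ ≤ ε / 2 := by linarith
    · rw [hη.radial_eq_zero (by positivity) y hy]
      simp
  have hpos := integral_bump_pos (n := n) (ρ := ε / 4) (by positivity)
  have h2 : ContDiffAt ℝ ∞ u x := by
    refine ((hconv.contDiffAt (x := x)).div_const (∫ y : En n, K y)).congr_of_eventuallyEq ?_
    filter_upwards [ball_mem_nhds x (show 0 < ε / 4 by positivity)] with z hz
    rw [heq z hz, mul_div_cancel_right₀ _ hpos.ne']
  exact h2.contDiffWithinAt

theorem HarmonicOnSet.isHarm {n : ℕ} {u : En n → ℝ} {U : Set (En n)} (hU : IsOpen U)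
    (hu : HarmonicOnSet u U) : IsHarm u U := by
  have hl : ∀ y ∈ U, ∑ i, partialDeriv1 i (partialDeriv1 i u) y = 0 := fun y hy => by
    rw [← laplacianAt_eq_sum hU hu.1 hy, hu.2 y hy]
  exact ⟨hU, contDiffOn_top_of_harmonic hU hu.1 hl, hl⟩

namespace IsHarm

variable {n : ℕ} {u : En n → ℝ} {U V : Set (En n)}

theorem mono (h : IsHarm u U) (hV : IsOpen V) (hVU : V ⊆ U) : IsHarm u V :=
  ⟨hV, h.contDiffOn.mono hVU, fun x hx => h.lap x (hVU hx)⟩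

theorem contDiffOn_nat (h : IsHarm u U) (k : ℕ) : ContDiffOn ℝ k u U :=
  h.contDiffOn.of_le (by exact_mod_cast le_top)

theorem contDiffOn_two (h : IsHarm u U) : ContDiffOn ℝ 2 u U := h.contDiffOn_nat 2

theorem contDiffOn_one (h : IsHarm u U) : ContDiffOn ℝ 1 u U := by simpa using h.contDiffOn_nat 1

theorem continuousOn (h : IsHarm u U) : ContinuousOn u U := h.contDiffOn.continuousOn

theorem differentiableAt (h : IsHarm u U) {x : En n} (hx : x ∈ U) : DifferentiableAt ℝ u x :=
  (h.contDiffOn_one.differentiableOn one_ne_zero).differentiableAt (h.isOpen.mem_nhds hx)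

theorem comp_add (h : IsHarm u U) (a : En n) (hV : IsOpen V) (hVU : ∀ y ∈ V, a + y ∈ U) :
    IsHarm (fun y => u (a + y)) V := by
  refine ⟨hV, (h.contDiffOn.comp_add_left a).mono hVU, fun x hx => ?_⟩
  simp only [partialDeriv1_comp_add]
  exact h.lap _ (hVU x hx)

theorem pderiv (h : IsHarm u U) (i : Fin n) : IsHarm (partialDeriv1 i u) U := by
  refine ⟨h.isOpen, h.contDiffOn.partialDeriv1 h.isOpen (by simp) i, fun x hx => ?_⟩
  have h3 := h.contDiffOn_nat 3
  have h2 : ∀ j, ContDiffOn ℝ 2 (partialDeriv1 j u) U := fun j =>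
    h3.partialDeriv1 h.isOpen (by norm_num) j
  have e : ∀ j, partialDeriv1 j (partialDeriv1 j (partialDeriv1 i u)) x
      = partialDeriv1 i (partialDeriv1 j (partialDeriv1 j u)) x := by
    intro j
    rw [partialDeriv1_congr h.isOpen (partialDeriv1_comm h.isOpen h.contDiffOn_two j i) j hx,
      partialDeriv1_comm h.isOpen (h2 j) j i hx]
  have hd : ∀ j, DifferentiableAt ℝ (partialDeriv1 j (partialDeriv1 j u)) x := fun j =>
    (((h2 j).partialDeriv1 h.isOpen (m := 1) (by norm_num) j).differentiableOn
      one_ne_zero).differentiableAt (h.isOpen.mem_nhds hx)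
  rw [Finset.sum_congr rfl fun j _ => e j]
  have h0 : fderiv ℝ (fun y => ∑ j, partialDeriv1 j (partialDeriv1 j u) y) x
      (EuclideanSpace.single i 1) = fderiv ℝ (fun _ => (0 : ℝ)) x (EuclideanSpace.single i 1) :=
    partialDeriv1_congr h.isOpen (fun y hy => h.lap y hy) i hx
  rw [fderiv_fun_sum fun j _ => hd j] at h0
  simpa [partialDeriv1] using h0

theorem integral_mul_radial (h : IsHarm u U) {η : ℝ → ℝ} {ρ R : ℝ} (hρ : 0 < ρ) (hR : ρ < R)
    (hη : IsRadialProfile η (ρ ^ 2)) {x : En n} (hx : ball x R ⊆ U) :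
    ∫ y, u (x + y) * radial η y = u x * ∫ y : En n, radial η y :=
  integral_translate_mul_radial hρ hR hη (h.contDiffOn_two.mono hx) fun y hy => h.lap y (hx hy)

end IsHarm

theorem le_integral_radial {n : ℕ} {η : ℝ → ℝ} {ρ r c : ℝ} (hρ : 0 ≤ ρ) (hr : 0 < r)
    (hη : IsRadialProfile η (ρ ^ 2)) (h0 : ∀ s, 0 ≤ η s) (hc : ∀ s, s ≤ r ^ 2 → c ≤ η s) :
    c * (r ^ n * unitBallVol n) ≤ ∫ y : En n, radial η y := by
  rw [← integral_indicator_ball 0 hr c]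
  refine integral_mono (integrable_indicator_ball _ _ _) (hη.integrable_radial hρ) fun y => ?_
  by_cases hy : y ∈ ball (0 : En n) r
  · rw [indicator_of_mem hy]
    refine hc _ ?_
    have := (mem_ball_zero_iff.1 hy).le
    gcongr
  · rw [indicator_of_notMem hy]
    exact h0 _

theorem tail_bumpProfile_nonneg {ρ : ℝ} (hρ : 0 < ρ) (s : ℝ) :
    0 ≤ profileTail (bumpProfile ρ) (ρ ^ 2) s := by
  rcases le_total s (ρ ^ 2) with hs | hs
  · exact intervalIntegral.integral_nonneg hs fun t _ => bumpProfile_nonneg _ _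
  · exact ((isRadialProfile_bumpProfile hρ).tail.eq_zero s hs).ge

theorem le_tail_bumpProfile {ρ : ℝ} (hρ : 0 < ρ) {s : ℝ} (hs : s ≤ (ρ / 2) ^ 2) :
    ρ ^ 2 / 4 ≤ profileTail (bumpProfile ρ) (ρ ^ 2) s := by
  have hc := (contDiff_bumpProfile ρ).continuous
  have h2 : 0 < ρ ^ 2 := by positivity
  have h1 : profileTail (bumpProfile ρ) (ρ ^ 2) s
      = (∫ t in s..ρ ^ 2 / 2, bumpProfile ρ t) + ∫ t in (ρ ^ 2 / 2)..ρ ^ 2, bumpProfile ρ t :=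
    (intervalIntegral.integral_add_adjacent_intervals (hc.intervalIntegrable _ _)
      (hc.intervalIntegrable _ _)).symm
  have h3 : 0 ≤ ∫ t in (ρ ^ 2 / 2)..ρ ^ 2, bumpProfile ρ t :=
    intervalIntegral.integral_nonneg (by linarith) fun t _ => bumpProfile_nonneg _ _
  have h4 : ∫ t in s..ρ ^ 2 / 2, bumpProfile ρ t = ∫ t in s..ρ ^ 2 / 2, (1 : ℝ) := by
    refine intervalIntegral.integral_congr fun t ht => ?_
    rw [uIcc_of_le (by nlinarith)] at ht
    exact bumpProfile_eq_one hρ ht.2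
  rw [h1, h4, intervalIntegral.integral_const, smul_eq_mul]
  nlinarith

/-- The constant in the interior gradient estimate. -/
def gradConst (n : ℕ) : ℝ := 16 * 2 ^ n

theorem gradConst_pos (n : ℕ) : 0 < gradConst n := by unfold gradConst; positivity

theorem abs_apply_le_norm {n : ℕ} (y : En n) (i : Fin n) : |y i| ≤ ‖y‖ := by
  simpa using PiLp.norm_apply_le y i

namespace IsHarm

variable {n : ℕ} {u : En n → ℝ} {U V : Set (En n)}

theorem abs_partialDeriv1_le (h : IsHarm u U) {x : En n} {ρ M : ℝ} (hρ : 0 < ρ)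
    (hx : ball x ρ ⊆ U) (hM : ∀ y ∈ ball x ρ, |u y| ≤ M) (i : Fin n) :
    |partialDeriv1 i u x| ≤ gradConst n / ρ * M := by
  obtain ⟨r, hr⟩ : ∃ r, r = ρ / 2 := ⟨_, rfl⟩
  have hr0 : 0 < r := by linarith
  have hη := isRadialProfile_bumpProfile hr0
  have hb : ∀ y ∈ ball (0 : En n) ρ, x + y ∈ ball x ρ := by
    intro y hy
    simpa [mem_ball, dist_eq_norm] using hy
  have hu' : ContDiffOn ℝ 1 (fun y => u (x + y)) (ball 0 ρ) :=
    (h.contDiffOn_one.comp_add_left x).mono fun y hy => hx (hb y hy)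
  have hsub : closedBall (0 : En n) r ⊆ ball 0 ρ := closedBall_subset_ball (by linarith)
  have e1 := (h.pderiv i).integral_mul_radial (R := ρ) hr0 (by linarith) hη.tail hx
  have e2 := hη.integral_partialDeriv1_mul_tail hr0.le isOpen_ball hu' hsub i
  simp only [partialDeriv1_comp_add] at e2
  rw [e1] at e2
  have hM0 : 0 ≤ M := (abs_nonneg _).trans (hM x (mem_ball_self hρ))
  have h3 : |∫ y : En n, u (x + y) * y i * radial (bumpProfile r) y|
      ≤ M * r * (r ^ n * unitBallVol n) := by
    refine (abs_integral_le_integral_abs).trans ?_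
    refine le_trans ?_ (mul_le_mul_of_nonneg_left (integral_bump_le hr0) (by positivity))
    rw [← integral_const_mul]
    refine integral_mono_of_nonneg (ae_of_all _ fun y => abs_nonneg _)
      ((hη.integrable_radial hr0.le).const_mul _) (ae_of_all _ fun y => ?_)
    have hpos : 0 ≤ radial (bumpProfile r) y := bumpProfile_nonneg _ _
    by_cases hy : y ∈ ball (0 : En n) r
    · have h1 := hM _ (hb y (hsub (ball_subset_closedBall hy)))
      have h2 := (abs_apply_le_norm y i).trans (mem_ball_zero_iff.1 hy).le
      simp only [abs_mul, abs_of_nonneg hpos]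
      gcongr
    · simp [hη.radial_eq_zero hr0.le y hy]
  have h4 : r ^ 2 / 4 * ((r / 2) ^ n * unitBallVol n)
      ≤ ∫ y : En n, radial (profileTail (bumpProfile r) (r ^ 2)) y :=
    le_integral_radial hr0.le (half_pos hr0) hη.tail (tail_bumpProfile_nonneg hr0)
      fun s hs => le_tail_bumpProfile hr0 hs
  have h5 : |partialDeriv1 i u x| * (r ^ 2 / 4 * ((r / 2) ^ n * unitBallVol n))
      ≤ 2 * (M * r * (r ^ n * unitBallVol n)) := by
    calc _ ≤ |partialDeriv1 i u x| * ∫ y : En n, radial (profileTail (bumpProfile r) (r ^ 2)) y := by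
          gcongr
      _ = |2 * ∫ y : En n, u (x + y) * y i * radial (bumpProfile r) y| := by
          rw [← e2, abs_mul]
          congr 1
          refine (abs_of_nonneg (le_trans ?_ h4)).symm
          have := unitBallVol_pos n
          positivity
      _ ≤ _ := by
          rw [abs_mul, abs_two]
          gcongr
  have hκ := unitBallVol_pos n
  have hp : 0 < r * (r ^ n * unitBallVol n) / (4 * 2 ^ n) := by positivity
  have h6 : |partialDeriv1 i u x| * r * (r * (r ^ n * unitBallVol n) / (4 * 2 ^ n))
      ≤ 8 * 2 ^ n * M * (r * (r ^ n * unitBallVol n) / (4 * 2 ^ n)) := by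
    rw [div_pow] at h5
    convert h5 using 1
    · field_simp
    · field_simp; ring
  have h7 := le_of_mul_le_mul_right h6 hp
  rw [gradConst, div_mul_eq_mul_div, le_div_iff₀ hρ]
  calc _ = 2 * (|partialDeriv1 i u x| * r) := by rw [hr]; ring
    _ ≤ 2 * (8 * 2 ^ n * M) := by gcongr
    _ = _ := by ring

theorem abs_le_setIntegral (h : IsHarm u U) {x : En n} {ρ : ℝ} (hρ : 0 < ρ)
    (hx : ball x ρ ⊆ U) (hintg : IntegrableOn u (ball x ρ)) :
    |u x| * ((ρ / 4) ^ n * unitBallVol n) ≤ ∫ y in ball x ρ, |u y| := by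
  obtain ⟨r, hr⟩ : ∃ r, r = ρ / 2 := ⟨_, rfl⟩
  have hr0 : 0 < r := by linarith
  have hη := isRadialProfile_bumpProfile hr0
  have e1 := h.integral_mul_radial (R := ρ) hr0 (by linarith) hη hx
  have h1 := le_integral_bump (n := n) hr0
  have hb : ∀ y : En n, x + y ∈ ball x ρ ↔ y ∈ ball (0 : En n) ρ := by
    intro y
    simp [mem_ball, dist_eq_norm]
  calc |u x| * ((ρ / 4) ^ n * unitBallVol n)
      ≤ |u x| * ∫ y : En n, radial (bumpProfile r) y := by
        rw [show ρ / 4 = r / 2 by rw [hr]; ring]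
        gcongr
    _ = |∫ y, u (x + y) * radial (bumpProfile r) y| := by
        rw [e1, abs_mul, abs_of_pos (integral_bump_pos hr0)]
    _ ≤ ∫ y, (ball x ρ).indicator (fun y => |u y|) (x + y) := by
        refine (abs_integral_le_integral_abs).trans ?_
        refine integral_mono_of_nonneg (ae_of_all _ fun y => abs_nonneg _) ?_
          (ae_of_all _ fun y => ?_)
        · exact ((integrable_indicator_iff isOpen_ball.measurableSet).2 hintg.abs).comp_add_left x
        · have hpos : 0 ≤ radial (bumpProfile r) y := bumpProfile_nonneg _ _
          have hle : radial (bumpProfile r) y ≤ 1 := bumpProfile_le_one _ _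
          by_cases hy : y ∈ ball (0 : En n) r
          · beta_reduce
            rw [indicator_of_mem ((hb y).2 (ball_subset_ball (by linarith) hy))]
            simp only [abs_mul, abs_of_nonneg hpos]
            exact mul_le_of_le_one_right (abs_nonneg _) hle
          · simp only [hη.radial_eq_zero hr0.le y hy, mul_zero, abs_zero]
            exact indicator_nonneg (fun _ _ => abs_nonneg _) _
    _ = _ := by
        rw [integral_add_left_eq_self (fun y => (ball x ρ).indicator (fun y => |u y|) y) x,
          integral_indicator isOpen_ball.measurableSet]

end IsHarm

/-- The iterated partial derivative along a list of coordinate directions. -/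
def partialDerivList {n : ℕ} (l : List (Fin n)) (u : En n → ℝ) : En n → ℝ :=
  l.foldr partialDeriv1 u

@[simp] theorem partialDerivList_nil {n : ℕ} (u : En n → ℝ) : partialDerivList [] u = u := rfl

@[simp] theorem partialDerivList_cons {n : ℕ} (i : Fin n) (l : List (Fin n)) (u : En n → ℝ) :
    partialDerivList (i :: l) u = partialDeriv1 i (partialDerivList l u) := rfl

theorem partialDerivList_append {n : ℕ} (l l' : List (Fin n)) (u : En n → ℝ) :
    partialDerivList (l ++ l') u = partialDerivList l (partialDerivList l' u) :=
  List.foldr_append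

/-- The constant in the interior estimates for higher derivatives. -/
def derivConst (n : ℕ) : ℝ := 2 * gradConst n * Real.exp 1

theorem derivConst_pos (n : ℕ) : 0 < derivConst n := by
  have := gradConst_pos n
  unfold derivConst
  positivity

namespace IsHarm

variable {n : ℕ} {u : En n → ℝ} {U V : Set (En n)}

theorem pderivList (h : IsHarm u U) (l : List (Fin n)) : IsHarm (partialDerivList l u) U := by
  induction l with
  | nil => exact h
  | cons i l ih => exact ih.pderiv i

theorem abs_partialDerivList_le_aux (h : IsHarm u U) {x : En n} {ρ M δ : ℝ} (hδ : 0 < δ)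
    (hx : ball x ρ ⊆ U) (hM : ∀ y ∈ ball x ρ, |u y| ≤ M) (l : List (Fin n)) :
    ∀ y ∈ ball x (ρ - l.length * δ),
      |partialDerivList l u y| ≤ (gradConst n / δ) ^ l.length * M := by
  induction l with
  | nil => simpa using hM
  | cons i l ih =>
    intro y hy
    have hy' := mem_ball.1 hy
    push_cast [List.length_cons] at hy'
    have hsub : ball y δ ⊆ ball x (ρ - l.length * δ) := ball_subset_ball' (by linarith)
    have hsub2 : ball x (ρ - l.length * δ) ⊆ U :=
      (ball_subset_ball (by nlinarith [(Nat.cast_nonneg l.length : (0 : ℝ) ≤ _)])).trans hx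
    have := (h.pderivList l).abs_partialDeriv1_le hδ (hsub.trans hsub2)
      (fun z hz => ih z (hsub hz)) i
    rw [List.length_cons, pow_succ', mul_assoc]
    exact this

theorem abs_partialDerivList_le (h : IsHarm u U) {x : En n} {ρ M : ℝ} (hρ : 0 < ρ)
    (hx : ball x ρ ⊆ U) (hM : ∀ y ∈ ball x ρ, |u y| ≤ M) (l : List (Fin n)) :
    ∀ y ∈ ball x (ρ / 2),
      |partialDerivList l u y| ≤ l.length.factorial * (derivConst n / ρ) ^ l.length * M := by
  intro y hy
  have hM0 : 0 ≤ M := (abs_nonneg _).trans (hM x (mem_ball_self hρ))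
  rcases Nat.eq_zero_or_pos l.length with h0 | hpos
  · rw [List.length_eq_zero_iff] at h0
    subst h0
    simpa using hM y (ball_subset_ball (by linarith) hy)
  have hk : (0 : ℝ) < l.length := by exact_mod_cast hpos
  have hg := gradConst_pos n
  have h1 := h.abs_partialDerivList_le_aux (δ := ρ / (2 * l.length)) (by positivity) hx hM l y
    (by
      have : ρ - l.length * (ρ / (2 * l.length)) = ρ / 2 := by field_simp; ring
      rwa [this])
  refine h1.trans ?_
  gcongr
  have h2 := Real.pow_div_factorial_le_exp (l.length : ℝ) hk.le l.length
  rw [div_le_iff₀ (by positivity)] at h2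
  have h3 : Real.exp (l.length : ℝ) = Real.exp 1 ^ l.length := by
    rw [← Real.exp_nat_mul, mul_one]
  calc (gradConst n / (ρ / (2 * l.length))) ^ l.length
      = (2 * gradConst n / ρ) ^ l.length * (l.length : ℝ) ^ l.length := by
        rw [← mul_pow]; congr 1; field_simp
    _ ≤ (2 * gradConst n / ρ) ^ l.length * (Real.exp 1 ^ l.length * l.length.factorial) := by
        rw [← h3]; gcongr
    _ = _ := by rw [derivConst]; ring

end IsHarm

/-! ### Weighted coefficient norms of polynomials -/

/-- The weighted `ℓ¹` norm `∑ |c_β| w^β` of the coefficients of a polynomial. -/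
def wnorm {n : ℕ} (w : Fin n → ℝ) (q : MvPolynomial (Fin n) ℝ) : ℝ :=
  ∑ β ∈ q.support, |q.coeff β| * ∏ i, w i ^ β i

/-- Polynomials as functions on Euclidean space. -/
def peval {n : ℕ} (q : MvPolynomial (Fin n) ℝ) (x : En n) : ℝ :=
  MvPolynomial.eval (fun i => x i) q

section wnorm

variable {n : ℕ} {w : Fin n → ℝ}

theorem wnorm_eq_sum_of_support_subset (w : Fin n → ℝ) {q : MvPolynomial (Fin n) ℝ}
    {S : Finset (Fin n →₀ ℕ)} (hS : q.support ⊆ S) :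
    wnorm w q = ∑ β ∈ S, |q.coeff β| * ∏ i, w i ^ β i := by
  refine Finset.sum_subset hS fun _ _ hβ => ?_
  rw [MvPolynomial.notMem_support_iff.1 hβ]
  simp

theorem wnorm_nonneg (hw : ∀ i, 0 ≤ w i) (q : MvPolynomial (Fin n) ℝ) : 0 ≤ wnorm w q :=
  Finset.sum_nonneg fun _ _ =>
    mul_nonneg (abs_nonneg _) (Finset.prod_nonneg fun i _ => pow_nonneg (hw i) _)

@[simp] theorem wnorm_zero : wnorm w 0 = 0 := by simp [wnorm]

theorem wnorm_monomial (β : Fin n →₀ ℕ) (c : ℝ) :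
    wnorm w (MvPolynomial.monomial β c) = |c| * ∏ i, w i ^ β i := by
  rw [wnorm_eq_sum_of_support_subset w MvPolynomial.support_monomial_subset]
  simp

theorem wnorm_C (c : ℝ) : wnorm w (MvPolynomial.C c) = |c| := by
  rw [MvPolynomial.C_apply, wnorm_monomial]
  simp

theorem wnorm_X (i : Fin n) : wnorm w (MvPolynomial.X i) = w i := by
  rw [MvPolynomial.X, wnorm_monomial, Finset.prod_eq_single i]
  · simp
  · intro j _ hj
    simp [hj.symm]
  · simp

theorem wnorm_add_le (hw : ∀ i, 0 ≤ w i) (p q : MvPolynomial (Fin n) ℝ) :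
    wnorm w (p + q) ≤ wnorm w p + wnorm w q := by
  classical
  rw [wnorm_eq_sum_of_support_subset w (MvPolynomial.support_add (p := p) (q := q)),
    wnorm_eq_sum_of_support_subset w (Finset.subset_union_left (s₁ := p.support) (s₂ := q.support)),
    wnorm_eq_sum_of_support_subset w (Finset.subset_union_right (s₁ := p.support) (s₂ := q.support)),
    ← Finset.sum_add_distrib]
  refine Finset.sum_le_sum fun β _ => ?_
  rw [← add_mul, MvPolynomial.coeff_add]
  exact mul_le_mul_of_nonneg_right (abs_add_le _ _)
    (Finset.prod_nonneg fun i _ => pow_nonneg (hw i) _)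

theorem wnorm_neg (q : MvPolynomial (Fin n) ℝ) : wnorm w (-q) = wnorm w q := by
  simp [wnorm]

theorem wnorm_sub_le (hw : ∀ i, 0 ≤ w i) (p q : MvPolynomial (Fin n) ℝ) :
    wnorm w (p - q) ≤ wnorm w p + wnorm w q := by
  rw [sub_eq_add_neg, ← wnorm_neg q]
  exact wnorm_add_le hw _ _

theorem wnorm_sum_le (hw : ∀ i, 0 ≤ w i) {ι : Type*} (s : Finset ι)
    (f : ι → MvPolynomial (Fin n) ℝ) : wnorm w (∑ i ∈ s, f i) ≤ ∑ i ∈ s, wnorm w (f i) := by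
  classical
  induction s using Finset.induction_on with
  | empty => simp
  | insert a s ha ih =>
    rw [Finset.sum_insert ha, Finset.sum_insert ha]
    exact (wnorm_add_le hw _ _).trans (by gcongr)

theorem wnorm_mul_le (hw : ∀ i, 0 ≤ w i) (p q : MvPolynomial (Fin n) ℝ) :
    wnorm w (p * q) ≤ wnorm w p * wnorm w q := by
  conv_lhs => rw [← p.support_sum_monomial_coeff, ← q.support_sum_monomial_coeff,
    Finset.sum_mul_sum]
  refine (wnorm_sum_le hw _ _).trans ?_
  rw [wnorm, wnorm, Finset.sum_mul_sum]
  refine Finset.sum_le_sum fun β _ => (wnorm_sum_le hw _ _).trans ?_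
  refine Finset.sum_le_sum fun γ _ => le_of_eq ?_
  rw [MvPolynomial.monomial_mul, wnorm_monomial, abs_mul]
  simp only [Finsupp.add_apply, pow_add, Finset.prod_mul_distrib]
  ring

theorem le_wnorm_monomial_mul (hw : ∀ i, 0 ≤ w i) (β : Fin n →₀ ℕ) (c : ℝ)
    (q : MvPolynomial (Fin n) ℝ) :
    |c| * (∏ i, w i ^ β i) * wnorm w q ≤ wnorm w (MvPolynomial.monomial β c * q) := by
  classical
  have h1 : |c| * (∏ i, w i ^ β i) * wnorm w q
      = ∑ δ ∈ q.support.image (β + ·),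
          |(MvPolynomial.monomial β c * q).coeff δ| * ∏ i, w i ^ δ i := by
    rw [Finset.sum_image fun _ _ _ _ h => add_left_cancel h, wnorm, Finset.mul_sum]
    refine Finset.sum_congr rfl fun γ _ => ?_
    rw [MvPolynomial.coeff_monomial_mul, abs_mul]
    simp only [Finsupp.add_apply, pow_add, Finset.prod_mul_distrib]
    ring
  rw [h1, wnorm_eq_sum_of_support_subset w (Finset.subset_union_left
    (s₁ := (MvPolynomial.monomial β c * q).support) (s₂ := q.support.image (β + ·)))]
  refine Finset.sum_le_sum_of_subset_of_nonneg Finset.subset_union_right fun δ _ _ => ?_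
  exact mul_nonneg (abs_nonneg _) (Finset.prod_nonneg fun i _ => pow_nonneg (hw i) _)

theorem abs_eval_le_wnorm {x : Fin n → ℝ} (hx : ∀ i, |x i| ≤ w i) (q : MvPolynomial (Fin n) ℝ) :
    |MvPolynomial.eval x q| ≤ wnorm w q := by
  rw [MvPolynomial.eval_eq', wnorm]
  refine (Finset.abs_sum_le_sum_abs _ _).trans (Finset.sum_le_sum fun β _ => ?_)
  rw [abs_mul, Finset.abs_prod]
  refine mul_le_mul_of_nonneg_left (Finset.prod_le_prod (fun i _ => abs_nonneg _) fun i _ => ?_)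
    (abs_nonneg _)
  rw [abs_pow]
  exact pow_le_pow_left₀ (abs_nonneg _) (hx i) _

theorem abs_peval_le_wnorm {x : En n} (hx : ∀ i, |x i| ≤ w i) (q : MvPolynomial (Fin n) ℝ) :
    |peval q x| ≤ wnorm w q :=
  abs_eval_le_wnorm hx q

theorem wnorm_mono {w' : Fin n → ℝ} (hw : ∀ i, 0 ≤ w i) (h : ∀ i, w i ≤ w' i)
    (q : MvPolynomial (Fin n) ℝ) : wnorm w q ≤ wnorm w' q := by
  refine Finset.sum_le_sum fun β _ => mul_le_mul_of_nonneg_left ?_ (abs_nonneg _)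
  exact Finset.prod_le_prod (fun i _ => pow_nonneg (hw i) _) fun i _ =>
    pow_le_pow_left₀ (hw i) (h i) _

theorem sum_eq_of_mem_support {q : MvPolynomial (Fin n) ℝ} {j : ℕ} (hq : q.IsHomogeneous j)
    {β : Fin n →₀ ℕ} (hβ : β ∈ q.support) : ∑ i, β i = j := by
  have := hq (MvPolynomial.mem_support_iff.1 hβ)
  rw [← this, Finsupp.weight_apply, Finsupp.sum_fintype] <;> simp

theorem wnorm_smul_of_isHomogeneous {q : MvPolynomial (Fin n) ℝ} {j : ℕ}
    (hq : q.IsHomogeneous j) (t : ℝ) : wnorm (fun i => t * w i) q = t ^ j * wnorm w q := by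
  rw [wnorm, wnorm, Finset.mul_sum]
  refine Finset.sum_congr rfl fun β hβ => ?_
  simp only [mul_pow, Finset.prod_mul_distrib, Finset.prod_pow_eq_pow_sum,
    sum_eq_of_mem_support hq hβ]
  ring

theorem wnorm_eq_zero_iff (hw : ∀ i, 0 < w i) {q : MvPolynomial (Fin n) ℝ} :
    wnorm w q = 0 ↔ q = 0 := by
  refine ⟨fun h => ?_, fun h => by simp [h]⟩
  rw [wnorm, Finset.sum_eq_zero_iff_of_nonneg] at h
  · by_contra hq
    obtain ⟨β, hβ⟩ := MvPolynomial.support_nonempty.2 hq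
    have h1 := h β hβ
    have h2 : (0 : ℝ) < ∏ i, w i ^ β i := Finset.prod_pos fun i _ => pow_pos (hw i) _
    have h3 : q.coeff β = 0 := by simpa [h2.ne'] using h1
    exact MvPolynomial.mem_support_iff.1 hβ h3
  · intro β _
    exact mul_nonneg (abs_nonneg _) (Finset.prod_nonneg fun i _ => pow_nonneg (hw i).le _)

end wnorm

section peval

variable {n : ℕ}

@[simp] theorem peval_zero (x : En n) : peval 0 x = 0 := by simp [peval]

@[simp] theorem peval_C (c : ℝ) (x : En n) : peval (MvPolynomial.C c) x = c := by simp [peval]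

@[simp] theorem peval_X (i : Fin n) (x : En n) : peval (MvPolynomial.X i) x = x i := by
  simp [peval]

@[simp] theorem peval_add (p q : MvPolynomial (Fin n) ℝ) (x : En n) :
    peval (p + q) x = peval p x + peval q x := by simp [peval]

@[simp] theorem peval_sub (p q : MvPolynomial (Fin n) ℝ) (x : En n) :
    peval (p - q) x = peval p x - peval q x := by simp [peval]

@[simp] theorem peval_mul (p q : MvPolynomial (Fin n) ℝ) (x : En n) :
    peval (p * q) x = peval p x * peval q x := by simp [peval]

@[simp] theorem peval_sum {ι : Type*} (s : Finset ι) (f : ι → MvPolynomial (Fin n) ℝ) (x : En n) :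
    peval (∑ i ∈ s, f i) x = ∑ i ∈ s, peval (f i) x := by simp [peval]

theorem contDiff_peval (q : MvPolynomial (Fin n) ℝ) : ContDiff ℝ ∞ (peval q) := by
  induction q using MvPolynomial.induction_on with
  | C c =>
    have : peval (MvPolynomial.C c : MvPolynomial (Fin n) ℝ) = fun _ => c := by ext; simp
    rw [this]
    exact contDiff_const
  | add p q hp hq => simpa [funext (peval_add p q)] using hp.add hq
  | mul_X p i hp =>
    have : peval (p * MvPolynomial.X i) = fun x => peval p x * x i := by ext x; simp
    rw [this]
    exact hp.mul (by fun_prop)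

theorem continuous_peval (q : MvPolynomial (Fin n) ℝ) : Continuous (peval q) :=
  (contDiff_peval q).continuous

theorem differentiable_peval (q : MvPolynomial (Fin n) ℝ) : Differentiable ℝ (peval q) :=
  (contDiff_peval q).differentiable (by simp)

theorem partialDeriv1_peval (i : Fin n) (q : MvPolynomial (Fin n) ℝ) :
    partialDeriv1 i (peval q) = peval (MvPolynomial.pderiv i q) := by
  induction q using MvPolynomial.induction_on with
  | C c =>
    ext x
    have : peval (MvPolynomial.C c : MvPolynomial (Fin n) ℝ) = fun _ => c := by ext; simp
    simp [partialDeriv1, this]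
  | add p q hp hq =>
    ext x
    have h1 : peval (p + q) = fun x => peval p x + peval q x := funext (peval_add p q)
    rw [map_add, peval_add, ← hp, ← hq, h1, partialDeriv1,
      fderiv_fun_add (differentiable_peval p x) (differentiable_peval q x)]
    rfl
  | mul_X p j hp =>
    ext x
    have h1 : peval (p * MvPolynomial.X j) = fun x => peval p x * x j := by ext; simp
    have h2 : HasFDerivAt (fun x : En n => x j) (EuclideanSpace.proj j : En n →L[ℝ] ℝ) x :=
      (EuclideanSpace.proj j : En n →L[ℝ] ℝ).hasFDerivAt
    have h3 := ((differentiable_peval p x).hasFDerivAt.mul h2).fderiv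
    have h4 : fderiv ℝ (fun x => peval p x * x j) x (EuclideanSpace.single i 1)
      = peval p x * (EuclideanSpace.single i (1 : ℝ) : En n) j
        + x j * partialDeriv1 i (peval p) x := by
      have h3' : fderiv ℝ (fun x => peval p x * x j) x = _ := h3
      rw [h3']
      simp [partialDeriv1]
    rw [h1, partialDeriv1, h4, hp, Derivation.leibniz]
    by_cases hij : i = j
    · subst hij; simp
    · have hji : j ≠ i := fun h => hij h.symm
      simp [MvPolynomial.pderiv_X, hji]

theorem peval_smul_of_isHomogeneous {q : MvPolynomial (Fin n) ℝ} {j : ℕ}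
    (hq : q.IsHomogeneous j) (t : ℝ) (x : En n) : peval q (t • x) = t ^ j * peval q x := by
  rw [peval, peval, MvPolynomial.eval_eq', MvPolynomial.eval_eq', Finset.mul_sum]
  refine Finset.sum_congr rfl fun β hβ => ?_
  simp only [PiLp.smul_apply, smul_eq_mul, mul_pow, Finset.prod_mul_distrib,
    Finset.prod_pow_eq_pow_sum, sum_eq_of_mem_support hq hβ]
  ring

theorem peval_eq_zero_iff {q : MvPolynomial (Fin n) ℝ} : (∀ x, peval q x = 0) ↔ q = 0 := by
  refine ⟨fun h => MvPolynomial.funext fun x => ?_, fun h => by simp [h]⟩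
  simpa [peval] using h (WithLp.toLp 2 x)

end peval

/-! ### Taylor polynomials -/

/-- The homogeneous Taylor polynomial of degree `j` of `u` at the origin. -/
def taylorPoly {n : ℕ} : ℕ → (En n → ℝ) → MvPolynomial (Fin n) ℝ
  | 0, u => MvPolynomial.C (u 0)
  | j + 1, u => MvPolynomial.C (1 / ((j : ℝ) + 1)) *
      ∑ i, MvPolynomial.X i * taylorPoly j (partialDeriv1 i u)

section taylorPoly

variable {n : ℕ} {u : En n → ℝ} {U : Set (En n)}

theorem isHomogeneous_taylorPoly (j : ℕ) (u : En n → ℝ) : (taylorPoly j u).IsHomogeneous j := by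
  induction j generalizing u with
  | zero => exact MvPolynomial.isHomogeneous_C _ _
  | succ j ih =>
    refine MvPolynomial.IsHomogeneous.C_mul ?_ _
    refine MvPolynomial.IsHomogeneous.sum _ _ _ fun i _ => ?_
    rw [add_comm]
    exact (MvPolynomial.isHomogeneous_X _ _).mul (ih _)

theorem taylorPoly_congr {f g : En n → ℝ} (hU : IsOpen U) (h0 : (0 : En n) ∈ U) (h : EqOn f g U)
    (j : ℕ) : taylorPoly j f = taylorPoly j g := by
  induction j generalizing f g with
  | zero => rw [taylorPoly, taylorPoly, h h0]
  | succ j ih =>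
    rw [taylorPoly, taylorPoly]
    congr 1
    exact Finset.sum_congr rfl fun i _ => by rw [ih (partialDeriv1_congr hU h i)]

theorem IsHarm.pderiv_taylorPoly_succ (h : IsHarm u U) (h0 : (0 : En n) ∈ U) (j : ℕ)
    (i : Fin n) :
    MvPolynomial.pderiv i (taylorPoly (j + 1) u) = taylorPoly j (partialDeriv1 i u) := by
  induction j generalizing u with
  | zero =>
    simp [taylorPoly, MvPolynomial.pderiv_X, Pi.single_apply,
      Derivation.leibniz]
  | succ j ih =>
    have hj : ((j : ℝ) + 1 + 1) ≠ 0 := by positivity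
    have e1 : ∑ k, MvPolynomial.X k *
        MvPolynomial.pderiv i (taylorPoly (j + 1) (partialDeriv1 k u))
        = MvPolynomial.C ((j : ℝ) + 1) * taylorPoly (j + 1) (partialDeriv1 i u) := by
      rw [taylorPoly, ← mul_assoc, ← MvPolynomial.C_mul,
        mul_one_div_cancel (by positivity), MvPolynomial.C_1, one_mul]
      refine Finset.sum_congr rfl fun k _ => ?_
      rw [ih (h.pderiv k), taylorPoly_congr h.isOpen h0
        (partialDeriv1_comm h.isOpen h.contDiffOn_two i k)]
    have e2 : ∑ k, taylorPoly (j + 1) (partialDeriv1 k u) *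
        MvPolynomial.pderiv i (MvPolynomial.X k : MvPolynomial (Fin n) ℝ)
        = taylorPoly (j + 1) (partialDeriv1 i u) := by
      rw [Finset.sum_eq_single i]
      · simp
      · intro k _ hk
        simp [MvPolynomial.pderiv_X, hk]
      · simp
    rw [taylorPoly, MvPolynomial.pderiv_C_mul, map_sum]
    simp only [Derivation.leibniz, smul_eq_mul, Finset.sum_add_distrib]
    rw [e1, e2, ← add_one_mul, ← mul_assoc]
    have e3 : (MvPolynomial.C (1 / (((j + 1 : ℕ) : ℝ) + 1)) : MvPolynomial (Fin n) ℝ) *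
        (MvPolynomial.C ((j : ℝ) + 1) + 1) = 1 := by
      rw [← MvPolynomial.C_1, ← MvPolynomial.C_add, ← MvPolynomial.C_mul]
      congr 1
      push_cast
      field_simp
    rw [e3, one_mul]

theorem IsHarm.sum_taylorPoly_eq_zero (h : IsHarm u U) (h0 : (0 : En n) ∈ U) (j : ℕ) :
    ∑ i, taylorPoly j (partialDeriv1 i (partialDeriv1 i u)) = 0 := by
  induction j generalizing u with
  | zero => simp [taylorPoly, ← map_sum, h.lap 0 h0]
  | succ j ih =>
    simp only [taylorPoly]
    rw [← Finset.mul_sum, Finset.sum_comm]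
    refine mul_eq_zero_of_right _ (Finset.sum_eq_zero fun k _ => ?_)
    rw [← Finset.mul_sum]
    refine mul_eq_zero_of_right _ ?_
    rw [← ih (h.pderiv k)]
    refine Finset.sum_congr rfl fun i _ => taylorPoly_congr h.isOpen h0 (fun x hx => ?_) j
    rw [partialDeriv1_comm h.isOpen (h.pderiv i).contDiffOn_two k i hx,
      partialDeriv1_congr h.isOpen (partialDeriv1_comm h.isOpen h.contDiffOn_two k i) i hx]

/-- Harmonic polynomials. -/
def IsHarmPoly (q : MvPolynomial (Fin n) ℝ) : Prop :=
  ∑ i, MvPolynomial.pderiv i (MvPolynomial.pderiv i q) = 0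

theorem IsHarm.isHarmPoly_taylorPoly (h : IsHarm u U) (h0 : (0 : En n) ∈ U) (j : ℕ) :
    IsHarmPoly (taylorPoly j u) := by
  rcases j with _ | _ | j
  · simp [IsHarmPoly, taylorPoly]
  · unfold IsHarmPoly
    simp only [h.pderiv_taylorPoly_succ h0]
    simp [taylorPoly]
  · unfold IsHarmPoly
    simp only [h.pderiv_taylorPoly_succ h0, (h.pderiv _).pderiv_taylorPoly_succ h0]
    exact h.sum_taylorPoly_eq_zero h0 j

theorem wnorm_taylorPoly_le {w : Fin n → ℝ} (hw : ∀ i, 0 ≤ w i) {D : ℝ} (j : ℕ)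
    (hD : ∀ l : List (Fin n), l.length = j → |partialDerivList l u 0| ≤ D) :
    wnorm w (taylorPoly j u) ≤ (∑ i, w i) ^ j / j.factorial * D := by
  induction j generalizing u with
  | zero => simpa [taylorPoly, wnorm_C] using hD [] rfl
  | succ j ih =>
    have h1 : ∀ i, wnorm w (taylorPoly j (partialDeriv1 i u))
        ≤ (∑ i, w i) ^ j / j.factorial * D := by
      intro i
      refine ih fun l hl => ?_
      have := hD (l ++ [i]) (by simp [hl])
      simpa [partialDerivList_append] using this
    rw [taylorPoly]
    refine (wnorm_mul_le hw _ _).trans ?_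
    rw [wnorm_C, abs_of_nonneg (by positivity)]
    have h2 : wnorm w (∑ i, MvPolynomial.X i * taylorPoly j (partialDeriv1 i u))
        ≤ ∑ i, w i * ((∑ i, w i) ^ j / j.factorial * D) := by
      refine (wnorm_sum_le hw _ _).trans (Finset.sum_le_sum fun i _ => ?_)
      refine (wnorm_mul_le hw _ _).trans ?_
      rw [wnorm_X]
      exact mul_le_mul_of_nonneg_left (h1 i) (hw i)
    rw [← Finset.sum_mul] at h2
    refine (mul_le_mul_of_nonneg_left h2 (by positivity)).trans (le_of_eq ?_)
    rw [Nat.factorial_succ]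
    push_cast
    field_simp
    ring

/-- Taylor's formula with remainder estimate. -/
theorem IsHarm.abs_sub_sum_taylorPoly_le (h : IsHarm u U) {r D : ℝ}
    (hr : 0 < r) (hrU : ball 0 r ⊆ U) (k : ℕ)
    (hD : ∀ l : List (Fin n), l.length = k → ∀ y ∈ ball (0 : En n) r,
      |partialDerivList l u y| ≤ D) {x : En n} (hx : x ∈ ball (0 : En n) r) :
    |u x - ∑ j ∈ Finset.range k, peval (taylorPoly j u) x|
      ≤ (n * ‖x‖) ^ k / k.factorial * D := by
  induction k generalizing u x with
  | zero => simpa using hD [] rfl x hx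
  | succ k ih =>
    have h0 : (0 : En n) ∈ U := hrU (mem_ball_self hr)
    have h1 : ∀ i, ∀ y ∈ ball (0 : En n) r,
        |partialDeriv1 i u y - ∑ j ∈ Finset.range k, peval (taylorPoly j (partialDeriv1 i u)) y|
        ≤ (n * ‖y‖) ^ k / k.factorial * D := by
      intro i y hy
      refine ih (h.pderiv i) (fun l hl z hz => ?_) hy
      have := hD (l ++ [i]) (by simp [hl]) z hz
      simpa [partialDerivList_append] using this
    set R : En n → ℝ := fun y => u y - ∑ j ∈ Finset.range (k + 1), peval (taylorPoly j u) y with hR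
    have hmem : ∀ t ∈ Icc (0 : ℝ) 1, t • x ∈ ball (0 : En n) r := by
      intro t ht
      rw [mem_ball_zero_iff] at hx ⊢
      rw [norm_smul, Real.norm_eq_abs, abs_of_nonneg ht.1]
      exact lt_of_le_of_lt (mul_le_of_le_one_left (norm_nonneg _) ht.2) hx
    have hRd : ∀ y ∈ ball (0 : En n) r, HasFDerivAt R (fderiv ℝ R y) y ∧
        fderiv ℝ R y x = ∑ i, x i * (partialDeriv1 i u y -
          ∑ j ∈ Finset.range k, peval (taylorPoly j (partialDeriv1 i u)) y) := by
      intro y hy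
      have hu := h.differentiableAt (hrU hy)
      have hs : DifferentiableAt ℝ
          (fun y => ∑ j ∈ Finset.range (k + 1), peval (taylorPoly j u) y) y :=
        DifferentiableAt.fun_sum fun j _ => differentiable_peval _ y
      refine ⟨(hu.sub hs).hasFDerivAt, ?_⟩
      rw [fderiv_apply_eq_sum_partialDeriv1]
      refine Finset.sum_congr rfl fun i _ => ?_
      congr 1
      rw [partialDeriv1, hR, fderiv_fun_sub hu hs,
        fderiv_fun_sum fun j _ => differentiable_peval _ y, Finset.sum_range_succ']
      have e : ∀ q : MvPolynomial (Fin n) ℝ, fderiv ℝ (peval q) y (EuclideanSpace.single i 1)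
          = peval (MvPolynomial.pderiv i q) y := fun q => by
        rw [← partialDeriv1_peval]; rfl
      simp only [sub_apply, add_apply, FunLike.coe_sum, Finset.sum_apply, e,
        h.pderiv_taylorPoly_succ h0]
      simp [partialDeriv1, taylorPoly]
    have hx1 : ∑ i, |x i| ≤ n * ‖x‖ := by
      calc ∑ i, |x i| ≤ ∑ _i : Fin n, ‖x‖ := Finset.sum_le_sum fun i _ => abs_apply_le_norm x i
        _ = n * ‖x‖ := by simp
    have hD0 : 0 ≤ D ∨ n = 0 := by
      rcases Nat.eq_zero_or_pos n with hn | hn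
      · exact Or.inr hn
      · exact Or.inl ((abs_nonneg _).trans
          (hD (List.replicate (k + 1) ⟨0, hn⟩) (by simp) 0 (mem_ball_self hr)))
    have hder : ∀ t ∈ Icc (0 : ℝ) 1, HasDerivAt (fun t : ℝ => R (t • x)) (fderiv ℝ R (t • x) x) t := by
      intro t ht
      have hs' : HasDerivAt (fun s : ℝ => s • x) x t := by
        simpa using (hasDerivAt_id t).smul_const x
      exact (hRd _ (hmem t ht)).1.comp_hasDerivAt t hs'
    have hbound := image_norm_le_of_norm_deriv_right_le_deriv_boundary
      (f := fun t : ℝ => R (t • x)) (f' := fun t => fderiv ℝ R (t • x) x) (a := 0) (b := 1)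
      (B := fun t => (n * ‖x‖) ^ (k + 1) / (k + 1).factorial * D * t ^ (k + 1))
      (B' := fun t => (n * ‖x‖) ^ (k + 1) / (k + 1).factorial * D * ((k + 1 : ℕ) * t ^ k))
      (fun t ht => (hder t ht).continuousAt.continuousWithinAt)
      (fun t ht => (hder t (Ico_subset_Icc_self ht)).hasDerivWithinAt)
      (by
        have : R 0 = 0 := by
          simp only [hR, Finset.sum_range_succ']
          simp [taylorPoly]
        simp [this])
      (fun t => by
        simpa using (hasDerivAt_pow (k + 1) t).const_mul
          ((n * ‖x‖) ^ (k + 1) / (k + 1).factorial * D))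
      (by
        intro t ht
        have ht' := Ico_subset_Icc_self ht
        rw [(hRd _ (hmem t ht')).2, Real.norm_eq_abs]
        refine (Finset.abs_sum_le_sum_abs _ _).trans ?_
        calc ∑ i, |x i * (partialDeriv1 i u (t • x) -
              ∑ j ∈ Finset.range k, peval (taylorPoly j (partialDeriv1 i u)) (t • x))|
            ≤ ∑ i, |x i| * ((n * ‖t • x‖) ^ k / k.factorial * D) := by
              refine Finset.sum_le_sum fun i _ => ?_
              rw [abs_mul]
              exact mul_le_mul_of_nonneg_left (h1 i _ (hmem t ht')) (abs_nonneg _)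
          _ = (∑ i, |x i|) * ((n * ‖t • x‖) ^ k / k.factorial * D) := by rw [Finset.sum_mul]
          _ ≤ n * ‖x‖ * ((n * ‖t • x‖) ^ k / k.factorial * D) := by
              rcases hD0 with hD0 | hn
              · gcongr
              · subst hn; simp
          _ = _ := by
              rw [norm_smul, Real.norm_eq_abs, abs_of_nonneg ht.1, Nat.factorial_succ]
              push_cast
              field_simp
              ring)
      (right_mem_Icc.2 zero_le_one)
    simpa using hbound

theorem IsHarm.wnorm_taylorPoly_le_of_bound (h : IsHarm u U) {ρ M : ℝ} (hρ : 0 < ρ)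
    (hρU : ball 0 ρ ⊆ U) (hM : ∀ y ∈ ball (0 : En n) ρ, |u y| ≤ M) {w : Fin n → ℝ}
    (hw : ∀ i, 0 ≤ w i) (j : ℕ) :
    wnorm w (taylorPoly j u) ≤ ((∑ i, w i) * derivConst n / ρ) ^ j * M := by
  refine (wnorm_taylorPoly_le hw j (D := j.factorial * (derivConst n / ρ) ^ j * M)
    fun l hl => ?_).trans (le_of_eq ?_)
  · rw [← hl]
    exact h.abs_partialDerivList_le hρ hρU hM l 0 (mem_ball_self (by positivity))
  · rw [mul_div_assoc, mul_pow]
    field_simp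

theorem IsHarm.hasSum_taylorPoly (h : IsHarm u U) {ρ M : ℝ} (hρ : 0 < ρ)
    (hρU : ball 0 ρ ⊆ U) (hM : ∀ y ∈ ball (0 : En n) ρ, |u y| ≤ M) {x : En n}
    (hx : ‖x‖ < ρ / 2) (hx' : n * ‖x‖ * derivConst n / ρ < 1) :
    HasSum (fun j => peval (taylorPoly j u) x) (u x) := by
  have hM0 : 0 ≤ M := (abs_nonneg _).trans (hM 0 (mem_ball_self hρ))
  have hΛ := derivConst_pos n
  have hq0 : 0 ≤ n * ‖x‖ * derivConst n / ρ := by positivity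
  have hsum : Summable fun j => peval (taylorPoly j u) x := by
    refine Summable.of_norm_bounded
      ((summable_geometric_of_lt_one hq0 hx').mul_right M) fun j => ?_
    refine (abs_peval_le_wnorm (w := fun _ => ‖x‖) (abs_apply_le_norm x) _).trans ?_
    simpa using h.wnorm_taylorPoly_le_of_bound hρ hρU hM (w := fun _ => ‖x‖)
      (fun _ => norm_nonneg _) j
  refine (hsum.hasSum_iff_tendsto_nat).2 ?_
  rw [tendsto_iff_norm_sub_tendsto_zero]
  have hlim := (tendsto_pow_atTop_nhds_zero_of_lt_one hq0 hx').mul_const M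
  rw [zero_mul] at hlim
  refine squeeze_zero (fun _ => norm_nonneg _) (fun k => ?_) hlim
  rw [norm_sub_rev, Real.norm_eq_abs]
  refine (h.abs_sub_sum_taylorPoly_le (r := ρ / 2) (D := k.factorial * (derivConst n / ρ) ^ k * M)
    (by positivity) ((ball_subset_ball (by linarith)).trans hρU) k (fun l hl y hy => ?_)
    (by simpa using hx)).trans (le_of_eq ?_)
  · rw [← hl]
    exact h.abs_partialDerivList_le hρ hρU hM l y hy
  · rw [mul_div_assoc (n * ‖x‖), mul_pow _ (derivConst n / ρ)]
    field_simp

end taylorPoly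

/-! ### Unique continuation -/

section continuation

variable {n : ℕ} {u : En n → ℝ} {U : Set (En n)}

theorem partialDerivList_comp_add (f : En n → ℝ) (a : En n) (l : List (Fin n)) :
    partialDerivList l (fun x => f (a + x)) = fun x => partialDerivList l f (a + x) := by
  induction l with
  | nil => rfl
  | cons i l ih => rw [partialDerivList_cons, ih, partialDeriv1_comp_add]; rfl

theorem partialDerivList_congr (hU : IsOpen U) {f g : En n → ℝ} (h : EqOn f g U)
    (l : List (Fin n)) : EqOn (partialDerivList l f) (partialDerivList l g) U := by
  induction l with
  | nil => exact h
  | cons i l ih => exact partialDeriv1_congr hU ih i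

theorem partialDerivList_zero (l : List (Fin n)) :
    partialDerivList l (fun _ : En n => (0 : ℝ)) = fun _ => 0 := by
  induction l with
  | nil => rfl
  | cons i l ih => rw [partialDerivList_cons, ih]; ext x; simp [partialDeriv1]

theorem IsHarm.exists_bound (h : IsHarm u U) {p : En n} (hp : p ∈ U) :
    ∃ ρ > 0, ∃ M > 0, ball p ρ ⊆ U ∧ ∀ y ∈ ball p ρ, |u y| ≤ M := by
  have hc := (h.continuousOn.continuousAt (h.isOpen.mem_nhds hp)).abs
  have h1 : ∀ᶠ y in 𝓝 p, |u y| < |u p| + 1 := hc.eventually (gt_mem_nhds (by linarith))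
  obtain ⟨ρ, hρ, hρ'⟩ := Metric.eventually_nhds_iff_ball.1
    (h1.and (h.isOpen.mem_nhds hp))
  exact ⟨ρ, hρ, |u p| + 1, by positivity, fun y hy => (hρ' y hy).2, fun y hy => (hρ' y hy).1.le⟩

theorem ball_eq_add (p : En n) (ρ : ℝ) {y : En n} : p + y ∈ ball p ρ ↔ y ∈ ball (0 : En n) ρ := by
  simp [mem_ball, dist_eq_norm]

theorem IsHarm.translate (h : IsHarm u U) {p : En n} {ρ : ℝ} (hρ : ball p ρ ⊆ U) :
    IsHarm (fun y => u (p + y)) (ball 0 ρ) :=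
  h.comp_add p isOpen_ball fun _ hy => hρ ((ball_eq_add p ρ).2 hy)

/-- Near the centre the Taylor series converges to the function. -/
theorem IsHarm.exists_hasSum_taylorPoly (h : IsHarm u U) (h0 : (0 : En n) ∈ U) :
    ∃ ρ > 0, ball 0 ρ ⊆ U ∧
      ∀ x ∈ ball (0 : En n) ρ, HasSum (fun j => peval (taylorPoly j u) x) (u x) := by
  obtain ⟨ρ, hρ, M, -, hρU, hM⟩ := h.exists_bound h0
  have hΛ := derivConst_pos n
  have hc : Tendsto (fun x : En n => n * ‖x‖ * derivConst n / ρ) (𝓝 0) (𝓝 0) := by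
    have : Continuous fun x : En n => n * ‖x‖ * derivConst n / ρ := by fun_prop
    simpa using this.tendsto 0
  have h1 : ∀ᶠ x in 𝓝 (0 : En n), n * ‖x‖ * derivConst n / ρ < 1 :=
    hc.eventually (gt_mem_nhds one_pos)
  have h2 : ∀ᶠ x in 𝓝 (0 : En n), x ∈ ball (0 : En n) (ρ / 2) := ball_mem_nhds _ (by positivity)
  obtain ⟨r, hr, hr'⟩ := Metric.eventually_nhds_iff_ball.1 (h1.and h2)
  refine ⟨r, hr, fun x hx => hρU (ball_subset_ball (by linarith) (hr' x hx).2), fun x hx => ?_⟩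
  exact h.hasSum_taylorPoly hρ hρU hM (by simpa using (hr' x hx).2) (hr' x hx).1

theorem IsHarm.eq_zero_nhds_of_partialDerivList (h : IsHarm u U) {p : En n} (hp : p ∈ U)
    (hd : ∀ l, partialDerivList l u p = 0) : ∃ r > 0, ∀ x ∈ ball p r, u x = 0 := by
  obtain ⟨ρ, hρ, hρU⟩ := Metric.isOpen_iff.1 h.isOpen p hp
  have ht := h.translate hρU
  obtain ⟨r, hr, -, hr'⟩ := ht.exists_hasSum_taylorPoly (mem_ball_self hρ)
  have hT : ∀ j, taylorPoly j (fun y => u (p + y)) = 0 := by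
    intro j
    rw [← wnorm_eq_zero_iff (w := fun _ => 1) fun _ => one_pos]
    refine le_antisymm ?_ (wnorm_nonneg (fun _ => zero_le_one) _)
    refine (wnorm_taylorPoly_le (D := 0) (fun _ => zero_le_one) j fun l _ => ?_).trans (by simp)
    simp [partialDerivList_comp_add, hd]
  refine ⟨r, hr, fun x hx => ?_⟩
  have := hr' (x - p) (by simpa [mem_ball, dist_eq_norm] using hx)
  simp only [hT, peval_zero, add_sub_cancel] at this
  exact this.unique hasSum_zero

theorem IsHarm.eqOn_zero_of_ball (h : IsHarm u U) (hU : IsPreconnected U) {p : En n} {r : ℝ}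
    (hr : 0 < r) (hp : p ∈ U) (hz : ∀ x ∈ ball p r, u x = 0) : ∀ x ∈ U, u x = 0 := by
  have hball : ∀ {q : En n} {s : ℝ}, (∀ x ∈ ball q s, u x = 0) → ∀ y ∈ ball q s, ∀ l,
      partialDerivList l u y = 0 := by
    intro q s hq y hy l
    rw [partialDerivList_congr isOpen_ball (g := fun _ => 0) hq l hy, partialDerivList_zero]
  set S : Set (En n) := {x ∈ U | ∀ l, partialDerivList l u x = 0} with hS
  have hSo : IsOpen S := by
    rw [Metric.isOpen_iff]
    rintro x ⟨hxU, hx⟩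
    obtain ⟨s, hs, hs'⟩ := h.eq_zero_nhds_of_partialDerivList hxU hx
    obtain ⟨t, ht, htU⟩ := Metric.isOpen_iff.1 h.isOpen x hxU
    refine ⟨min s t, lt_min hs ht, fun y hy => ⟨htU (ball_subset_ball (min_le_right _ _) hy), ?_⟩⟩
    exact hball hs' y (ball_subset_ball (min_le_left _ _) hy)
  have hsub : U ⊆ S := by
    refine hU.subset_of_closure_inter_subset hSo ⟨p, hp, hp, hball hz p (mem_ball_self hr)⟩ ?_
    rintro x ⟨hxS, hxU⟩
    refine ⟨hxU, fun l => ?_⟩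
    have hc : ContinuousAt (partialDerivList l u) x :=
      (h.pderivList l).continuousOn.continuousAt (h.isOpen.mem_nhds hxU)
    have hmem := hc.continuousWithinAt.mem_closure (s := S) (t := {(0 : ℝ)}) hxS fun y hy => hy.2 l
    simpa using hmem
  exact fun x hx => (hsub hx).2 []

theorem IsHarm.exists_ne_zero_of_ball (h : IsHarm u U) (hU : IsPreconnected U)
    (hne : ∃ x ∈ U, u x ≠ 0) {p : En n} {r : ℝ} (hr : 0 < r) (hp : p ∈ U) :
    ∃ x ∈ ball p r, u x ≠ 0 := by
  by_contra! hcon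
  obtain ⟨x, hx, hx'⟩ := hne
  exact hx' (h.eqOn_zero_of_ball hU hr hp hcon x hx)

end continuation

/-! ### Orthogonality of homogeneous harmonic polynomials -/

section orthogonality

variable {n : ℕ}

theorem eq_zero_of_eval_eq_zero_on_open {q : MvPolynomial (Fin n) ℝ} {V : Set (Fin n → ℝ)}
    (hV : IsOpen V) (hne : V.Nonempty) (h : ∀ x ∈ V, MvPolynomial.eval x q = 0) : q = 0 := by
  obtain ⟨x, hx⟩ := hne
  obtain ⟨r, hr, hrV⟩ := Metric.isOpen_iff.1 hV x hx
  refine MvPolynomial.funext_set (fun i => ball (x i) r) (fun i => ?_) fun y hy => ?_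
  · rw [Real.ball_eq_Ioo]
    exact Ioo_infinite (by linarith)
  · rw [map_zero]
    refine h y (hrV ?_)
    rwa [ball_pi _ hr]

theorem eq_zero_of_peval_eq_zero_on_open {q : MvPolynomial (Fin n) ℝ} {V : Set (En n)}
    (hV : IsOpen V) (hne : V.Nonempty) (h : ∀ x ∈ V, peval q x = 0) : q = 0 := by
  obtain ⟨x, hx⟩ := hne
  refine eq_zero_of_eval_eq_zero_on_open (V := WithLp.toLp 2 ⁻¹' V)
    (hV.preimage (by fun_prop)) ⟨fun i => x i, by simpa using hx⟩ fun y hy => ?_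
  simpa [peval] using h _ hy

theorem integrable_peval_mul_radial {η : ℝ → ℝ} {ρ : ℝ} (hρ : 0 ≤ ρ)
    (hη : IsRadialProfile η (ρ ^ 2)) (q : MvPolynomial (Fin n) ℝ) :
    Integrable fun y => peval q y * radial η y :=
  integrable_continuousOn_mul_radial hρ hη (continuous_peval q).continuousOn

theorem IsHarmPoly.pderiv {P : MvPolynomial (Fin n) ℝ} (hP : IsHarmPoly P) (i : Fin n) :
    IsHarmPoly (MvPolynomial.pderiv i P) := by
  have hcomm : ∀ (a b : Fin n) (q : MvPolynomial (Fin n) ℝ),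
      MvPolynomial.pderiv a (MvPolynomial.pderiv b q)
        = MvPolynomial.pderiv b (MvPolynomial.pderiv a q) := by
    intro a b q
    rw [← sub_eq_zero, ← peval_eq_zero_iff]
    intro x
    have := partialDeriv1_comm isOpen_univ
      ((contDiff_peval q).of_le (WithTop.coe_le_coe.2 (le_top : (2 : ℕ∞) ≤ ⊤))).contDiffOn a b (mem_univ x)
    simpa [partialDeriv1_peval, sub_eq_zero] using this
  unfold IsHarmPoly at hP ⊢
  have : ∀ k, MvPolynomial.pderiv k (MvPolynomial.pderiv k (MvPolynomial.pderiv i P))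
      = MvPolynomial.pderiv i (MvPolynomial.pderiv k (MvPolynomial.pderiv k P)) := by
    intro k
    rw [hcomm k i P, hcomm k i]
  simp only [this]
  rw [← map_sum, hP, map_zero]

theorem IsHarmPoly.integral_mul_eq_zero {m k : ℕ} {P q : MvPolynomial (Fin n) ℝ}
    (hP : IsHarmPoly P) (hPm : P.IsHomogeneous m) (hq : q.IsHomogeneous k) (hk : k < m)
    {η : ℝ → ℝ} {ρ : ℝ} (hρ : 0 ≤ ρ) (hη : IsRadialProfile η (ρ ^ 2)) :
    ∫ y, peval (P * q) y * radial η y = 0 := by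
  induction m generalizing P q k η with
  | zero => omega
  | succ m ih =>
    have hm : ((m : ℝ) + 1) ≠ 0 := by positivity
    have h1 : ∀ i : Fin n, ∫ y, peval (MvPolynomial.pderiv i P * q) y * y i * radial η y
        = 1 / 2 * ∫ y, peval (MvPolynomial.pderiv i (MvPolynomial.pderiv i P * q)) y
            * radial (profileTail η (ρ ^ 2)) y := by
      intro i
      have := hη.integral_partialDeriv1_mul_tail hρ isOpen_univ
        (f := peval (MvPolynomial.pderiv i P * q))
        ((contDiff_peval _).of_le (by exact_mod_cast le_top)).contDiffOn (subset_univ _) i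
      rw [partialDeriv1_peval] at this
      rw [this]
      ring
    have h2 : ∀ i : Fin n, ∫ y, peval (MvPolynomial.pderiv i P * MvPolynomial.pderiv i q) y
        * radial (profileTail η (ρ ^ 2)) y = 0 := by
      intro i
      rcases Nat.eq_zero_or_pos k with rfl | hk0
      · have hq0 : MvPolynomial.pderiv i q = 0 := by
          have := MvPolynomial.totalDegree_eq_zero_iff_eq_C.1
            ((MvPolynomial.totalDegree_zero_iff_isHomogeneous _).2 hq)
          rw [this, MvPolynomial.pderiv_C]
        simp [hq0]
      · exact ih (hP.pderiv i) hPm.pderiv hq.pderiv (by omega) hη.tail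
    have h3 : ∑ i : Fin n, ∫ y, peval (MvPolynomial.pderiv i (MvPolynomial.pderiv i P) * q) y
        * radial (profileTail η (ρ ^ 2)) y = 0 := by
      rw [← integral_finsetSum _ fun i _ => integrable_peval_mul_radial hρ hη.tail _]
      simp only [← Finset.sum_mul, ← peval_sum]
      rw [show ∑ i, MvPolynomial.pderiv i (MvPolynomial.pderiv i P) = 0 from hP]
      simp
    have h4 : ∑ i : Fin n, ∫ y, peval (MvPolynomial.pderiv i P * q) y * y i * radial η y = 0 := by
      rw [Finset.sum_congr rfl fun i _ => h1 i, ← Finset.mul_sum]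
      have : ∀ i : Fin n, ∫ y, peval (MvPolynomial.pderiv i (MvPolynomial.pderiv i P * q)) y
            * radial (profileTail η (ρ ^ 2)) y
          = ∫ y, peval (MvPolynomial.pderiv i (MvPolynomial.pderiv i P) * q) y
            * radial (profileTail η (ρ ^ 2)) y := by
        intro i
        rw [Derivation.leibniz, smul_eq_mul, smul_eq_mul]
        simp only [peval_add, add_mul]
        rw [integral_add (integrable_peval_mul_radial hρ hη.tail _)
          (integrable_peval_mul_radial hρ hη.tail _), h2 i, zero_add, mul_comm q]
      rw [Finset.sum_congr rfl fun i _ => this i, h3, mul_zero]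
    have h5 : ∀ y, ((m : ℝ) + 1) * (peval (P * q) y * radial η y)
        = ∑ i, peval (MvPolynomial.pderiv i P * q) y * y i * radial η y := by
      intro y
      have h6 := congrArg (fun r => peval r y) hPm.sum_X_mul_pderiv
      simp only [peval_sum, peval_mul, peval_X, nsmul_eq_mul] at h6
      have h7 : peval ((m + 1 : ℕ) : MvPolynomial (Fin n) ℝ) y = (m : ℝ) + 1 := by simp [peval]
      rw [h7] at h6
      rw [peval_mul, ← mul_assoc, ← mul_assoc, ← h6, Finset.sum_mul, Finset.sum_mul]
      refine Finset.sum_congr rfl fun i _ => ?_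
      rw [peval_mul]
      ring
    have h8 : ((m : ℝ) + 1) * ∫ y, peval (P * q) y * radial η y = 0 := by
      rw [← integral_const_mul]
      simp only [h5]
      rw [integral_finsetSum _ fun i _ => ?_, h4]
      refine integrable_continuousOn_mul_radial hρ hη ?_
      exact ((continuous_peval _).mul (by fun_prop)).continuousOn
    exact (mul_eq_zero.1 h8).resolve_left hm

/-- A nonnegative polynomial factor of a homogeneous harmonic polynomial is constant. -/
theorem IsHarmPoly.isUnit_of_nonneg {m : ℕ} {P g h : MvPolynomial (Fin n) ℝ} (hP : IsHarmPoly P)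
    (hPm : P.IsHomogeneous m) (hP0 : P ≠ 0) (hgh : P = g * h) (hg : ∀ x, 0 ≤ peval g x) :
    IsUnit g := by
  have hg0 : g ≠ 0 := fun h0 => hP0 (by rw [hgh, h0, zero_mul])
  have hh0 : h ≠ 0 := fun h0 => hP0 (by rw [hgh, h0, mul_zero])
  have hdeg : m = g.totalDegree + h.totalDegree := by
    rw [← MvPolynomial.totalDegree_mul_of_isDomain hg0 hh0, ← hgh, hPm.totalDegree hP0]
  rcases Nat.eq_zero_or_pos g.totalDegree with h0 | hpos
  · rw [MvPolynomial.totalDegree_eq_zero_iff_eq_C] at h0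
    rw [h0]
    refine (IsUnit.mk0 _ fun hc => hg0 ?_).map MvPolynomial.C
    rw [h0, hc, map_zero]
  exfalso
  have hη := isRadialProfile_bumpProfile one_pos
  have hintg : ∫ y, peval (P * h) y * radial (bumpProfile 1) y = 0 := by
    conv_lhs => rw [← h.sum_homogeneousComponent, Finset.mul_sum]
    simp only [peval_sum, Finset.sum_mul]
    rw [integral_finsetSum _ fun i _ => integrable_peval_mul_radial zero_le_one hη _]
    refine Finset.sum_eq_zero fun k hk => ?_
    refine hP.integral_mul_eq_zero hPm (MvPolynomial.homogeneousComponent_isHomogeneous k h) ?_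
      zero_le_one hη
    have := Finset.mem_range.1 hk
    omega
  have hform : ∀ y, peval (P * h) y = peval g y * peval h y ^ 2 := by
    intro y
    rw [hgh, peval_mul, peval_mul]
    ring
  have hnonneg : ∀ y, 0 ≤ peval (P * h) y * radial (bumpProfile 1) y := by
    intro y
    rw [hform]
    exact mul_nonneg (mul_nonneg (hg y) (sq_nonneg _)) (bumpProfile_nonneg _ _)
  have hae := (integral_eq_zero_iff_of_nonneg hnonneg
    (integrable_peval_mul_radial zero_le_one hη _)).1 hintg
  have hzero := (Continuous.ae_eq_iff_eq volume
    ((continuous_peval _).mul hη.continuous_radial) continuous_zero).1 hae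
  have hPh : P * h = 0 := by
    refine eq_zero_of_peval_eq_zero_on_open (V := ball (0 : En n) (1 / 2)) isOpen_ball
      ⟨0, mem_ball_self (by norm_num)⟩ fun x hx => ?_
    have := congrFun hzero x
    simpa [radial_bumpProfile_eq_one one_pos (mem_ball_zero_iff.1 hx).le] using this
  exact (mul_ne_zero hP0 hh0) hPh

end orthogonality

/-! ### Divisibility by a polynomial without semidefinite factors -/

section divisibility

variable {n : ℕ}

/-- A real polynomial in one variable changing sign on `[0, 1]` has a root there at which it takes
both signs arbitrarily close by. -/
theorem exists_root_of_sign_change (f : Polynomial ℝ) (h0 : f.eval 0 < 0) (h1 : 0 < f.eval 1) :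
    ∃ s₀, f.eval s₀ = 0 ∧ ∀ δ > 0, ∃ s₁ s₂, |s₁ - s₀| < δ ∧ |s₂ - s₀| < δ ∧
      f.eval s₁ < 0 ∧ 0 < f.eval s₂ := by
  have hf0 : f ≠ 0 := by
    rintro rfl
    simp at h0
  set S : Set ℝ := {s ∈ Icc (0 : ℝ) 1 | f.eval s < 0} with hS
  have hSne : S.Nonempty := ⟨0, ⟨le_rfl, zero_le_one⟩, h0⟩
  have hSb : BddAbove S := ⟨1, fun s hs => hs.1.2⟩
  set s₀ := sSup S with hs₀
  have hcont : Continuous fun s => f.eval s := f.continuous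
  have hs0le : s₀ ≤ 1 := csSup_le hSne fun s hs => hs.1.2
  have hs00 : 0 ≤ s₀ := le_csSup hSb ⟨⟨le_rfl, zero_le_one⟩, h0⟩
  have hle : f.eval s₀ ≤ 0 := by
    have hmem : s₀ ∈ closure S := csSup_mem_closure hSne hSb
    have : closure S ⊆ {s | f.eval s ≤ 0} :=
      closure_minimal (fun s hs => hs.2.le) (isClosed_le hcont continuous_const)
    exact this hmem
  have hlt : s₀ < 1 := by
    rcases hs0le.lt_or_eq with h | h
    · exact h
    · rw [h] at hle
      exact absurd hle (not_le.2 h1)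
  have hright : ∀ s, s₀ < s → s ≤ 1 → 0 ≤ f.eval s := by
    intro s hs hs1
    by_contra hneg
    exact absurd (le_csSup hSb ⟨⟨hs00.trans hs.le, hs1⟩, not_le.1 hneg⟩) (not_le.2 hs)
  have hge : 0 ≤ f.eval s₀ := by
    have hmem : s₀ ∈ closure (Ioo s₀ 1) := by
      rw [closure_Ioo hlt.ne]
      exact ⟨le_rfl, hlt.le⟩
    have : closure (Ioo s₀ 1) ⊆ {s | 0 ≤ f.eval s} :=
      closure_minimal (fun s hs => hright s hs.1 hs.2.le) (isClosed_le continuous_const hcont)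
    exact this hmem
  refine ⟨s₀, le_antisymm hle hge, fun δ hδ => ?_⟩
  obtain ⟨s₁, hs₁, hlt₁⟩ := exists_lt_of_lt_csSup hSne (show s₀ - δ < sSup S by linarith)
  have hinf : (Ioo s₀ (min 1 (s₀ + δ))).Infinite := Ioo_infinite (lt_min hlt (by linarith))
  obtain ⟨s₂, hs₂, hroot⟩ := (hinf.sdiff (f.roots.toFinset.finite_toSet)).nonempty
  have h2 : s₂ < 1 := hs₂.2.trans_le (min_le_left _ _)
  have h3 : s₂ < s₀ + δ := hs₂.2.trans_le (min_le_right _ _)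
  have hs₁le : s₁ ≤ s₀ := le_csSup hSb hs₁
  refine ⟨s₁, s₂, ?_, ?_, hs₁.2, lt_of_le_of_ne (hright s₂ hs₂.1 h2.le) fun h => hroot ?_⟩
  · rw [abs_lt]
    constructor <;> linarith
  · rw [abs_lt]
    constructor <;> linarith [hs₂.1]
  · simp [hf0, ← h]

/-- Substitution of `X + T e` for `X`, as a polynomial in `T`. -/
def lineHom (e : En n) : MvPolynomial (Fin n) ℝ →+* Polynomial (MvPolynomial (Fin n) ℝ) :=
  MvPolynomial.eval₂Hom (Polynomial.C.comp MvPolynomial.C)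
    fun j => Polynomial.C (MvPolynomial.X j) + Polynomial.C (MvPolynomial.C (e j)) * Polynomial.X

@[simp] theorem lineHom_C (e : En n) (c : ℝ) :
    lineHom e (MvPolynomial.C c) = Polynomial.C (MvPolynomial.C c) := by
  simp [lineHom]

@[simp] theorem lineHom_X (e : En n) (j : Fin n) :
    lineHom e (MvPolynomial.X j) = Polynomial.C (MvPolynomial.X j)
      + Polynomial.C (MvPolynomial.C (e j)) * Polynomial.X := by
  simp [lineHom]

theorem eval_map_lineHom (e x : En n) (s : ℝ) (p : MvPolynomial (Fin n) ℝ) :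
    ((lineHom e p).map (MvPolynomial.eval fun i => x i)).eval s = peval p (x + s • e) := by
  induction p using MvPolynomial.induction_on with
  | C a => simp
  | add p q hp hq => simp [hp, hq]
  | mul_X p i hp =>
    rw [map_mul, Polynomial.map_mul, Polynomial.eval_mul, hp, peval_mul, lineHom_X, peval_X]
    simp only [Polynomial.map_add, Polynomial.map_mul, Polynomial.map_C, Polynomial.map_X,
      Polynomial.eval_add, Polynomial.eval_mul, Polynomial.eval_C, Polynomial.eval_X,
      MvPolynomial.eval_X, MvPolynomial.eval_C, PiLp.add_apply, PiLp.smul_apply, smul_eq_mul]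
    ring

/-- The automorphism `X ↦ X + T e`, `T ↦ T`. -/
def lineShear (e : En n) :
    Polynomial (MvPolynomial (Fin n) ℝ) →+* Polynomial (MvPolynomial (Fin n) ℝ) :=
  Polynomial.eval₂RingHom (lineHom e) Polynomial.X

theorem lineShear_C (e : En n) (p : MvPolynomial (Fin n) ℝ) :
    lineShear e (Polynomial.C p) = lineHom e p := by
  simp [lineShear]

theorem lineShear_X (e : En n) : lineShear e Polynomial.X = Polynomial.X := by
  simp [lineShear]

theorem lineShear_comp {e e' : En n} (h : e + e' = 0) :
    (lineShear e).comp (lineShear e') = RingHom.id _ := by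
  have hj : ∀ j, e j + e' j = 0 := fun j => by simpa using congrArg (fun y => y j) h
  refine Polynomial.ringHom_ext' (MvPolynomial.ringHom_ext (fun c => ?_) fun j => ?_) ?_
  · simp [lineShear_C]
  · have : Polynomial.C (MvPolynomial.C (e j)) + Polynomial.C (MvPolynomial.C (e' j))
        = (0 : Polynomial (MvPolynomial (Fin n) ℝ)) := by
      rw [← Polynomial.C_add, ← MvPolynomial.C_add, hj, map_zero, map_zero]
    simp only [RingHom.comp_apply, lineShear_C, lineHom_X, map_add, map_mul, lineShear_X, lineHom_C,
      RingHom.id_apply]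
    linear_combination Polynomial.X * this
  · simp [lineShear_X]

def lineShearEquiv (e : En n) :
    Polynomial (MvPolynomial (Fin n) ℝ) ≃+* Polynomial (MvPolynomial (Fin n) ℝ) :=
  RingEquiv.ofRingHom (lineShear e) (lineShear (-e)) (lineShear_comp (by simp))
    (lineShear_comp (by simp))

theorem lineHom_eq (e : En n) (p : MvPolynomial (Fin n) ℝ) :
    lineHom e p = lineShearEquiv e (Polynomial.C p) := (lineShear_C e p).symm

theorem prime_lineHom (e : En n) {p : MvPolynomial (Fin n) ℝ} (hp : Irreducible p) :
    Prime (lineHom e p) := by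
  rw [lineHom_eq, MulEquiv.prime_iff (lineShearEquiv e), Polynomial.prime_C_iff]
  exact hp.prime

theorem lineHom_dvd_iff (e : En n) {p q : MvPolynomial (Fin n) ℝ} :
    lineHom e p ∣ lineHom e q ↔ p ∣ q := by
  rw [lineHom_eq, lineHom_eq, map_dvd_iff (lineShearEquiv e)]
  exact ⟨fun h => by simpa using (Polynomial.C_dvd_iff_dvd_coeff _ _).1 h 0,
    fun h => map_dvd Polynomial.C h⟩

theorem exists_clear_denominators {R K : Type*} [CommRing R] [IsDomain R] [Field K] [Algebra R K]
    [IsFractionRing R K] (h : Polynomial K) :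
    ∃ (c : R) (H : Polynomial R), c ≠ 0 ∧
      H.map (algebraMap R K) = Polynomial.C (algebraMap R K c) * h := by
  obtain ⟨c, hc, hH⟩ := IsLocalization.integerNormalization_spec (nonZeroDivisors R) h
  refine ⟨c, _, nonZeroDivisors.ne_zero hc, hH.trans ?_⟩
  rw [← Polynomial.smul_eq_C_mul, algebraMap_smul]

theorem exists_bezout_of_prime_of_not_dvd {R : Type*} [CommRing R] [IsDomain R]
    [IsGCDMonoid R]
    {f g : Polynomial R} (hf : Prime f) (hdeg : f.natDegree ≠ 0) (hfg : ¬ f ∣ g) :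
    ∃ (a b : Polynomial R) (d : R), d ≠ 0 ∧ a * f + b * g = Polynomial.C d := by
  have hinj : Function.Injective (algebraMap R (FractionRing R)) :=
    IsFractionRing.injective R (FractionRing R)
  have hmapinj := Polynomial.map_injective _ hinj
  have hprim : f.IsPrimitive := hf.irreducible.isPrimitive hdeg
  have hirr : Irreducible (f.map (algebraMap R (FractionRing R))) :=
    (hprim.irreducible_iff_irreducible_map_fraction_map).1 hf.irreducible
  have hcop : IsCoprime (f.map (algebraMap R (FractionRing R)))
      (g.map (algebraMap R (FractionRing R))) := by
    refine (hirr.coprime_iff_not_dvd).2 fun ⟨h, hh⟩ => ?_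
    obtain ⟨c, H, hc, hH⟩ := exists_clear_denominators (R := R) h
    have hmul : Polynomial.C c * g = f * H := by
      apply hmapinj
      rw [Polynomial.map_mul, Polynomial.map_mul, hH, hh, Polynomial.map_C]
      ring
    rcases hf.dvd_or_dvd (Dvd.intro _ hmul.symm) with h1 | h1
    · have := Polynomial.natDegree_le_of_dvd h1 (by simpa using hc)
      rw [Polynomial.natDegree_C] at this
      omega
    · exact hfg h1
  obtain ⟨a, b, hab⟩ := hcop
  obtain ⟨c, A, hc, hA⟩ := exists_clear_denominators (R := R) a
  obtain ⟨d, B, hd, hB⟩ := exists_clear_denominators (R := R) b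
  refine ⟨Polynomial.C d * A, Polynomial.C c * B, c * d, mul_ne_zero hc hd, hmapinj ?_⟩
  simp only [Polynomial.map_add, Polynomial.map_mul, hA, hB, Polynomial.map_C, map_mul]
  linear_combination Polynomial.C (algebraMap R (FractionRing R) c)
    * Polynomial.C (algebraMap R (FractionRing R) d) * hab

/-- If the irreducible `p` takes both signs and does not divide `q`, some zero of `p` that is not a
zero of `q` is a limit of points of a line through it at which `p` is negative, resp. positive. -/
theorem exists_sign_change_of_irreducible {p q : MvPolynomial (Fin n) ℝ} (hp : Irreducible p)
    (hpq : ¬ p ∣ q) {a b : En n} (ha : peval p a < 0) (hb : 0 < peval p b) :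
    ∃ x₀ : En n, peval q x₀ ≠ 0 ∧ ∀ δ > 0, ∃ y₁ ∈ ball x₀ δ, ∃ y₂ ∈ ball x₀ δ,
      peval p y₁ < 0 ∧ 0 < peval p y₂ := by
  set e := b - a with he
  have hdeg : (lineHom e p).natDegree ≠ 0 := by
    intro h
    rw [Polynomial.natDegree_eq_zero] at h
    obtain ⟨c, hc⟩ := h
    have h0 := eval_map_lineHom e a 0 p
    have h1 := eval_map_lineHom e a 1 p
    rw [← hc] at h0 h1
    simp only [Polynomial.map_C, Polynomial.eval_C] at h0 h1
    rw [h0, zero_smul, add_zero, one_smul, he, add_sub_cancel] at h1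
    linarith
  obtain ⟨A, B, D, hD, hAB⟩ := exists_bezout_of_prime_of_not_dvd (prime_lineHom e hp) hdeg
    (mt (lineHom_dvd_iff e).1 hpq)
  by_contra! hcon
  refine hD (eq_zero_of_peval_eq_zero_on_open
    (V := {x : En n | peval p x < 0} ∩ {x | 0 < peval p (x + e)}) ?_ ⟨a, ha, ?_⟩ ?_)
  · exact (isOpen_lt (continuous_peval p) continuous_const).inter
      (isOpen_lt continuous_const ((continuous_peval p).comp (by fun_prop)))
  · simpa [he] using hb
  · rintro x ⟨hx1, hx2⟩
    obtain ⟨s₀, hs₀, hnear⟩ := exists_root_of_sign_change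
      ((lineHom e p).map (MvPolynomial.eval fun i => x i))
      (by rw [eval_map_lineHom]; simpa using hx1) (by rw [eval_map_lineHom]; simpa using hx2)
    simp only [eval_map_lineHom] at hs₀ hnear
    have hq : peval q (x + s₀ • e) = 0 := by
      by_contra hq
      obtain ⟨δ, hδ, h⟩ := hcon _ hq
      obtain ⟨s₁, s₂, h1, h2, h3, h4⟩ := hnear (δ / (‖e‖ + 1)) (by positivity)
      have key : ∀ s, |s - s₀| < δ / (‖e‖ + 1) → x + s • e ∈ ball (x + s₀ • e) δ := by
        intro s hs
        rw [mem_ball_iff_norm, add_sub_add_left_eq_sub, ← sub_smul, norm_smul, Real.norm_eq_abs]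
        rw [lt_div_iff₀ (by positivity)] at hs
        have := norm_nonneg e
        have := abs_nonneg (s - s₀)
        nlinarith
      exact absurd (h _ (key s₁ h1) _ (key s₂ h2) h3) (not_le.2 h4)
    have := congrArg (fun F => (F.map (MvPolynomial.eval fun i => x i)).eval s₀) hAB
    simp only [Polynomial.map_add, Polynomial.map_mul, Polynomial.eval_add, Polynomial.eval_mul,
      eval_map_lineHom, Polynomial.map_C, Polynomial.eval_C, hs₀, hq, mul_zero, add_zero] at this
    exact this.symm

/-- `W` vanishes somewhere on every segment along which `P` goes from negative to positive. -/
def VanishesBetween (P : MvPolynomial (Fin n) ℝ) (W : En n → ℝ) : Prop :=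
  ∀ y₁ y₂ : En n, peval P y₁ < 0 → 0 < peval P y₂ → ∃ y ∈ segment ℝ y₁ y₂, W y = 0

theorem squarefree_dvd_of_forall_irreducible {R : Type*} [CommRing R] [IsDomain R]
    [UniqueFactorizationMonoid R] {P W : R} (hP0 : P ≠ 0) (hP : Squarefree P)
    (h : ∀ p, Irreducible p → p ∣ P → p ∣ W) : P ∣ W := by
  induction P using WfDvdMonoid.induction_on_irreducible with
  | zero => exact absurd rfl hP0
  | unit u hu => exact hu.dvd
  | mul P p hP0' hp ih =>
    have hPW := ih hP0' (hP.squarefree_of_dvd (Dvd.intro_left _ rfl))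
      fun r hr hrP => h r hr (hrP.mul_left _)
    refine IsRelPrime.mul_dvd ?_ (h p hp (dvd_mul_right _ _)) hPW
    refine (hp.isRelPrime_iff_not_dvd).2 fun hdvd => hp.not_isUnit (hP p ?_)
    exact mul_dvd_mul_left p hdvd

theorem dvd_of_vanishesBetween {P W : MvPolynomial (Fin n) ℝ} (hP0 : P ≠ 0)
    (hP : ∀ g h, P = g * h → (∀ x, 0 ≤ peval g x) → IsUnit g)
    (hW : VanishesBetween P (peval W)) : P ∣ W := by
  have hsq : Squarefree P := by
    rintro d ⟨h, hh⟩
    have := hP (d * d) h hh fun x => by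
      rw [peval_mul]
      exact mul_self_nonneg _
    exact isUnit_of_mul_isUnit_left this
  refine squarefree_dvd_of_forall_irreducible hP0 hsq fun p hp hpP => ?_
  obtain ⟨h, hh⟩ := hpP
  have hph : ¬ p ∣ h := by
    rintro ⟨k, hk⟩
    exact hp.not_isUnit (hsq p ⟨k, by rw [hh, hk, mul_assoc]⟩)
  obtain ⟨a, ha⟩ : ∃ a, peval p a < 0 := by
    by_contra! hcon
    exact hp.not_isUnit (hP p h hh hcon)
  obtain ⟨b, hb⟩ : ∃ b, 0 < peval p b := by
    by_contra! hcon
    refine hp.not_isUnit ((IsUnit.neg_iff p).1 (hP (-p) (-h) (by rw [hh]; ring) fun x => ?_))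
    have := hcon x
    simp only [peval, map_neg] at this ⊢
    linarith
  by_contra hpW
  obtain ⟨x₀, hx₀, hnear⟩ := exists_sign_change_of_irreducible hp (q := W * h)
    (fun hd => (hp.prime.dvd_or_dvd hd).elim hpW hph) ha hb
  rw [peval_mul] at hx₀
  have hW0 := left_ne_zero_of_mul hx₀
  have hh0 := right_ne_zero_of_mul hx₀
  obtain ⟨δ₁, hδ₁, hball₁⟩ := Metric.isOpen_iff.1
    (isOpen_ne_fun (continuous_peval W) continuous_const) x₀ hW0
  rcases lt_or_gt_of_ne hh0 with hneg | hpos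
  · obtain ⟨δ₂, hδ₂, hball₂⟩ := Metric.isOpen_iff.1
      (isOpen_lt (continuous_peval h) continuous_const) x₀ hneg
    obtain ⟨y₁, hy₁, y₂, hy₂, h1, h2⟩ := hnear (min δ₁ δ₂) (lt_min hδ₁ hδ₂)
    have hh1 : peval h y₁ < 0 := hball₂ (ball_subset_ball (min_le_right _ _) hy₁)
    have hh2 : peval h y₂ < 0 := hball₂ (ball_subset_ball (min_le_right _ _) hy₂)
    obtain ⟨y, hy, hy0⟩ := hW y₂ y₁ (by rw [hh, peval_mul]; exact mul_neg_of_pos_of_neg h2 hh2)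
      (by rw [hh, peval_mul]; exact mul_pos_of_neg_of_neg h1 hh1)
    exact hball₁ (ball_subset_ball (min_le_left _ _)
      ((convex_ball x₀ _).segment_subset hy₂ hy₁ hy)) hy0
  · obtain ⟨δ₂, hδ₂, hball₂⟩ := Metric.isOpen_iff.1
      (isOpen_lt continuous_const (continuous_peval h)) x₀ hpos
    obtain ⟨y₁, hy₁, y₂, hy₂, h1, h2⟩ := hnear (min δ₁ δ₂) (lt_min hδ₁ hδ₂)
    have hh1 : 0 < peval h y₁ := hball₂ (ball_subset_ball (min_le_right _ _) hy₁)
    have hh2 : 0 < peval h y₂ := hball₂ (ball_subset_ball (min_le_right _ _) hy₂)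
    obtain ⟨y, hy, hy0⟩ := hW y₁ y₂ (by rw [hh, peval_mul]; exact mul_neg_of_neg_of_pos h1 hh1)
      (by rw [hh, peval_mul]; exact mul_pos h2 hh2)
    exact hball₁ (ball_subset_ball (min_le_left _ _)
      ((convex_ball x₀ _).segment_subset hy₁ hy₂ hy)) hy0

end divisibility

section dominating

variable {n : ℕ}

theorem sum_pow_mul_injOn (K : ℕ) {β γ : Fin n →₀ ℕ} (hβ : ∀ i, β i < K + 2)
    (hγ : ∀ i, γ i < K + 2)
    (h : ∑ i : Fin n, (K + 2) ^ i.1 * β i = ∑ i : Fin n, (K + 2) ^ i.1 * γ i) : β = γ := by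
  have key : ∀ δ : Fin n →₀ ℕ,
      Nat.ofDigits (K + 2) (List.ofFn δ) = ∑ i : Fin n, (K + 2) ^ i.1 * δ i := by
    intro δ
    simp [Nat.ofDigits_eq_sum_mapIdx, List.mapIdx_eq_ofFn, List.sum_ofFn, mul_comm]
  have := Nat.ofDigits_inj_of_len_eq (b := K + 2) (by omega) (L1 := List.ofFn β)
    (L2 := List.ofFn γ) (by simp) (by simpa [List.mem_ofFn] using hβ)
    (by simpa [List.mem_ofFn] using hγ) (by rw [key, key, h])
  exact DFunLike.coe_injective (List.ofFn_injective this)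

/-- Some monomial of a nonzero polynomial dominates on a suitable polydisc, hence multiplication by
the polynomial is bounded below for the corresponding weighted norm. -/
theorem exists_weight_le_wnorm_mul {P : MvPolynomial (Fin n) ℝ} (hP : P ≠ 0) :
    ∃ w : Fin n → ℝ, (∀ i, 0 < w i ∧ w i ≤ 1) ∧ ∃ c > 0, ∀ q, c * wnorm w q ≤ wnorm w (P * q) := by
  classical
  set K := P.totalDegree with hK
  have hlt : ∀ β ∈ P.support, ∀ i, β i < K + 2 := by
    intro β hβ i
    have h1 := MvPolynomial.le_totalDegree hβ
    have h2 : β i ≤ β.sum fun _ e => e := by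
      rw [Finsupp.sum_fintype _ _ fun _ => rfl]
      exact Finset.single_le_sum (f := fun i => β i) (fun _ _ => Nat.zero_le _) (Finset.mem_univ i)
    omega
  set k : (Fin n →₀ ℕ) → ℕ := fun β => ∑ i : Fin n, (K + 2) ^ i.1 * β i with hk
  obtain ⟨β, hβ, hmin⟩ := P.support.exists_min_image k (MvPolynomial.support_nonempty.2 hP)
  have hmin' : ∀ γ ∈ P.support.erase β, k β + 1 ≤ k γ := by
    intro γ hγ
    obtain ⟨hne, hγ⟩ := Finset.mem_erase.1 hγ
    refine lt_of_le_of_ne (hmin γ hγ) fun h => hne ?_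
    exact (sum_pow_mul_injOn K (hlt β hβ) (hlt γ hγ) h).symm
  set c := |P.coeff β| with hc
  have hcpos : 0 < c := abs_pos.2 (MvPolynomial.mem_support_iff.1 hβ)
  set S := ∑ γ ∈ P.support, |P.coeff γ| with hS
  have hcS : c ≤ S := Finset.single_le_sum (f := fun γ => |P.coeff γ|)
    (fun _ _ => abs_nonneg _) hβ
  set δ := c / (2 * S) with hδ
  have hSpos : 0 < S := hcpos.trans_le hcS
  have hδ0 : 0 < δ := by positivity
  have hδ1 : δ ≤ 1 := by
    rw [hδ, div_le_one (by positivity)]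
    linarith
  set w : Fin n → ℝ := fun i => δ ^ ((K + 2) ^ i.1) with hw
  have hw0 : ∀ i, 0 ≤ w i := fun i => by positivity
  have hprod : ∀ γ : Fin n →₀ ℕ, ∏ i, w i ^ γ i = δ ^ k γ := by
    intro γ
    simp only [hw, ← pow_mul, hk]
    rw [Finset.prod_pow_eq_pow_sum]
  refine ⟨w, fun i => ⟨by positivity, pow_le_one₀ hδ0.le hδ1⟩, c * δ ^ k β / 2, by positivity,
    fun q => ?_⟩
  set r := ∑ γ ∈ P.support.erase β, MvPolynomial.monomial γ (P.coeff γ) with hr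
  have hsplit : P = MvPolynomial.monomial β (P.coeff β) + r := by
    conv_lhs => rw [← P.support_sum_monomial_coeff, ← Finset.add_sum_erase _ _ hβ]
  have hrn : wnorm w r ≤ c * δ ^ k β / 2 := by
    calc wnorm w r ≤ ∑ γ ∈ P.support.erase β, |P.coeff γ| * δ ^ (k β + 1) := by
          refine (wnorm_sum_le hw0 _ _).trans (Finset.sum_le_sum fun γ hγ => ?_)
          rw [wnorm_monomial, hprod]
          exact mul_le_mul_of_nonneg_left (pow_le_pow_of_le_one hδ0.le hδ1 (hmin' γ hγ))
            (abs_nonneg _)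
      _ ≤ S * δ ^ (k β + 1) := by
          rw [← Finset.sum_mul]
          refine mul_le_mul_of_nonneg_right ?_ (by positivity)
          exact Finset.sum_le_sum_of_subset_of_nonneg (Finset.erase_subset _ _)
            fun _ _ _ => abs_nonneg _
      _ = c * δ ^ k β / 2 := by
          rw [pow_succ, hδ]
          field_simp
  have h1 := le_wnorm_monomial_mul hw0 β (P.coeff β) q
  rw [hprod] at h1
  have h2 : wnorm w (MvPolynomial.monomial β (P.coeff β) * q)
      ≤ wnorm w (P * q) + wnorm w r * wnorm w q := by
    have : MvPolynomial.monomial β (P.coeff β) * q = P * q - r * q := by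
      conv_rhs => rw [hsplit]
      ring
    rw [this]
    exact (wnorm_sub_le hw0 _ _).trans (add_le_add_right (wnorm_mul_le hw0 _ _) _)
  have h3 := mul_le_mul_of_nonneg_right hrn (wnorm_nonneg hw0 q)
  linarith

theorem le_wnorm_smul_mul {P q : MvPolynomial (Fin n) ℝ} {m j : ℕ} (hP : P.IsHomogeneous m)
    (hq : q.IsHomogeneous j) {w : Fin n → ℝ} {c : ℝ}
    (hc : c * wnorm w q ≤ wnorm w (P * q)) {t : ℝ} (ht : 0 ≤ t) :
    t ^ m * c * wnorm (fun i => t * w i) q ≤ wnorm (fun i => t * w i) (P * q) := by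
  rw [wnorm_smul_of_isHomogeneous hq, wnorm_smul_of_isHomogeneous (hP.mul hq), pow_add]
  have := mul_le_mul_of_nonneg_left hc (show 0 ≤ t ^ m * t ^ j by positivity)
  linarith

end dominating

/-! ### Division of harmonic functions with the same zeros -/

section division

variable {n : ℕ}

theorem exists_homogeneous_quotient {P W : MvPolynomial (Fin n) ℝ} {m i : ℕ}
    (hP : P.IsHomogeneous m) (hW : W.IsHomogeneous (m + i)) (h : P ∣ W) :
    ∃ g : MvPolynomial (Fin n) ℝ, g.IsHomogeneous i ∧ W = P * g := by
  obtain ⟨g, hg⟩ := h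
  refine ⟨MvPolynomial.homogeneousComponent i g,
    MvPolynomial.homogeneousComponent_isHomogeneous i g, ?_⟩
  have h1 : MvPolynomial.homogeneousComponent (m + i) W = W := by
    rw [MvPolynomial.homogeneousComponent_of_mem hW, if_pos rfl]
  have h2 : ∀ j, MvPolynomial.homogeneousComponent (m + i)
      (P * MvPolynomial.homogeneousComponent j g)
      = if i = j then P * MvPolynomial.homogeneousComponent j g else 0 := by
    intro j
    rw [MvPolynomial.homogeneousComponent_of_mem
      (hP.mul (MvPolynomial.homogeneousComponent_isHomogeneous j g))]
    simp
  rw [← h1, hg]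
  conv_lhs => rw [← g.sum_homogeneousComponent, Finset.mul_sum, map_sum]
  simp only [h2, Finset.sum_ite_eq, Finset.mem_range]
  split_ifs with h
  · rfl
  · rw [MvPolynomial.homogeneousComponent_eq_zero _ _ (by omega), mul_zero]

theorem eq_zero_of_dvd_of_lt {P W : MvPolynomial (Fin n) ℝ} {m k : ℕ} (hP0 : P ≠ 0)
    (hP : P.IsHomogeneous m) (hW : W.IsHomogeneous k) (hk : k < m) (h : P ∣ W) : W = 0 := by
  by_contra hW0
  obtain ⟨g, rfl⟩ := h
  have := MvPolynomial.totalDegree_mul_of_isDomain (left_ne_zero_of_mul hW0)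
    (right_ne_zero_of_mul hW0)
  rw [hW.totalDegree hW0, hP.totalDegree hP0] at this
  omega

theorem abs_peval_le_of_isHomogeneous {q : MvPolynomial (Fin n) ℝ} {j : ℕ}
    (hq : q.IsHomogeneous j) (x : En n) :
    |peval q x| ≤ wnorm (fun _ => 1) q * ‖x‖ ^ j := by
  refine (abs_peval_le_wnorm (w := fun _ => ‖x‖ * 1) (fun i => ?_) q).trans (le_of_eq ?_)
  · simpa using abs_apply_le_norm x i
  · rw [wnorm_smul_of_isHomogeneous hq, mul_comm]

theorem IsHarm.exists_taylor_bound {u : En n → ℝ} {U : Set (En n)} (h : IsHarm u U)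
    (h0 : (0 : En n) ∈ U) (k : ℕ) :
    ∃ C δ : ℝ, 0 ≤ C ∧ 0 < δ ∧ ∀ x ∈ ball (0 : En n) δ,
      |u x - ∑ j ∈ Finset.range k, peval (taylorPoly j u) x| ≤ C * ‖x‖ ^ k := by
  obtain ⟨ρ, hρ, M, hM, hρU, hb⟩ := h.exists_bound h0
  have hΛ := derivConst_pos n
  refine ⟨(n : ℝ) ^ k / k.factorial * (k.factorial * (derivConst n / ρ) ^ k * M), ρ / 2,
    by positivity, by positivity, fun x hx => ?_⟩
  refine (h.abs_sub_sum_taylorPoly_le (half_pos hρ)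
    ((ball_subset_ball (by linarith)).trans hρU) k
    (D := k.factorial * (derivConst n / ρ) ^ k * M) (fun l hl y hy => ?_) hx).trans (le_of_eq ?_)
  · have := h.abs_partialDerivList_le hρ hρU hb l y hy
    rwa [hl] at this
  · rw [mul_pow]
    ring

/-- The lowest order part of `w` vanishes between points where that of `b` has opposite signs,
provided that `w` vanishes on the zeros of `b`. -/
theorem vanishesBetween_of_isLittle {b w : En n → ℝ} {P W : MvPolynomial (Fin n) ℝ} {m k : ℕ}
    (hP : P.IsHomogeneous m) (hW : W.IsHomogeneous k) {ρ C : ℝ} (hρ : 0 < ρ)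
    (hb : ContinuousOn b (ball 0 ρ)) (hzero : ∀ x ∈ ball (0 : En n) ρ, b x = 0 → w x = 0)
    (hbP : ∀ x ∈ ball (0 : En n) ρ, |b x - peval P x| ≤ C * ‖x‖ ^ (m + 1))
    (hwW : ∀ x ∈ ball (0 : En n) ρ, |w x - peval W x| ≤ C * ‖x‖ ^ (k + 1)) :
    VanishesBetween P (peval W) := by
  intro y₁ y₂ h1 h2
  by_contra! hcon
  have hcomp : IsCompact (segment ℝ y₁ y₂) := by
    rw [segment_eq_image ℝ y₁ y₂]
    exact isCompact_Icc.image (by fun_prop)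
  obtain ⟨z, hz, hmin⟩ := hcomp.exists_isMinOn ⟨y₁, left_mem_segment ℝ y₁ y₂⟩
    (continuous_peval W).abs.continuousOn
  have hzpos : 0 < |peval W z| := abs_pos.2 (hcon z hz)
  set N := ‖y₁‖ + ‖y₂‖ + 1 with hN
  have hNpos : 0 < N := by positivity
  have hnorm : ∀ y ∈ segment ℝ y₁ y₂, ‖y‖ ≤ N := by
    intro y hy
    have h3 : segment ℝ y₁ y₂ ⊆ closedBall 0 N := (convex_closedBall _ _).segment_subset
      (by simp [hN]; linarith [norm_nonneg y₂]) (by simp [hN]; linarith [norm_nonneg y₁])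
    simpa using h3 hy
  have hsmall : ∀ K : ℝ, ∀ ε > 0, ∀ᶠ t : ℝ in 𝓝[>] 0, K * t < ε := by
    intro K ε hε
    have : Tendsto (fun t : ℝ => K * t) (𝓝 0) (𝓝 (K * 0)) :=
      (continuous_const.mul continuous_id).tendsto 0
    rw [mul_zero] at this
    exact nhdsWithin_le_nhds (this.eventually (gt_mem_nhds hε))
  obtain ⟨t, ⟨⟨⟨htN, ht1⟩, ht2⟩, htW⟩, ht0⟩ := ((((hsmall N ρ hρ).and
    (hsmall (C * N ^ (m + 1)) _ (neg_pos.2 h1))).and (hsmall (C * N ^ (m + 1)) _ h2)).and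
    (hsmall (C * N ^ (k + 1)) _ hzpos)).and self_mem_nhdsWithin |>.exists
  have ht0 : 0 < t := ht0
  have hC : 0 ≤ C := by
    by_contra hC
    by_cases hy : y₁ = 0
    · by_cases hy' : y₂ = 0
      · rw [hy] at h1
        rw [hy'] at h2
        linarith
      · have h4 : t • y₂ ∈ ball (0 : En n) ρ := by
          rw [mem_ball_zero_iff, norm_smul, Real.norm_of_nonneg ht0.le]
          have := hnorm y₂ (right_mem_segment ℝ _ _)
          nlinarith
        have h5 := (abs_nonneg _).trans (hbP _ h4)
        have : 0 < ‖t • y₂‖ ^ (m + 1) := by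
          have : t • y₂ ≠ 0 := smul_ne_zero ht0.ne' hy'
          positivity
        nlinarith
    · have h4 : t • y₁ ∈ ball (0 : En n) ρ := by
        rw [mem_ball_zero_iff, norm_smul, Real.norm_of_nonneg ht0.le]
        have := hnorm y₁ (left_mem_segment ℝ _ _)
        nlinarith
      have h5 := (abs_nonneg _).trans (hbP _ h4)
      have : 0 < ‖t • y₁‖ ^ (m + 1) := by
        have : t • y₁ ≠ 0 := smul_ne_zero ht0.ne' hy
        positivity
      nlinarith
  have hball : ∀ y ∈ segment ℝ y₁ y₂, t • y ∈ ball (0 : En n) ρ := by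
    intro y hy
    rw [mem_ball_zero_iff, norm_smul, Real.norm_of_nonneg ht0.le]
    have := hnorm y hy
    nlinarith
  have hpow : ∀ (j : ℕ), ∀ y ∈ segment ℝ y₁ y₂,
      C * ‖t • y‖ ^ (j + 1) ≤ t ^ j * (C * N ^ (j + 1) * t) := by
    intro j y hy
    rw [norm_smul, Real.norm_of_nonneg ht0.le, mul_pow]
    have := pow_le_pow_left₀ (norm_nonneg y) (hnorm y hy) (j + 1)
    calc C * (t ^ (j + 1) * ‖y‖ ^ (j + 1)) ≤ C * (t ^ (j + 1) * N ^ (j + 1)) := by gcongr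
      _ = _ := by ring
  have hb1 : b (t • y₁) < 0 := by
    have h3 := abs_le.1 (hbP _ (hball y₁ (left_mem_segment ℝ _ _)))
    have h4 := hpow m y₁ (left_mem_segment ℝ _ _)
    rw [peval_smul_of_isHomogeneous hP] at h3
    have : 0 < t ^ m := by positivity
    nlinarith [h3.2]
  have hb2 : 0 < b (t • y₂) := by
    have h3 := abs_le.1 (hbP _ (hball y₂ (right_mem_segment ℝ _ _)))
    have h4 := hpow m y₂ (right_mem_segment ℝ _ _)
    rw [peval_smul_of_isHomogeneous hP] at h3
    have : 0 < t ^ m := by positivity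
    nlinarith [h3.1]
  obtain ⟨y, hy, hby⟩ : ∃ y ∈ segment ℝ y₁ y₂, b (t • y) = 0 := by
    have hpre : IsPreconnected (segment ℝ y₁ y₂) := (convex_segment y₁ y₂).isPreconnected
    have hcont : ContinuousOn (fun y => b (t • y)) (segment ℝ y₁ y₂) :=
      hb.comp (by fun_prop) hball
    exact hpre.intermediate_value (left_mem_segment ℝ _ _) (right_mem_segment ℝ _ _) hcont
      ⟨hb1.le, hb2.le⟩
  have h3 := hwW _ (hball y hy)
  rw [hzero _ (hball y hy) hby, zero_sub, abs_neg, peval_smul_of_isHomogeneous hW, abs_mul,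
    abs_of_pos (show 0 < t ^ k by positivity)] at h3
  have h4 := hpow k y hy
  have h5 : |peval W z| ≤ |peval W y| := hmin hy
  have h6 : 0 < t ^ k := by positivity
  nlinarith

theorem sum_antidiagonal_eq_sum_range_mul {R : Type*} [CommSemiring R] (f g : ℕ → R) (k : ℕ) :
    ∑ q ∈ Finset.range (k + 1), ∑ p ∈ Finset.HasAntidiagonal.antidiagonal q, f p.1 * g p.2
      = ∑ p ∈ Finset.range (k + 1), f p * ∑ s ∈ Finset.range (k + 1 - p), g s := by
  simp only [Finset.Nat.sum_antidiagonal_eq_sum_range_succ_mk, Finset.mul_sum]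
  exact Finset.sum_range_diag_flip (k + 1) fun p s => f p * g s

theorem vanishesBetween_remainder {a b : En n → ℝ} {U : Set (En n)} (ha : IsHarm a U)
    (hb : IsHarm b U) (h0 : (0 : En n) ∈ U) (hzero : ∀ x ∈ U, b x = 0 → a x = 0) {m : ℕ}
    (hm : ∀ s < m, taylorPoly s b = 0) {k : ℕ} {f : ℕ → MvPolynomial (Fin n) ℝ}
    (hf : ∀ p, (f p).IsHomogeneous p)
    (hlow : ∀ q < k, taylorPoly q a = ∑ p ∈ Finset.HasAntidiagonal.antidiagonal q, f p.1 * taylorPoly p.2 b) :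
    VanishesBetween (taylorPoly m b) (peval (taylorPoly k a
      - ∑ p ∈ Finset.HasAntidiagonal.antidiagonal k, f p.1 * taylorPoly p.2 b)) := by
  obtain ⟨ρ, hρ, hρU⟩ := Metric.isOpen_iff.1 ha.isOpen 0 h0
  obtain ⟨Ca, δa, hCa, hδa, hta⟩ := ha.exists_taylor_bound h0 (k + 1)
  obtain ⟨Cb, δb, hCb, hδb, htb⟩ := hb.exists_taylor_bound h0 (m + 1)
  choose C δ hC hδ ht using fun j => hb.exists_taylor_bound h0 j
  set W := taylorPoly k a - ∑ p ∈ Finset.HasAntidiagonal.antidiagonal k, f p.1 * taylorPoly p.2 b with hW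
  have hWhom : W.IsHomogeneous k := by
    refine (isHomogeneous_taylorPoly k a).sub (MvPolynomial.IsHomogeneous.sum _ _ _ fun p hp => ?_)
    rw [← Finset.HasAntidiagonal.mem_antidiagonal.1 hp]
    exact (hf _).mul (isHomogeneous_taylorPoly _ _)
  have hδev : ∀ᶠ x in 𝓝 (0 : En n), x ∈ ball (0 : En n) ρ ∧ x ∈ ball (0 : En n) δa
      ∧ x ∈ ball (0 : En n) δb ∧ ∀ j ∈ Finset.range (k + 2), x ∈ ball (0 : En n) (δ j) :=
    Filter.Eventually.and (ball_mem_nhds _ hρ) (Filter.Eventually.and (ball_mem_nhds _ hδa)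
      (Filter.Eventually.and (ball_mem_nhds _ hδb)
        ((Filter.eventually_all_finset _).2 fun j _ => ball_mem_nhds _ (hδ j))))
  obtain ⟨r, hr, hr'⟩ := Metric.eventually_nhds_iff_ball.1 hδev
  set K := Ca + ∑ p ∈ Finset.range (k + 1), wnorm (fun _ => 1) (f p) * C (k + 1 - p) with hK
  refine vanishesBetween_of_isLittle (b := b) (C := max Cb K)
    (w := fun x => a x - ∑ p ∈ Finset.range (k + 1), peval (f p) x * b x)
    (isHomogeneous_taylorPoly m b) hWhom hr
    (hb.continuousOn.mono fun x hx => hρU (hr' x hx).1) (fun x hx hbx => ?_) (fun x hx => ?_)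
    (fun x hx => ?_)
  · simp [hbx, hzero x (hρU (hr' x hx).1) hbx]
  · have h1 := htb x (hr' x hx).2.2.1
    have h2 : ∑ j ∈ Finset.range (m + 1), peval (taylorPoly j b) x = peval (taylorPoly m b) x := by
      rw [Finset.sum_range_succ, Finset.sum_eq_zero, zero_add]
      intro j hj
      rw [hm j (Finset.mem_range.1 hj), peval_zero]
    rw [h2] at h1
    exact h1.trans (mul_le_mul_of_nonneg_right (le_max_left _ _) (by positivity))
  · have hpoly : ∑ q ∈ Finset.range (k + 1), taylorPoly q a = W
        + ∑ p ∈ Finset.range (k + 1), f p * ∑ s ∈ Finset.range (k + 1 - p), taylorPoly s b := by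
      rw [← sum_antidiagonal_eq_sum_range_mul f fun s => taylorPoly s b, Finset.sum_range_succ,
        Finset.sum_range_succ, Finset.sum_congr rfl fun q hq => hlow q (Finset.mem_range.1 hq), hW]
      ring
    have hval := congrArg (fun q => peval q x) hpoly
    simp only [peval_sum, peval_add, peval_mul] at hval
    have hsplit : a x - ∑ p ∈ Finset.range (k + 1), peval (f p) x * b x - peval W x
        = (a x - ∑ q ∈ Finset.range (k + 1), peval (taylorPoly q a) x)
          - ∑ p ∈ Finset.range (k + 1), peval (f p) x *
            (b x - ∑ s ∈ Finset.range (k + 1 - p), peval (taylorPoly s b) x) := by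
      simp only [mul_sub, Finset.sum_sub_distrib]
      rw [hval]
      ring
    have hbound : |a x - ∑ p ∈ Finset.range (k + 1), peval (f p) x * b x - peval W x|
        ≤ K * ‖x‖ ^ (k + 1) := by
      rw [hsplit, hK, add_mul, Finset.sum_mul]
      refine (abs_sub _ _).trans (add_le_add (hta x (hr' x hx).2.1)
        ((Finset.abs_sum_le_sum_abs _ _).trans (Finset.sum_le_sum fun p hp => ?_)))
      have hp' := Finset.mem_range.1 hp
      rw [abs_mul]
      have h1 := abs_peval_le_of_isHomogeneous (hf p) x
      have h2 := ht (k + 1 - p) x ((hr' x hx).2.2.2 _ (Finset.mem_range.2 (by omega)))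
      calc |peval (f p) x| * |b x - ∑ s ∈ Finset.range (k + 1 - p), peval (taylorPoly s b) x|
          ≤ (wnorm (fun _ => 1) (f p) * ‖x‖ ^ p) * (C (k + 1 - p) * ‖x‖ ^ (k + 1 - p)) :=
            mul_le_mul h1 h2 (abs_nonneg _) ((abs_nonneg _).trans h1)
        _ = wnorm (fun _ => 1) (f p) * C (k + 1 - p) * ‖x‖ ^ (p + (k + 1 - p)) := by
            rw [pow_add]
            ring
        _ = _ := by rw [Nat.add_sub_cancel' (by omega)]
    exact hbound.trans (mul_le_mul_of_nonneg_right (le_max_right _ _) (by positivity))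

end division

/-! ### The quotient series -/

section quotient

variable {n : ℕ}

theorem sum_antidiagonal_of_eq_zero {R : Type*} [CommSemiring R] {B : ℕ → R} {m : ℕ}
    (hB : ∀ s < m, B s = 0) (g : ℕ → R) (i : ℕ) :
    ∑ p ∈ Finset.HasAntidiagonal.antidiagonal (m + i), g p.1 * B p.2
      = ∑ j ∈ Finset.range i, g j * B (m + i - j) + g i * B m := by
  rw [Finset.Nat.sum_antidiagonal_eq_sum_range_succ_mk,
    ← Finset.sum_subset (Finset.range_subset_range.2 (show i + 1 ≤ (m + i).succ by omega)),
    Finset.sum_range_succ, Nat.add_sub_cancel]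
  intro p hp hp'
  simp only [Finset.mem_range] at hp hp'
  rw [hB _ (by omega), mul_zero]

/-- The homogeneous parts of the quotient of two series. -/
def quotSeq (A B : ℕ → MvPolynomial (Fin n) ℝ) (m : ℕ) : ℕ → MvPolynomial (Fin n) ℝ
  | i => Classical.epsilon fun g => g.IsHomogeneous i ∧
      A (m + i) - ∑ j : Fin i, quotSeq A B m j * B (m + i - j) = B m * g

theorem exists_quotient_seq {a b : En n → ℝ} {U : Set (En n)} (ha : IsHarm a U)
    (hb : IsHarm b U) (h0 : (0 : En n) ∈ U) (hzero : ∀ x ∈ U, b x = 0 → a x = 0) {m : ℕ}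
    (hm : ∀ s < m, taylorPoly s b = 0) (hm0 : taylorPoly m b ≠ 0) :
    ∃ f : ℕ → MvPolynomial (Fin n) ℝ, (∀ p, (f p).IsHomogeneous p) ∧
      (∀ s < m, taylorPoly s a = 0) ∧
      ∀ k, taylorPoly k a
        = ∑ p ∈ Finset.HasAntidiagonal.antidiagonal k, f p.1 * taylorPoly p.2 b := by
  have hP := hb.isHarmPoly_taylorPoly h0 m
  have hPm := isHomogeneous_taylorPoly m b
  have hBC := fun g h hgh hg => hP.isUnit_of_nonneg (g := g) (h := h) hPm hm0 hgh hg
  have hlow : ∀ s < m, taylorPoly s a = 0 := by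
    intro s
    induction s using Nat.strong_induction_on with
    | _ s ih =>
      intro hs
      have := vanishesBetween_remainder ha hb h0 hzero hm (k := s) (f := fun _ => 0)
        (fun p => MvPolynomial.isHomogeneous_zero _ _ _) (fun q hq => by
          simpa using ih q hq (hq.trans hs))
      simp only [zero_mul, Finset.sum_const_zero, sub_zero] at this
      exact eq_zero_of_dvd_of_lt hm0 hPm (isHomogeneous_taylorPoly s a) hs
        (dvd_of_vanishesBetween hm0 hBC this)
  set A := fun k => taylorPoly k a with hA
  set B := fun k => taylorPoly k b with hB
  have hB0 : ∀ s < m, B s = 0 := hm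
  set f := quotSeq A B m with hf
  have key : ∀ i, (f i).IsHomogeneous i ∧
      A (m + i) - ∑ j ∈ Finset.range i, f j * B (m + i - j) = B m * f i := by
    intro i
    induction i using Nat.strong_induction_on with
    | _ i ih =>
      have hex : ∃ g : MvPolynomial (Fin n) ℝ, g.IsHomogeneous i ∧
          A (m + i) - ∑ j : Fin i, f j * B (m + i - j) = B m * g := by
        rw [Fin.sum_univ_eq_sum_range (fun j => f j * B (m + i - j))]
        set f' : ℕ → MvPolynomial (Fin n) ℝ := fun p => if p < i then f p else 0 with hf'
        have hf'hom : ∀ p, (f' p).IsHomogeneous p := by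
          intro p
          simp only [hf']
          split_ifs with h
          · exact (ih p h).1
          · exact MvPolynomial.isHomogeneous_zero _ _ _
        have hf'lt : ∀ p < i, f' p = f p := fun p hp => if_pos hp
        have hf'i : f' i = 0 := if_neg (lt_irrefl i)
        have hvan := vanishesBetween_remainder ha hb h0 hzero hm (k := m + i) hf'hom
          (fun q hq => by
            rcases lt_or_ge q m with hqm | hqm
            · rw [hlow q hqm]
              refine (Finset.sum_eq_zero fun p hp => ?_).symm
              have := Finset.HasAntidiagonal.mem_antidiagonal.1 hp
              rw [hm _ (by omega), mul_zero]
            · obtain ⟨i', rfl⟩ := Nat.exists_eq_add_of_le hqm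
              have hi' : i' < i := by omega
              have h1 := sum_antidiagonal_of_eq_zero hB0 f' i'
              have h2 : ∑ j ∈ Finset.range i', f' j * B (m + i' - j)
                  = ∑ j ∈ Finset.range i', f j * B (m + i' - j) :=
                Finset.sum_congr rfl fun j hj => by
                  rw [hf'lt j (by have := Finset.mem_range.1 hj; omega)]
              refine Eq.trans ?_ h1.symm
              rw [h2, hf'lt i' hi']
              linear_combination (ih i' hi').2)
        have hrem : taylorPoly (m + i) a - ∑ p ∈ Finset.HasAntidiagonal.antidiagonal (m + i),
            f' p.1 * taylorPoly p.2 b = A (m + i) - ∑ j ∈ Finset.range i, f j * B (m + i - j) := by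
          have h1 := sum_antidiagonal_of_eq_zero hB0 f' i
          have h2 : ∑ j ∈ Finset.range i, f' j * B (m + i - j)
              = ∑ j ∈ Finset.range i, f j * B (m + i - j) :=
            Finset.sum_congr rfl fun j hj => by rw [hf'lt j (Finset.mem_range.1 hj)]
          rw [h2, hf'i, zero_mul, add_zero] at h1
          exact congrArg (fun q => A (m + i) - q) h1
        rw [hrem] at hvan
        refine exists_homogeneous_quotient hPm ?_ (dvd_of_vanishesBetween hm0 hBC hvan)
        refine (isHomogeneous_taylorPoly _ a).sub (MvPolynomial.IsHomogeneous.sum _ _ _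
          fun j hj => ?_)
        have hj' := Finset.mem_range.1 hj
        have := (ih j hj').1.mul (isHomogeneous_taylorPoly (m + i - j) b)
        rwa [show j + (m + i - j) = m + i by omega] at this
      have hspec := Classical.epsilon_spec hex
      have hfi : f i = Classical.epsilon fun g : MvPolynomial (Fin n) ℝ => g.IsHomogeneous i ∧
          A (m + i) - ∑ j : Fin i, f j * B (m + i - j) = B m * g := by
        rw [hf, quotSeq]
      rw [← hfi, Fin.sum_univ_eq_sum_range (fun j => f j * B (m + i - j))] at hspec
      exact hspec
  refine ⟨f, fun p => (key p).1, hlow, fun k => ?_⟩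
  rcases lt_or_ge k m with hkm | hkm
  · rw [hlow k hkm]
    refine (Finset.sum_eq_zero fun p hp => ?_).symm
    have := Finset.HasAntidiagonal.mem_antidiagonal.1 hp
    rw [hm _ (by omega), mul_zero]
  · obtain ⟨i, rfl⟩ := Nat.exists_eq_add_of_le hkm
    refine Eq.trans ?_ (sum_antidiagonal_of_eq_zero hB0 f i).symm
    linear_combination (key i).2

/-- If moreover the zeros coincide, then so do the vanishing orders. -/
theorem quotient_seq_zero_ne_zero {a b : En n → ℝ} {U : Set (En n)} (ha : IsHarm a U)
    (hb : IsHarm b U) (h0 : (0 : En n) ∈ U) (hzero : ∀ x ∈ U, b x = 0 ↔ a x = 0) {m : ℕ}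
    (hm : ∀ s < m, taylorPoly s b = 0) (hm0 : taylorPoly m b ≠ 0)
    {f : ℕ → MvPolynomial (Fin n) ℝ} (hf : ∀ p, (f p).IsHomogeneous p)
    (hfk : ∀ k, taylorPoly k a
        = ∑ p ∈ Finset.HasAntidiagonal.antidiagonal k, f p.1 * taylorPoly p.2 b)
    (ha0 : ∃ k, taylorPoly k a ≠ 0) :
    ∃ c : ℝ, c ≠ 0 ∧ f 0 = MvPolynomial.C c := by
  classical
  have hma : taylorPoly m a ≠ 0 := by
    obtain ⟨-, -, hlow, -⟩ := exists_quotient_seq hb ha h0 (fun x hx => (hzero x hx).2)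
      (m := Nat.find ha0) (fun s hs => not_not.1 (Nat.find_min ha0 hs)) (Nat.find_spec ha0)
    obtain ⟨-, -, hlow', -⟩ := exists_quotient_seq ha hb h0 (fun x hx => (hzero x hx).1) hm hm0
    have h1 : Nat.find ha0 = m := by
      refine le_antisymm (not_lt.1 fun h => hm0 (hlow m h)) (not_lt.1 fun h => ?_)
      exact Nat.find_spec ha0 (hlow' _ h)
    exact h1 ▸ Nat.find_spec ha0
  have h1 := (sum_antidiagonal_of_eq_zero (B := fun k => taylorPoly k b) hm f 0)
  have h2 : taylorPoly m a = f 0 * taylorPoly m b := by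
    have := hfk (m + 0)
    rw [h1] at this
    simpa using this
  have h3 : f 0 = MvPolynomial.C ((f 0).coeff 0) :=
    MvPolynomial.totalDegree_eq_zero_iff_eq_C.1
      ((MvPolynomial.totalDegree_zero_iff_isHomogeneous _).2 (hf 0))
  refine ⟨(f 0).coeff 0, fun hc => hma ?_, h3⟩
  rw [h2, h3, hc, map_zero, zero_mul]

end quotient

/-! ### Orthogonality of homogeneous harmonic polynomials and harmonic functions -/

section orthogonality

variable {n : ℕ}

theorem IsHarmPoly.integral_mul_radial_succ {j : ℕ} {P : MvPolynomial (Fin n) ℝ}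
    (hP : IsHarmPoly P) (hPj : P.IsHomogeneous (j + 1)) {f : En n → ℝ} {U : Set (En n)}
    (hU : IsOpen U) (hf : ContDiffOn ℝ 1 f U) {η : ℝ → ℝ} {ρ : ℝ} (hρ : 0 ≤ ρ)
    (hρU : closedBall 0 ρ ⊆ U) (hη : IsRadialProfile η (ρ ^ 2)) :
    ((j : ℝ) + 1) * ∫ y, peval P y * f y * radial η y
      = 1 / 2 * ∑ i, ∫ y, peval (MvPolynomial.pderiv i P) y * partialDeriv1 i f y
          * radial (profileTail η (ρ ^ 2)) y := by
  have hfc : ContinuousOn f (closedBall 0 ρ) := hf.continuousOn.mono hρU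
  have hdf : ∀ i, ContinuousOn (partialDeriv1 i f) (closedBall 0 ρ) := fun i =>
    ((ContDiffOn.partialDeriv1 (m := 0) hU hf (by norm_num) i).continuousOn).mono hρU
  have hc1 : ∀ q : MvPolynomial (Fin n) ℝ, ContDiff ℝ 1 (peval q) := fun q =>
    (contDiff_peval _).of_le (by exact_mod_cast le_top)
  have h5 : ∀ y, ((j : ℝ) + 1) * (peval P y * f y * radial η y)
      = ∑ i, (peval (MvPolynomial.pderiv i P) y * f y) * y i * radial η y := by
    intro y
    have h6 := congrArg (fun r => peval r y) hPj.sum_X_mul_pderiv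
    simp only [peval_sum, peval_mul, peval_X, nsmul_eq_mul] at h6
    have h7 : peval ((j + 1 : ℕ) : MvPolynomial (Fin n) ℝ) y = (j : ℝ) + 1 := by simp [peval]
    rw [h7] at h6
    rw [← mul_assoc, ← mul_assoc, ← h6, Finset.sum_mul, Finset.sum_mul]
    refine Finset.sum_congr rfl fun i _ => ?_
    ring
  have h1 : ∀ i : Fin n, ∫ y, (peval (MvPolynomial.pderiv i P) y * f y) * y i * radial η y
      = 1 / 2 * ∫ y, (peval (MvPolynomial.pderiv i (MvPolynomial.pderiv i P)) y * f y
          + peval (MvPolynomial.pderiv i P) y * partialDeriv1 i f y)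
          * radial (profileTail η (ρ ^ 2)) y := by
    intro i
    have := hη.integral_partialDeriv1_mul_tail hρ hU
      (f := fun y => peval (MvPolynomial.pderiv i P) y * f y)
      ((hc1 _).contDiffOn.mul hf) hρU i
    rw [← mul_right_inj' (two_ne_zero' ℝ), ← this, ← mul_assoc]
    norm_num
    refine integral_congr_ae (ae_of_all _ fun y => ?_)
    beta_reduce
    by_cases hy : y ∈ closedBall (0 : En n) ρ
    · congr 1
      have hd : DifferentiableAt ℝ f y :=
        (hf.differentiableOn (by norm_num)).differentiableAt (hU.mem_nhds (hρU hy))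
      rw [← partialDeriv1_peval i (MvPolynomial.pderiv i P)]
      unfold partialDeriv1
      rw [fderiv_fun_mul (differentiable_peval _ _) hd]
      simp only [add_apply, smul_apply, smul_eq_mul]
      ring
    · rw [hη.tail.radial_eq_zero hρ _ (fun h => hy (ball_subset_closedBall h)), mul_zero, mul_zero]
  have hint1 : ∀ i : Fin n, Integrable fun y =>
      peval (MvPolynomial.pderiv i (MvPolynomial.pderiv i P)) y * f y
        * radial (profileTail η (ρ ^ 2)) y := fun i =>
    integrable_continuousOn_mul_radial hρ hη.tail ((continuous_peval _).continuousOn.mul hfc)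
  have hint2 : ∀ i : Fin n, Integrable fun y =>
      peval (MvPolynomial.pderiv i P) y * partialDeriv1 i f y
        * radial (profileTail η (ρ ^ 2)) y := fun i =>
    integrable_continuousOn_mul_radial hρ hη.tail ((continuous_peval _).continuousOn.mul (hdf i))
  have h3 : ∑ i : Fin n, ∫ y, peval (MvPolynomial.pderiv i (MvPolynomial.pderiv i P)) y * f y
      * radial (profileTail η (ρ ^ 2)) y = 0 := by
    rw [← integral_finsetSum _ fun i _ => hint1 i]
    simp only [← Finset.sum_mul, ← peval_sum]
    rw [show ∑ i, MvPolynomial.pderiv i (MvPolynomial.pderiv i P) = 0 from hP]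
    simp
  rw [← integral_const_mul]
  simp only [h5]
  rw [integral_finsetSum _ fun i _ => ?_]
  · rw [Finset.sum_congr rfl fun i _ => h1 i, ← Finset.mul_sum]
    congr 1
    simp only [add_mul]
    rw [Finset.sum_congr rfl fun i _ => integral_add (hint1 i) (hint2 i), Finset.sum_add_distrib,
      h3, zero_add]
  · exact integrable_continuousOn_mul_radial hρ hη
      (((continuous_peval _).continuousOn.mul hfc).mul (by fun_prop))

theorem IsHarmPoly.integral_mul_radial_eq_taylorPoly {j : ℕ} {P : MvPolynomial (Fin n) ℝ}
    (hP : IsHarmPoly P) (hPj : P.IsHomogeneous j) {u : En n → ℝ} {U : Set (En n)}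
    (hu : IsHarm u U) {η : ℝ → ℝ} {ρ R : ℝ} (hρ : 0 < ρ) (hR : ρ < R) (hRU : ball 0 R ⊆ U)
    (hη : IsRadialProfile η (ρ ^ 2)) :
    ∫ y, peval P y * u y * radial η y
      = ∫ y, peval P y * peval (taylorPoly j u) y * radial η y := by
  have h0 : (0 : En n) ∈ U := hRU (mem_ball_self (hρ.trans hR))
  induction j generalizing P u η with
  | zero =>
    have hPc := MvPolynomial.totalDegree_eq_zero_iff_eq_C.1
      ((MvPolynomial.totalDegree_zero_iff_isHomogeneous _).2 hPj)
    rw [hPc]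
    have h1 := hu.integral_mul_radial hρ hR hη (x := 0) hRU
    simp only [zero_add] at h1
    simp only [peval_C, taylorPoly, mul_assoc]
    rw [integral_const_mul, integral_const_mul, h1, integral_const_mul]
  | succ j ih =>
    have hj : ((j : ℝ) + 1) ≠ 0 := by positivity
    rw [← mul_right_inj' hj, hP.integral_mul_radial_succ hPj hu.isOpen hu.contDiffOn_one hρ.le
      ((closedBall_subset_ball hR).trans hRU) hη,
      hP.integral_mul_radial_succ hPj isOpen_univ
        ((contDiff_peval _).of_le (by exact_mod_cast le_top)).contDiffOn hρ.le (subset_univ _) hη]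
    congr 1
    refine Finset.sum_congr rfl fun i _ => ?_
    rw [ih (hP.pderiv i) hPj.pderiv (hu.pderiv i) hη.tail]
    simp only [partialDeriv1_peval, hu.pderiv_taylorPoly_succ h0 j i]

end orthogonality

/-! ### Division of series -/

section division

variable {n : ℕ}

/-- Formal division of series of polynomials, with weighted `ℓ¹` bounds. -/
theorem sum_wnorm_quotient_le {A B f : ℕ → MvPolynomial (Fin n) ℝ} {m : ℕ} {w : Fin n → ℝ}
    (hw : ∀ i, 0 ≤ w i) {κ S : ℝ} (hκ : 0 < κ)
    (hA : ∀ k, A k = ∑ p ∈ Finset.HasAntidiagonal.antidiagonal k, f p.1 * B p.2)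
    (hB : ∀ s < m, B s = 0) (hBm : ∀ i, κ * wnorm w (f i) ≤ wnorm w (B m * f i))
    (hBs : ∀ N, ∑ j ∈ Finset.range N, wnorm w (B (m + 1 + j)) ≤ κ / 2)
    (hAs : ∀ N, ∑ k ∈ Finset.range N, wnorm w (A k) ≤ S) (N : ℕ) :
    ∑ i ∈ Finset.range N, wnorm w (f i) ≤ 2 * S / κ := by
  have h1 : ∀ i, κ * wnorm w (f i) ≤ wnorm w (A (m + i))
      + ∑ j ∈ Finset.range i, wnorm w (f j) * wnorm w (B (m + i - j)) := by
    intro i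
    refine (hBm i).trans ?_
    have h2 : B m * f i = A (m + i) - ∑ j ∈ Finset.range i, f j * B (m + i - j) := by
      rw [hA, sum_antidiagonal_of_eq_zero hB]
      ring
    rw [h2]
    refine (wnorm_sub_le hw _ _).trans (add_le_add le_rfl ?_)
    refine (wnorm_sum_le hw _ _).trans (Finset.sum_le_sum fun j _ => wnorm_mul_le hw _ _)
  have h3 : κ * ∑ i ∈ Finset.range N, wnorm w (f i) ≤ S
      + ∑ i ∈ Finset.range N, ∑ j ∈ Finset.range i, wnorm w (f j) * wnorm w (B (m + i - j)) := by
    rw [Finset.mul_sum]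
    refine (Finset.sum_le_sum fun i _ => h1 i).trans ?_
    rw [Finset.sum_add_distrib]
    refine add_le_add (le_trans ?_ (hAs (m + N))) le_rfl
    rw [Finset.sum_range_add]
    exact le_add_of_nonneg_left (Finset.sum_nonneg fun _ _ => wnorm_nonneg hw _)
  have h4 : ∑ i ∈ Finset.range N, ∑ j ∈ Finset.range i, wnorm w (f j) * wnorm w (B (m + i - j))
      ≤ κ / 2 * ∑ i ∈ Finset.range N, wnorm w (f i) := by
    rw [Finset.sum_sigma', Finset.mul_sum]
    have hbij := Finset.sum_nbij' (s := (Finset.range N).sigma fun i => Finset.range i)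
      (t := (Finset.range N).sigma fun j => Finset.range (N - 1 - j))
      (f := fun x : (_ : ℕ) × ℕ => wnorm w (f x.2) * wnorm w (B (m + x.1 - x.2)))
      (g := fun x : (_ : ℕ) × ℕ => wnorm w (f x.1) * wnorm w (B (m + 1 + x.2)))
      (fun x => ⟨x.2, x.1 - x.2 - 1⟩) (fun x => ⟨x.1 + x.2 + 1, x.1⟩)
      ?_ ?_ ?_ ?_ ?_
    · rw [hbij]
      rw [Finset.sum_sigma]
      refine Finset.sum_le_sum fun j _ => ?_
      dsimp only
      rw [← Finset.mul_sum, mul_comm]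
      exact mul_le_mul_of_nonneg_right (hBs _) (wnorm_nonneg hw _)
    · rintro ⟨i, j⟩ h
      simp only [Finset.mem_sigma, Finset.mem_range] at h ⊢
      omega
    · rintro ⟨i, j⟩ h
      simp only [Finset.mem_sigma, Finset.mem_range] at h ⊢
      omega
    · rintro ⟨i, j⟩ h
      simp only [Finset.mem_sigma, Finset.mem_range] at h
      have : j + (i - j - 1) + 1 = i := by omega
      simp [this]
    · rintro ⟨i, j⟩ h
      have : i + j + 1 - i - 1 = j := by omega
      simp [this]
    · rintro ⟨i, j⟩ h
      simp only [Finset.mem_sigma, Finset.mem_range] at h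
      dsimp only
      rw [show m + 1 + (i - j - 1) = m + i - j by omega]
  rw [le_div_iff₀ hκ]
  nlinarith

/-- The pointwise sum of a series of polynomials. -/
def polySum (q : ℕ → MvPolynomial (Fin n) ℝ) (x : En n) : ℝ := ∑' j, peval (q j) x

theorem summable_of_sum_wnorm_le {q : ℕ → MvPolynomial (Fin n) ℝ} {w : Fin n → ℝ}
    (hw : ∀ i, 0 ≤ w i) {S : ℝ} (h : ∀ N, ∑ i ∈ Finset.range N, wnorm w (q i) ≤ S) :
    Summable fun j => wnorm w (q j) :=
  summable_of_sum_range_le (fun _ => wnorm_nonneg hw _) h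

theorem summable_norm_peval {q : ℕ → MvPolynomial (Fin n) ℝ} {w : Fin n → ℝ}
    (hq : Summable fun j => wnorm w (q j)) {x : En n} (hx : ∀ i, |x i| ≤ w i) :
    Summable fun j => ‖peval (q j) x‖ :=
  Summable.of_nonneg_of_le (fun _ => norm_nonneg _) (fun _ => abs_peval_le_wnorm hx _) hq

theorem polySum_eq_mul {A B f : ℕ → MvPolynomial (Fin n) ℝ} {w : Fin n → ℝ}
    (hA : ∀ k, A k = ∑ p ∈ Finset.HasAntidiagonal.antidiagonal k, f p.1 * B p.2)
    (hf : Summable fun j => wnorm w (f j)) (hB : Summable fun j => wnorm w (B j))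
    {x : En n} (hx : ∀ i, |x i| ≤ w i) :
    polySum A x = polySum f x * polySum B x := by
  unfold polySum
  rw [tsum_mul_tsum_eq_tsum_sum_antidiagonal_of_summable_norm (summable_norm_peval hf hx)
    (summable_norm_peval hB hx)]
  refine tsum_congr fun k => ?_
  rw [hA, peval_sum]
  simp only [peval_mul]

end division

/-! ### Lower bounds for integrals of harmonic functions -/

section lower

variable {n : ℕ} {U : Set (En n)}

theorem exists_partialDerivList_ne_zero {u : En n → ℝ} {m : ℕ} (h : taylorPoly m u ≠ 0) :
    ∃ l : List (Fin n), l.length = m ∧ partialDerivList l u 0 ≠ 0 := by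
  by_contra! hcon
  have h1 := wnorm_taylorPoly_le (u := u) (w := fun _ => 1) (fun _ => zero_le_one) (D := 0) m
    fun l hl => by simp [hcon l hl]
  rw [mul_zero] at h1
  exact h ((wnorm_eq_zero_iff fun _ => one_pos).1
    (h1.antisymm (wnorm_nonneg (fun _ => zero_le_one) _)))

theorem IsHarm.exists_le_setIntegral {v : En n → ℝ} (h : IsHarm v U) (h0 : (0 : En n) ∈ U)
    {m : ℕ} (hm : taylorPoly m v ≠ 0) :
    ∃ c > 0, ∃ δ₀ > 0, ball 0 δ₀ ⊆ U ∧ ∀ z ∈ ball (0 : En n) δ₀, ∀ δ > 0,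
      ball z δ ⊆ ball 0 δ₀ → c * δ ^ (n + m) ≤ ∫ y in ball z δ, |v y| := by
  obtain ⟨l, hl, hl0⟩ := exists_partialDerivList_ne_zero hm
  set κ := |partialDerivList l v 0| with hκ
  have hκ0 : 0 < κ := abs_pos.2 hl0
  have hcont := ((h.pderivList l).continuousOn.continuousAt (h.isOpen.mem_nhds h0)).abs
  have h1 : ∀ᶠ y in 𝓝 (0 : En n), κ / 2 < |partialDerivList l v y| :=
    hcont.eventually (lt_mem_nhds (by show κ / 2 < κ; linarith))
  obtain ⟨δ₁, hδ₁, hδ₁'⟩ := Metric.eventually_nhds_iff_ball.1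
    (h1.and (h.isOpen.mem_nhds h0))
  have hΛ := derivConst_pos n
  have hv := unitBallVol_pos n
  refine ⟨κ / 2 * ((8 : ℝ)⁻¹ ^ n * unitBallVol n) / (m.factorial * (2 * derivConst n) ^ m),
    by positivity, δ₁ / 2, by positivity, fun y hy =>
      (hδ₁' y (ball_subset_ball (by linarith) hy)).2, fun z hz δ hδ hzδ => ?_⟩
  have hcb : closedBall z δ ⊆ U := by
    rw [← closure_ball z hδ.ne']
    refine (closure_mono hzδ).trans ?_
    rw [closure_ball _ (by positivity)]
    exact (closedBall_subset_ball (by linarith)).trans fun y hy => (hδ₁' y hy).2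
  have hintv : IntegrableOn v (ball z δ) :=
    ((h.continuousOn.mono hcb).integrableOn_compact (isCompact_closedBall _ _)).mono_set
      ball_subset_closedBall
  have hintg : IntegrableOn (fun y => |v y|) (ball z δ) := hintv.abs
  set J := ∫ y in ball z δ, |v y| with hJ
  have hd : (0 : ℝ) < (δ / 8) ^ n * unitBallVol n := by positivity
  have h2 : ∀ y ∈ ball z (δ / 2), |v y| ≤ J / ((δ / 8) ^ n * unitBallVol n) := by
    intro y hy
    have hsub : ball y (δ / 2) ⊆ ball z δ := ball_subset_ball' (by
      have := mem_ball.1 hy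
      linarith)
    have h3 := h.abs_le_setIntegral (x := y) (ρ := δ / 2) (by positivity)
      (hsub.trans (ball_subset_closedBall.trans hcb)) (hintv.mono_set hsub)
    rw [show δ / 2 / 4 = δ / 8 by ring] at h3
    rw [le_div_iff₀ hd]
    exact h3.trans (setIntegral_mono_set hintg (ae_of_all _ fun _ => abs_nonneg _)
      hsub.eventuallyLE)
  have h4 := h.abs_partialDerivList_le (x := z) (ρ := δ / 2) (by positivity)
    ((ball_subset_ball (by linarith)).trans (ball_subset_closedBall.trans hcb)) h2 l z
    (mem_ball_self (by positivity))
  have h5 := (hδ₁' z (ball_subset_ball (by linarith) hz)).1.le.trans h4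
  rw [hl] at h5
  have e1 : (m.factorial : ℝ) * (derivConst n / (δ / 2)) ^ m * (J / ((δ / 8) ^ n * unitBallVol n))
      = J * ((m.factorial * (2 * derivConst n) ^ m) / ((8 : ℝ)⁻¹ ^ n * unitBallVol n)
        / δ ^ (n + m)) := by
    rw [pow_add, show δ / 8 = 8⁻¹ * δ by ring, mul_pow,
      show derivConst n / (δ / 2) = 2 * derivConst n / δ by field_simp, div_pow]
    field_simp
  rw [e1] at h5
  have hX : 0 < δ ^ (n + m) := by positivity
  have hY : (0 : ℝ) < m.factorial * (2 * derivConst n) ^ m := by positivity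
  have hZ : (0 : ℝ) < (8 : ℝ)⁻¹ ^ n * unitBallVol n := by positivity
  rw [div_mul_eq_mul_div, div_le_iff₀ hY]
  rw [div_div, mul_div_assoc', le_div_iff₀ (by positivity)] at h5
  linarith

theorem IsHarm.mul_le_setIntegral_mul {v : En n → ℝ} {k : ℕ} {c δ₀ : ℝ} (hc : 0 < c)
    (hvU : ball 0 δ₀ ⊆ U) (hvc : ContinuousOn v U)
    (hv : ∀ z ∈ ball (0 : En n) δ₀, ∀ δ > 0,
      ball z δ ⊆ ball 0 δ₀ → c * δ ^ k ≤ ∫ y in ball z δ, |v y|) :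
    ∃ C > 0, ∀ u, IsHarm u U → ∀ t > 0, t < δ₀ → ∀ x ∈ closedBall (0 : En n) (t / 2),
      |u x| * t ^ k ≤ C * ∫ y in ball 0 t, |u y| * |v y| := by
  have hG := gradConst_pos n
  set ε : ℝ := 1 / (8 * (n + 1) * (gradConst n + 1) * 2 ^ (k + 1)) with hε
  have hε0 : 0 < ε := by positivity
  have hε8 : ε ≤ 1 / 8 := by
    rw [hε]
    refine one_div_le_one_div_of_le (by norm_num) ?_
    have h1 : (1 : ℝ) ≤ n + 1 := by linarith [n.cast_nonneg (α := ℝ)]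
    have h2 : 1 ≤ gradConst n + 1 := by linarith
    have h3 : (1 : ℝ) ≤ 2 ^ (k + 1) := one_le_pow₀ (by norm_num)
    have h4 := mul_le_mul (mul_le_mul h1 h2 zero_le_one (by positivity)) h3 zero_le_one
      (by positivity)
    linarith
  refine ⟨2 ^ (k + 2) / (c * ε ^ k), by positivity, fun u hu t ht htδ x hx => ?_⟩
  have htU : closedBall 0 t ⊆ U := (closedBall_subset_ball htδ).trans hvU
  have huc : ContinuousOn u (closedBall 0 t) := hu.continuousOn.mono htU
  obtain ⟨z, hz, hzmax⟩ := (isCompact_closedBall (0 : En n) t).exists_isMaxOn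
    (nonempty_closedBall.2 ht.le)
    (f := fun y => (t - ‖y‖) ^ (k + 1) * |u y|) (by fun_prop)
  have hmax : ∀ y ∈ closedBall (0 : En n) t,
      (t - ‖y‖) ^ (k + 1) * |u y| ≤ (t - ‖z‖) ^ (k + 1) * |u z| := fun y hy => hzmax hy
  have hI : IntegrableOn (fun y => |u y| * |v y|) (ball 0 t) :=
    ((huc.abs.mul (hvc.mono htU).abs).integrableOn_compact
      (isCompact_closedBall _ _)).mono_set ball_subset_closedBall
  set I := ∫ y in ball 0 t, |u y| * |v y| with hIdef
  have hI0 : 0 ≤ I := integral_nonneg fun _ => by positivity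
  have hx' : ‖x‖ ≤ t / 2 := mem_closedBall_zero_iff.1 hx
  have hz' : ‖z‖ ≤ t := mem_closedBall_zero_iff.1 hz
  have hxm := hmax x (closedBall_subset_closedBall (by linarith) hx)
  have h1 : (t / 2) ^ (k + 1) * |u x| ≤ (t - ‖z‖) ^ (k + 1) * |u z| :=
    (mul_le_mul_of_nonneg_right (pow_le_pow_left₀ (by positivity) (by linarith) _)
      (abs_nonneg _)).trans hxm
  set d := t - ‖z‖ with hd
  rcases (sub_nonneg.2 hz').eq_or_lt with hd0 | hd0
  · rw [← hd] at hd0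
    rw [← hd0, zero_pow (by omega), zero_mul] at h1
    have h2 : |u x| = 0 := le_antisymm (nonpos_of_mul_nonpos_right h1 (by positivity)) (abs_nonneg _)
    rw [h2, zero_mul]
    positivity
  rw [← hd] at hd0
  have h2 : ∀ y ∈ ball z (d / 2), |u y| ≤ 2 ^ (k + 1) * |u z| := by
    intro y hy
    have hy1 : ‖y‖ ≤ ‖z‖ + d / 2 := by
      have := norm_add_le z (y - z)
      rw [add_sub_cancel] at this
      have := mem_ball_iff_norm.1 hy
      linarith
    have h3 := hmax y (mem_closedBall_zero_iff.2 (by linarith))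
    have h4 : (d / 2) ^ (k + 1) * |u y| ≤ d ^ (k + 1) * |u z| :=
      (mul_le_mul_of_nonneg_right (pow_le_pow_left₀ (by positivity) (by linarith) _)
        (abs_nonneg _)).trans h3
    rw [div_pow, div_mul_eq_mul_div, div_le_iff₀ (by positivity)] at h4
    have h5 : 0 < d ^ (k + 1) := by positivity
    nlinarith
  have hdt : d ≤ t := by linarith [norm_nonneg z]
  have hzt : ball z d ⊆ ball 0 t := ball_subset_ball' (by rw [dist_zero_right]; linarith)
  have hzU : ball z d ⊆ U := hzt.trans (ball_subset_closedBall.trans htU)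
  have h6 : ∀ i, ∀ y ∈ ball z (d / 4),
      |partialDeriv1 i u y| ≤ gradConst n / (d / 4) * (2 ^ (k + 1) * |u z|) := by
    intro i y hy
    have hsub : ball y (d / 4) ⊆ ball z (d / 2) := ball_subset_ball' (by
      have := mem_ball.1 hy
      linarith)
    exact hu.abs_partialDeriv1_le (by positivity)
      ((hsub.trans (ball_subset_ball (by linarith))).trans hzU) (fun w hw => h2 w (hsub hw)) i
  have h7 : ∀ y ∈ ball z (ε * d), |u z| / 2 ≤ |u y| := by
    intro y hy
    have hyz : ‖y - z‖ < ε * d := mem_ball_iff_norm.1 hy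
    have hyd : ε * d ≤ d / 8 := by nlinarith
    have htr := hu.translate (p := z) (ρ := d / 4) ((ball_subset_ball (by linarith)).trans hzU)
    have h8 := htr.abs_sub_sum_taylorPoly_le (r := d / 4) (by positivity) subset_rfl 1
      (D := gradConst n / (d / 4) * (2 ^ (k + 1) * |u z|)) (fun l hl w hw => by
        obtain ⟨i, rfl⟩ := List.length_eq_one_iff.1 hl
        rw [partialDerivList_comp_add]
        exact h6 i _ ((ball_eq_add _ _).2 hw)) (x := y - z)
      (by rw [mem_ball_zero_iff]; linarith)
    simp only [add_sub_cancel, Finset.sum_range_one, taylorPoly, peval_C, add_zero, pow_one,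
      Nat.factorial_one, Nat.cast_one, div_one] at h8
    have h9 : (n * ‖y - z‖) * (gradConst n / (d / 4) * (2 ^ (k + 1) * |u z|)) ≤ |u z| / 2 := by
      have e1 : (n * ‖y - z‖) * (gradConst n / (d / 4) * (2 ^ (k + 1) * |u z|))
          ≤ ((n + 1) * (ε * d)) * ((gradConst n + 1) / (d / 4) * (2 ^ (k + 1) * |u z|)) := by
        gcongr <;> linarith
      refine e1.trans (le_of_eq ?_)
      rw [hε]
      field_simp
      ring
    have h10 := abs_sub_abs_le_abs_sub (u z) (u y)
    rw [abs_sub_comm] at h10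
    linarith
  have hεd : ε * d ≤ d := by nlinarith
  have hzδ : ball z (ε * d) ⊆ ball 0 t := (ball_subset_ball hεd).trans hzt
  have h11 := hv z (mem_ball_zero_iff.2 (by linarith)) (ε * d) (by positivity)
    (hzδ.trans (ball_subset_ball htδ.le))
  have h12 : |u z| / 2 * (c * (ε * d) ^ k) ≤ I := by
    refine (mul_le_mul_of_nonneg_left h11 (by positivity)).trans ?_
    rw [← integral_const_mul]
    refine le_trans (setIntegral_mono_on ?_ (hI.mono_set hzδ) measurableSet_ball fun y hy =>
      mul_le_mul_of_nonneg_right (h7 y hy) (abs_nonneg _))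
      (setIntegral_mono_set hI (ae_of_all _ fun _ => by positivity) hzδ.eventuallyLE)
    refine Integrable.const_mul ?_ _
    exact ((hvc.mono htU).abs.integrableOn_compact (isCompact_closedBall _ _)).mono_set
      (hzδ.trans ball_subset_closedBall)
  have h13 : (t / 2) ^ (k + 1) * |u x| ≤ t * (d ^ k * |u z|) := by
    refine h1.trans ?_
    rw [pow_succ]
    have : 0 ≤ d ^ k * |u z| := by positivity
    nlinarith
  have h14 : |u x| * t ^ k ≤ 2 ^ (k + 1) * (d ^ k * |u z|) := by
    rw [div_pow, div_mul_eq_mul_div, div_le_iff₀ (by positivity), pow_succ t] at h13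
    refine le_of_mul_le_mul_left ?_ ht
    linarith
  rw [mul_pow] at h12
  rw [div_mul_eq_mul_div, le_div_iff₀ (by positivity)]
  calc |u x| * t ^ k * (c * ε ^ k) ≤ 2 ^ (k + 1) * (d ^ k * |u z|) * (c * ε ^ k) := by gcongr
    _ = 2 ^ (k + 2) * (|u z| / 2 * (c * (ε ^ k * d ^ k))) := by ring
    _ ≤ _ := by gcongr

end lower

/-! ### A local upper bound by the leading coefficient -/

section upper

variable {n : ℕ} {U : Set (En n)}

theorem abs_radial_bumpProfile (r : ℝ) (y : En n) :
    |radial (bumpProfile r) y| = radial (bumpProfile r) y :=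
  abs_of_nonneg (bumpProfile_nonneg _ _)

theorem abs_integral_mul_radial_le {F : En n → ℝ} {r K : ℝ} (hr : 0 < r)
    (hF : ∀ y ∈ ball (0 : En n) r, |F y| ≤ K) :
    |∫ y, F y * radial (bumpProfile r) y| ≤ K * (r ^ n * unitBallVol n) := by
  have hη := isRadialProfile_bumpProfile hr
  have hK : 0 ≤ K := (abs_nonneg _).trans (hF 0 (mem_ball_self hr))
  have h1 : ∀ y, ‖F y * radial (bumpProfile r) y‖ ≤ K * radial (bumpProfile r) y := by
    intro y
    by_cases hy : y ∈ ball (0 : En n) r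
    · rw [norm_mul, Real.norm_eq_abs, Real.norm_eq_abs, abs_radial_bumpProfile]
      exact mul_le_mul_of_nonneg_right (hF y hy) (bumpProfile_nonneg _ _)
    · rw [hη.radial_eq_zero hr.le y hy]
      simp
  refine (norm_integral_le_of_norm_le ((hη.integrable_radial hr.le).const_mul K)
    (ae_of_all _ h1)).trans ?_
  rw [integral_const_mul]
  exact mul_le_mul_of_nonneg_left (integral_bump_le hr) hK

theorem IsHarm.abs_integral_mul_le {u v : En n → ℝ} (hu : IsHarm u U) (hv : IsHarm v U)
    {ρ₀ M M₀ r θ c : ℝ} {m : ℕ} (hρ₀ : ball 0 ρ₀ ⊆ U)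
    (hM₀ : ∀ y ∈ ball (0 : En n) ρ₀, |v y| ≤ M₀) (hr : 0 < r) (hrρ : r < ρ₀ / 2)
    (hr1 : n * r * derivConst n / ρ₀ < 1) (hθ : θ = 4 * n ^ 2 * derivConst n ^ 2 / ρ₀)
    (hθr : θ * r ≤ 1 / 2) (hM : ∀ y ∈ ball (0 : En n) (r / 4), |u y| ≤ M)
    (hv0 : ∀ j < m, taylorPoly j v = 0)
    (hum : taylorPoly m u = MvPolynomial.C c * taylorPoly m v) :
    |∫ y, u y * v y * radial (bumpProfile r) y| ≤ r ^ n * unitBallVol n *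
      (|c| * r ^ (2 * m) * wnorm (fun _ => 1) (taylorPoly m v) ^ 2
        + 2 * (θ * r) ^ (m + 1) * (M * M₀)) := by
  have hη := isRadialProfile_bumpProfile hr
  have hΛ := derivConst_pos n
  have hvol := unitBallVol_pos n
  have hρ₀0 : 0 < ρ₀ := by linarith
  have hM0 : 0 ≤ M := (abs_nonneg _).trans (hM 0 (mem_ball_self (by positivity)))
  have hM₀0 : 0 ≤ M₀ := (abs_nonneg _).trans (hM₀ 0 (mem_ball_self hρ₀0))
  have hrU : closedBall 0 r ⊆ U := (closedBall_subset_ball (by linarith)).trans hρ₀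
  have huc : ContinuousOn u (closedBall 0 r) := hu.continuousOn.mono hrU
  set a := n * r * derivConst n / ρ₀ with ha
  have ha0 : 0 ≤ a := by positivity
  have hvj : ∀ j, ∀ y ∈ ball (0 : En n) r, |peval (taylorPoly j v) y| ≤ a ^ j * M₀ := by
    intro j y hy
    refine (abs_peval_le_wnorm (w := fun _ => r) (fun i => (abs_apply_le_norm y i).trans
      (mem_ball_zero_iff.1 hy).le) _).trans ?_
    simpa using hv.wnorm_taylorPoly_le_of_bound hρ₀0 hρ₀ hM₀ (w := fun _ => r) (fun _ => hr.le) j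
  have huj : ∀ j, ∀ y ∈ ball (0 : En n) r,
      |peval (taylorPoly j u) y| ≤ (4 * n * derivConst n) ^ j * M := by
    intro j y hy
    refine (abs_peval_le_wnorm (w := fun _ => r) (fun i => (abs_apply_le_norm y i).trans
      (mem_ball_zero_iff.1 hy).le) _).trans ?_
    refine (hu.wnorm_taylorPoly_le_of_bound (ρ := r / 4) (by positivity)
      ((ball_subset_ball (by linarith)).trans (ball_subset_closedBall.trans hrU)) hM
      (w := fun _ => r) (fun _ => hr.le) j).trans (le_of_eq ?_)
    congr 2
    rw [Finset.sum_const, Finset.card_univ, Fintype.card_fin, nsmul_eq_mul]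
    field_simp
  set G : ℕ → En n → ℝ := fun j y =>
    peval (taylorPoly j v) y * u y * radial (bumpProfile r) y with hG
  have hGint : ∀ j, Integrable (G j) := fun j =>
    integrable_continuousOn_mul_radial hr.le hη ((continuous_peval _).continuousOn.mul huc)
  have huη : Integrable fun y => |u y| * radial (bumpProfile r) y :=
    integrable_continuousOn_mul_radial hr.le hη huc.abs
  have hGle : ∀ j y, ‖G j y‖ ≤ a ^ j * M₀ * (|u y| * radial (bumpProfile r) y) := by
    intro j y
    by_cases hy : y ∈ ball (0 : En n) r
    · simp only [hG]
      rw [mul_assoc, norm_mul, norm_mul, Real.norm_eq_abs, Real.norm_eq_abs, Real.norm_eq_abs,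
        abs_radial_bumpProfile]
      exact mul_le_mul_of_nonneg_right (hvj j y hy)
        (mul_nonneg (abs_nonneg _) (bumpProfile_nonneg _ _))
    · simp [hG, hη.radial_eq_zero hr.le y hy]
  have hsum : HasSum (fun j => ∫ y, G j y) (∫ y, ∑' j, G j y) := by
    refine hasSum_integral_of_summable_integral_norm hGint ?_
    refine Summable.of_nonneg_of_le (fun j => integral_nonneg fun _ => norm_nonneg _) (fun j =>
      integral_mono (hGint j).norm (huη.const_mul _) (hGle j)) ?_
    simp only [integral_const_mul]
    exact ((summable_geometric_of_lt_one ha0 hr1).mul_right _).mul_right _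
  have htsum : ∀ y, ∑' j, G j y = u y * v y * radial (bumpProfile r) y := by
    intro y
    by_cases hy : y ∈ ball (0 : En n) r
    · have hyr := mem_ball_zero_iff.1 hy
      have h1 := hv.hasSum_taylorPoly hρ₀0 hρ₀ hM₀ (x := y) (by linarith) (lt_of_le_of_lt (by
        rw [ha]
        gcongr) hr1)
      have h2 := (h1.mul_right (u y * radial (bumpProfile r) y)).tsum_eq
      rw [show u y * v y * radial (bumpProfile r) y = v y * (u y * radial (bumpProfile r) y) by
        ring, ← h2]
      refine tsum_congr fun j => ?_
      simp only [hG]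
      ring
    · simp [hG, hη.radial_eq_zero hr.le y hy]
  simp only [htsum] at hsum
  have hGeq : ∀ j, ∫ y, G j y
      = ∫ y, peval (taylorPoly j v) y * peval (taylorPoly j u) y * radial (bumpProfile r) y :=
    fun j => (hv.isHarmPoly_taylorPoly (hrU (mem_closedBall_self hr.le))
      j).integral_mul_radial_eq_taylorPoly (isHomogeneous_taylorPoly j v) hu hr
      (R := ρ₀) (by linarith) hρ₀ hη
  have haθ : a * (4 * n * derivConst n) = θ * r := by
    rw [ha, hθ]
    field_simp
  have hθr0 : 0 ≤ θ * r := by rw [← haθ]; positivity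
  have hGj : ∀ j, ‖∫ y, G j y‖ ≤ (θ * r) ^ j * (M * M₀ * (r ^ n * unitBallVol n)) := by
    intro j
    rw [hGeq, Real.norm_eq_abs]
    refine (abs_integral_mul_radial_le hr (K := (a ^ j * M₀) * ((4 * n * derivConst n) ^ j * M))
      fun y hy => ?_).trans (le_of_eq ?_)
    · rw [abs_mul]
      exact mul_le_mul (hvj j y hy) (huj j y hy) (abs_nonneg _) (by positivity)
    · rw [← haθ, mul_pow]
      ring
  have hGm : |∫ y, G m y| ≤ |c| * r ^ (2 * m) * wnorm (fun _ => 1) (taylorPoly m v) ^ 2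
      * (r ^ n * unitBallVol n) := by
    rw [hGeq]
    refine abs_integral_mul_radial_le hr fun y hy => ?_
    have h1 := abs_peval_le_of_isHomogeneous (isHomogeneous_taylorPoly m v) y
    have h2 : |peval (taylorPoly m v) y| ≤ wnorm (fun _ => 1) (taylorPoly m v) * r ^ m :=
      h1.trans (mul_le_mul_of_nonneg_left (pow_le_pow_left₀ (norm_nonneg _)
        (mem_ball_zero_iff.1 hy).le _) (wnorm_nonneg (fun _ => zero_le_one) _))
    rw [hum, peval_mul, peval_C, abs_mul, abs_mul]
    have h3 := mul_le_mul h2 h2 (abs_nonneg _) ((abs_nonneg _).trans h2)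
    have h4 := mul_le_mul_of_nonneg_left h3 (abs_nonneg c)
    calc _ = |c| * (|peval (taylorPoly m v) y| * |peval (taylorPoly m v) y|) := by ring
      _ ≤ _ := h4
      _ = _ := by rw [two_mul, pow_add]; ring
  have hGlow : ∀ j < m, ∫ y, G j y = 0 := by
    intro j hj
    simp [hG, hv0 j hj]
  rw [← hsum.tsum_eq, ← hsum.summable.sum_add_tsum_nat_add (m + 1), Finset.sum_range_succ,
    Finset.sum_eq_zero fun j hj => hGlow j (Finset.mem_range.1 hj), zero_add]
  have htail : ‖∑' j, ∫ y, G (j + (m + 1)) y‖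
      ≤ 2 * ((θ * r) ^ (m + 1) * (M * M₀ * (r ^ n * unitBallVol n))) := by
    refine tsum_of_norm_bounded (hasSum_geometric_two.mul_right _) fun j => ?_
    refine (hGj _).trans ?_
    rw [pow_add, mul_assoc]
    gcongr
  rw [Real.norm_eq_abs] at htail
  refine (abs_add_le _ _).trans ((add_le_add hGm htail).trans (le_of_eq ?_))
  ring

theorem IsHarm.exists_abs_le_leading_coeff {v : En n → ℝ} (hv : IsHarm v U) (h0 : (0 : En n) ∈ U) {m : ℕ}
    (hv0 : ∀ j < m, taylorPoly j v = 0) (hvm : taylorPoly m v ≠ 0) :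
    ∃ s > 0, ∃ C > 0, ball 0 s ⊆ U ∧ ∀ u c, IsHarm u U →
      ((∀ x ∈ U, 0 ≤ u x * v x) ∨ ∀ x ∈ U, u x * v x ≤ 0) →
      taylorPoly m u = MvPolynomial.C c * taylorPoly m v →
      ∀ x ∈ ball (0 : En n) s, |u x| ≤ C * |c| := by
  obtain ⟨c₀, hc₀, δ₀, hδ₀, hδU, hlow⟩ := hv.exists_le_setIntegral h0 hvm
  obtain ⟨Cb, hCb, hmul⟩ := IsHarm.mul_le_setIntegral_mul (U := U) hc₀ hδU hv.continuousOn hlow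
  obtain ⟨ρ₀, hρ₀, M₀, hM₀0, hρU, hM₀⟩ := hv.exists_bound h0
  have hΛ := derivConst_pos n
  have hvol := unitBallVol_pos n
  set W := wnorm (fun _ => 1) (taylorPoly m v) with hW
  have hW0 : 0 ≤ W := wnorm_nonneg (fun _ => zero_le_one) _
  obtain ⟨θ, hθ⟩ : ∃ θ, θ = 4 * n ^ 2 * derivConst n ^ 2 / ρ₀ := ⟨_, rfl⟩
  have hθ0 : 0 ≤ θ := by rw [hθ]; positivity
  set K := Cb * unitBallVol n * 2 ^ (n + m) with hK
  have hK0 : 0 < K := by positivity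
  have hsmall : ∀ᶠ r : ℝ in 𝓝[>] 0, (r < ρ₀ / 2 ∧ n * r * derivConst n / ρ₀ < 1) ∧
      (θ * r ≤ 1 / 2 ∧ r < δ₀) ∧ K * (2 * θ ^ (m + 1) * M₀) * r ≤ 1 / 2 ∧ r < 1 := by
    have ht : ∀ a : ℝ, Tendsto (fun r : ℝ => a * r) (𝓝[>] 0) (𝓝 0) := fun a => by
      have : Tendsto (fun r : ℝ => a * r) (𝓝 0) (𝓝 (a * 0)) := tendsto_id.const_mul a
      rw [mul_zero] at this
      exact this.mono_left nhdsWithin_le_nhds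
    have hid : ∀ b : ℝ, 0 < b → ∀ᶠ r : ℝ in 𝓝[>] 0, r < b := fun b hb =>
      nhdsWithin_le_nhds (gt_mem_nhds hb)
    refine ((hid _ (by positivity)).and ?_).and
      ((Filter.Eventually.and ?_ (hid _ hδ₀)).and (Filter.Eventually.and ?_ (hid _ one_pos)))
    · filter_upwards [(ht (n * derivConst n / ρ₀)).eventually (gt_mem_nhds one_pos)] with r hr
      rwa [mul_right_comm, mul_div_right_comm]
    · filter_upwards [(ht θ).eventually (gt_mem_nhds (half_pos one_pos))] with r hr using hr.le
    · filter_upwards [(ht (K * (2 * θ ^ (m + 1) * M₀))).eventually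
        (gt_mem_nhds (half_pos one_pos))] with r hr using hr.le
  obtain ⟨r, ⟨⟨hrρ, hr1⟩, ⟨hθr, hrδ⟩, hrK, hr1'⟩, hr⟩ :=
    (hsmall.and self_mem_nhdsWithin).exists
  have hr : 0 < r := hr
  have hrU : closedBall 0 r ⊆ U := (closedBall_subset_ball hrδ).trans hδU
  refine ⟨r / 4, by positivity, 2 * (K * W ^ 2) + 1, by positivity,
    (ball_subset_ball (by linarith)).trans (ball_subset_closedBall.trans hrU),
    fun u c hu hsign hum x hx => ?_⟩
  have huc : ContinuousOn u (closedBall 0 r) := hu.continuousOn.mono hrU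
  obtain ⟨z, hz, hzmax⟩ := (isCompact_closedBall (0 : En n) (r / 4)).exists_isMaxOn
    (nonempty_closedBall.2 (by positivity)) (f := fun y => |u y|)
    (huc.abs.mono (closedBall_subset_closedBall (by linarith)))
  have hmax : ∀ y ∈ closedBall (0 : En n) (r / 4), |u y| ≤ |u z| := fun y hy => hzmax hy
  have h1 := hmul u hu (r / 2) (by positivity) (by linarith) z
    (by rwa [show r / 2 / 2 = r / 4 by ring])
  have h2 := hu.abs_integral_mul_le hv hρU hM₀ hr hrρ hr1 hθ hθr (M := |u z|)
    (fun y hy => hmax y (ball_subset_closedBall hy)) hv0 hum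
  have hη := isRadialProfile_bumpProfile hr
  have h3 : ∫ y in ball 0 (r / 2), |u y| * |v y|
      ≤ |∫ y, u y * v y * radial (bumpProfile r) y| := by
    have habs : |∫ y, u y * v y * radial (bumpProfile r) y|
        = ∫ y, |u y * v y| * radial (bumpProfile r) y := by
      have hcase : ∀ y ∉ ball (0 : En n) r, radial (bumpProfile r) y = 0 := fun y hy =>
        hη.radial_eq_zero hr.le y hy
      rcases hsign with h | h
      · have e : ∀ y, u y * v y * radial (bumpProfile r) y
            = |u y * v y| * radial (bumpProfile r) y := by
          intro y
          by_cases hy : y ∈ ball (0 : En n) r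
          · rw [abs_of_nonneg (h y (hrU (ball_subset_closedBall hy)))]
          · rw [hcase y hy, mul_zero, mul_zero]
        simp only [e]
        exact abs_of_nonneg (integral_nonneg fun y =>
          mul_nonneg (abs_nonneg _) (bumpProfile_nonneg _ _))
      · have e : ∀ y, u y * v y * radial (bumpProfile r) y
            = -(|u y * v y| * radial (bumpProfile r) y) := by
          intro y
          by_cases hy : y ∈ ball (0 : En n) r
          · rw [abs_of_nonpos (h y (hrU (ball_subset_closedBall hy)))]
            ring
          · rw [hcase y hy, mul_zero, mul_zero, neg_zero]
        simp only [e]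
        rw [integral_neg, abs_neg]
        exact abs_of_nonneg (integral_nonneg fun y =>
          mul_nonneg (abs_nonneg _) (bumpProfile_nonneg _ _))
    rw [habs, ← integral_indicator measurableSet_ball]
    have hintg : Integrable fun y => |u y * v y| * radial (bumpProfile r) y :=
      integrable_continuousOn_mul_radial hr.le hη (huc.mul (hv.continuousOn.mono hrU)).abs
    refine integral_mono_of_nonneg (ae_of_all _ fun y => ?_) hintg (ae_of_all _ fun y => ?_)
    · exact indicator_nonneg (fun _ _ => by positivity) _
    · beta_reduce
      by_cases hy : y ∈ ball (0 : En n) (r / 2)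
      · rw [indicator_of_mem hy, radial_bumpProfile_eq_one hr (mem_ball_zero_iff.1 hy).le,
          mul_one, abs_mul]
      · rw [indicator_of_notMem hy]
        exact mul_nonneg (abs_nonneg _) (bumpProfile_nonneg _ _)
  have h4 := h1.trans (mul_le_mul_of_nonneg_left (h3.trans h2) hCb.le)
  rw [← hW] at h4
  have h5 : |u z| ≤ K * (|c| * W ^ 2 + 2 * θ ^ (m + 1) * r * (|u z| * M₀)) := by
    have e : Cb * (r ^ n * unitBallVol n *
        (|c| * r ^ (2 * m) * W ^ 2 + 2 * (θ * r) ^ (m + 1) * (|u z| * M₀)))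
        = K * (|c| * r ^ m * W ^ 2 + 2 * θ ^ (m + 1) * r * (|u z| * M₀)) * (r / 2) ^ (n + m) := by
      rw [hK, two_mul m, div_pow]
      field_simp
      ring
    rw [e] at h4
    refine (le_of_mul_le_mul_right h4 (by positivity)).trans ?_
    have hrm : r ^ m ≤ 1 := pow_le_one₀ hr.le hr1'.le
    have : |c| * r ^ m * W ^ 2 ≤ |c| * W ^ 2 := by
      rw [mul_right_comm]
      exact mul_le_of_le_one_right (by positivity) hrm
    gcongr
  have h6 := hmax x (ball_subset_closedBall hx)
  have h7 : K * (2 * θ ^ (m + 1) * M₀) * r * |u z| ≤ 1 / 2 * |u z| :=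
    mul_le_mul_of_nonneg_right hrK (abs_nonneg _)
  have h8 := abs_nonneg c
  nlinarith

end upper

/-! ### The local quotient series -/

section local_quotient

variable {n : ℕ} {U : Set (En n)}

theorem norm_le_sum_abs (x : En n) : ‖x‖ ≤ ∑ i, |x i| := by
  have h1 : x = ∑ i, x i • EuclideanSpace.single i (1 : ℝ) := by
    ext j
    simp [Finset.sum_apply, Pi.single_apply]
  conv_lhs => rw [h1]
  refine (norm_sum_le _ _).trans (Finset.sum_le_sum fun i _ => ?_)
  rw [norm_smul]
  simp

theorem sum_range_geometric_le {a K : ℝ} {k : ℕ} (ha : 0 ≤ a) (ha' : a ≤ 1 / 2) (hK : 0 ≤ K)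
    (N : ℕ) : ∑ j ∈ Finset.range N, a ^ (k + j) * K ≤ 2 * a ^ k * K := by
  rw [← Finset.sum_mul]
  refine mul_le_mul_of_nonneg_right ?_ hK
  simp only [pow_add]
  rw [← Finset.mul_sum, mul_comm 2]
  refine mul_le_mul_of_nonneg_left ?_ (by positivity)
  calc ∑ j ∈ Finset.range N, a ^ j ≤ ∑ j ∈ Finset.range N, (1 / 2 : ℝ) ^ j :=
        Finset.sum_le_sum fun j _ => pow_le_pow_left₀ ha ha' j
    _ ≤ 2 := sum_geometric_two_le N

theorem exists_series_div {f h : ℕ → MvPolynomial (Fin n) ℝ} {d : ℝ} (hd : d ≠ 0)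
    (hh : h 0 = MvPolynomial.C d) :
    ∃ g : ℕ → MvPolynomial (Fin n) ℝ,
      ∀ k, f k = ∑ p ∈ Finset.HasAntidiagonal.antidiagonal k, g p.1 * h p.2 := by
  have hu : IsUnit (PowerSeries.mk h) := by
    rw [PowerSeries.isUnit_iff_constantCoeff, ← PowerSeries.coeff_zero_eq_constantCoeff_apply,
      PowerSeries.coeff_mk, hh]
    exact (IsUnit.mk0 d hd).map MvPolynomial.C
  obtain ⟨y, hy⟩ := hu.dvd (a := PowerSeries.mk f)
  refine ⟨fun k => PowerSeries.coeff k y, fun k => ?_⟩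
  have := congrArg (PowerSeries.coeff k) hy
  rw [PowerSeries.coeff_mk, mul_comm, PowerSeries.coeff_mul] at this
  simpa only [PowerSeries.coeff_mk] using this

/-- `u` is harmonic on `U`, has the same zeros as `v`, and `u v` does not change sign. -/
structure IsNodalMate (v u : En n → ℝ) (U : Set (En n)) : Prop where
  isHarm : IsHarm u U
  zero_iff : ∀ x ∈ U, v x = 0 ↔ u x = 0
  sign : (∀ x ∈ U, 0 ≤ u x * v x) ∨ ∀ x ∈ U, u x * v x ≤ 0

theorem IsHarm.exists_taylorPoly_ne_zero {v : En n → ℝ} (hv : IsHarm v U) (h0 : (0 : En n) ∈ U)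
    (hne : ∀ r > 0, ∃ x ∈ ball (0 : En n) r, v x ≠ 0) :
    ∃ m, (∀ j < m, taylorPoly j v = 0) ∧ taylorPoly m v ≠ 0 := by
  classical
  obtain ⟨ρ, hρ, -, hsum⟩ := hv.exists_hasSum_taylorPoly h0
  have hex : ∃ m, taylorPoly m v ≠ 0 := by
    by_contra! hcon
    obtain ⟨x, hx, hx'⟩ := hne ρ hρ
    have := hsum x hx
    simp only [hcon, peval_zero] at this
    exact hx' (this.unique hasSum_zero)
  exact ⟨Nat.find hex, fun j hj => not_not.1 (Nat.find_min hex hj), Nat.find_spec hex⟩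

/-- A harmonic function that is a formal multiple of `v` is an actual multiple of `v` on a fixed
box, with a quotient controlled by the size of the function. -/
theorem IsHarm.exists_factor_series_of_bound {v : En n → ℝ} (hv : IsHarm v U)
    (h0 : (0 : En n) ∈ U) {m : ℕ} (hv0 : ∀ j < m, taylorPoly j v = 0) (hvm : taylorPoly m v ≠ 0)
    {s : ℝ} (hs : 0 < s) (hsU : ball 0 s ⊆ U) :
    ∃ w : Fin n → ℝ, (∀ i, 0 < w i) ∧ (∀ x : En n, (∀ i, |x i| ≤ w i) → x ∈ U) ∧
      ∃ C > 0, ∀ (u : En n → ℝ) (M : ℝ), IsHarm u U → (∀ x ∈ ball (0 : En n) s, |u x| ≤ M) →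
        ∀ f : ℕ → MvPolynomial (Fin n) ℝ, (∀ i, (f i).IsHomogeneous i) →
          (∀ k, taylorPoly k u
            = ∑ p ∈ Finset.HasAntidiagonal.antidiagonal k, f p.1 * taylorPoly p.2 v) →
          (∀ N, ∑ i ∈ Finset.range N, wnorm w (f i) ≤ C * M) ∧
          ∀ x : En n, (∀ i, |x i| ≤ w i) → u x = polySum f x * v x := by
  obtain ⟨ρ₀, hρ₀, M₀, hM₀0, hρU, hM₀⟩ := hv.exists_bound h0
  obtain ⟨w₁, hw₁, c₁, hc₁, hP⟩ := exists_weight_le_wnorm_mul hvm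
  have hΛ := derivConst_pos n
  obtain ⟨b, hb⟩ : ∃ b, b = n * derivConst n / ρ₀ := ⟨_, rfl⟩
  have hb0 : 0 ≤ b := by rw [hb]; positivity
  have hsmall : ∀ᶠ t : ℝ in 𝓝[>] 0, (n * t < s / 2 ∧ n * t < ρ₀ / 2) ∧
      (n * (n * t) * derivConst n / s < 1 ∧ n * (n * t) * derivConst n / ρ₀ < 1) ∧
      (t * b ≤ 1 / 2 ∧ t * (n * derivConst n / s) ≤ 1 / 2) ∧
      2 * b ^ (m + 1) * t * M₀ ≤ c₁ / 2 := by
    have ht : ∀ (a : ℝ) (e : ℝ) (F : ℝ → ℝ), 0 < e → (∀ t, F t = a * t) →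
        ∀ᶠ t : ℝ in 𝓝[>] 0, F t < e := fun a e F he hF => by
      have : Tendsto (fun r : ℝ => a * r) (𝓝 0) (𝓝 (a * 0)) := tendsto_id.const_mul a
      rw [mul_zero] at this
      simp only [hF]
      exact (this.mono_left nhdsWithin_le_nhds).eventually (gt_mem_nhds he)
    refine ((ht n _ _ (by positivity) fun _ => rfl).and
      (ht n _ _ (by positivity) fun _ => rfl)).and
      (((ht (n * n * derivConst n / s) _ _ one_pos fun t => by ring).and
        (ht (n * n * derivConst n / ρ₀) _ _ one_pos fun t => by ring)).and
      (((ht b (1 / 2) (fun t => t * b) (by norm_num) fun t => by ring).mono fun t h => h.le).and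
        ((ht (n * derivConst n / s) (1 / 2) _ (by norm_num) fun t => by ring).mono
          fun t h => h.le) |>.and ((ht (2 * b ^ (m + 1) * M₀) (c₁ / 2) _ (by positivity)
            fun t => by ring).mono fun t h => h.le)))
  obtain ⟨t, ⟨⟨hts, htρ⟩, ⟨hts1, htρ1⟩, ⟨htb, htbs⟩, htc⟩, ht⟩ :=
    (hsmall.and self_mem_nhdsWithin).exists
  have ht : 0 < t := ht
  set w : Fin n → ℝ := fun i => t * w₁ i with hwdef
  have hw : ∀ i, 0 < w i := fun i => mul_pos ht (hw₁ i).1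
  have hw0 : ∀ i, 0 ≤ w i := fun i => (hw i).le
  have hwsum : ∑ i, w i ≤ n * t := by
    refine (Finset.sum_le_sum (g := fun _ => t) fun i _ => ?_).trans (by simp)
    exact mul_le_of_le_one_right ht.le (hw₁ i).2
  have hwsum0 : 0 ≤ ∑ i, w i := Finset.sum_nonneg fun i _ => hw0 i
  have hbox : ∀ x : En n, (∀ i, |x i| ≤ w i) → ‖x‖ ≤ n * t := fun x hx =>
    (norm_le_sum_abs x).trans ((Finset.sum_le_sum fun i _ => hx i).trans hwsum)
  have hterm : ∀ {g : En n → ℝ} {r M : ℝ}, 0 < r → ball 0 r ⊆ U → IsHarm g U →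
      (∀ y ∈ ball (0 : En n) r, |g y| ≤ M) → ∀ j,
      wnorm w (taylorPoly j g) ≤ (t * (n * derivConst n / r)) ^ j * M := by
    intro g r M hr hrU hg hM j
    have hM0 : 0 ≤ M := (abs_nonneg _).trans (hM 0 (mem_ball_self hr))
    refine (hg.wnorm_taylorPoly_le_of_bound hr hrU hM hw0 j).trans ?_
    refine mul_le_mul_of_nonneg_right (pow_le_pow_left₀ (by positivity) ?_ j) hM0
    calc (∑ i, w i) * derivConst n / r ≤ (n * t) * derivConst n / r := by gcongr
      _ = _ := by ring
  refine ⟨w, hw, fun x hx => hρU (mem_ball_zero_iff.2 (by linarith [hbox x hx])),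
    4 / (t ^ m * c₁), by positivity, fun u M hu hub f hf hfk => ?_⟩
  have hM0 : 0 ≤ M := (abs_nonneg _).trans (hub 0 (mem_ball_self hs))
  have hvt := hterm hρ₀ hρU hv hM₀
  rw [← hb] at hvt
  have hut := hterm hs hsU hu hub
  have hle : ∀ i, t ^ m * c₁ * wnorm w (f i) ≤ wnorm w (taylorPoly m v * f i) := fun i =>
    le_wnorm_smul_mul (isHomogeneous_taylorPoly m v) (hf i) (hP (f i)) ht.le
  have htail : ∀ N, ∑ j ∈ Finset.range N, wnorm w (taylorPoly (m + 1 + j) v)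
      ≤ t ^ m * c₁ / 2 := by
    intro N
    refine (Finset.sum_le_sum fun j _ => hvt (m + 1 + j)).trans
      ((sum_range_geometric_le (by positivity) htb hM₀0.le N).trans ?_)
    rw [mul_pow, pow_succ t]
    have h1 : 0 < t ^ m := by positivity
    have := mul_le_mul_of_nonneg_left htc h1.le
    linarith
  have huN : ∀ N, ∑ j ∈ Finset.range N, wnorm w (taylorPoly j u) ≤ 2 * M := by
    intro N
    have h1 := sum_range_geometric_le (k := 0) (by positivity) htbs hM0 N
    simp only [zero_add, pow_zero, mul_one] at h1
    exact (Finset.sum_le_sum fun j _ => hut j).trans h1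
  have hsumf := sum_wnorm_quotient_le (A := fun k => taylorPoly k u)
    (B := fun k => taylorPoly k v) (m := m) hw0 (κ := t ^ m * c₁) (by positivity) hfk hv0 hle
    htail huN
  refine ⟨fun N => (hsumf N).trans (le_of_eq (by ring)), fun x hx => ?_⟩
  have hvs : Summable fun j => wnorm w (taylorPoly j v) := by
    refine Summable.of_nonneg_of_le (fun _ => wnorm_nonneg hw0 _) hvt ?_
    exact (summable_geometric_of_lt_one (by positivity) (by linarith)).mul_right _
  have hxn := hbox x hx
  have hconv : ∀ {g : En n → ℝ} {r M : ℝ}, 0 < r → ball 0 r ⊆ U → IsHarm g U →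
      (∀ y ∈ ball (0 : En n) r, |g y| ≤ M) → n * t < r / 2 →
      n * (n * t) * derivConst n / r < 1 → g x = polySum (fun j => taylorPoly j g) x := by
    intro g r M hr hrU hg hM h1 h2
    refine (hg.hasSum_taylorPoly hr hrU hM (by linarith) (lt_of_le_of_lt ?_ h2)).tsum_eq.symm
    gcongr
  rw [hconv hs hsU hu hub hts hts1, hconv hρ₀ hρU hv hM₀ htρ htρ1]
  exact polySum_eq_mul (A := fun k => taylorPoly k u) (B := fun k => taylorPoly k v) hfk (summable_of_sum_wnorm_le hw0 hsumf) hvs hx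

theorem taylorPoly_eq_C_mul {u v : En n → ℝ} {f : ℕ → MvPolynomial (Fin n) ℝ} {m : ℕ}
    (hv0 : ∀ j < m, taylorPoly j v = 0)
    (hfk : ∀ k, taylorPoly k u
      = ∑ p ∈ Finset.HasAntidiagonal.antidiagonal k, f p.1 * taylorPoly p.2 v) :
    taylorPoly m u = f 0 * taylorPoly m v := by
  have := sum_antidiagonal_of_eq_zero (B := fun k => taylorPoly k v) hv0 f 0
  simp only [add_zero, Finset.range_zero, Finset.sum_empty, zero_add] at this
  rw [hfk m, this]

theorem IsHarm.exists_factor_series {v : En n → ℝ} (hv : IsHarm v U) (h0 : (0 : En n) ∈ U)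
    (hne : ∀ r > 0, ∃ x ∈ ball (0 : En n) r, v x ≠ 0) :
    ∃ w : Fin n → ℝ, (∀ i, 0 < w i) ∧ (∀ x : En n, (∀ i, |x i| ≤ w i) → x ∈ U) ∧
      ∃ C > 0, ∀ u, IsNodalMate v u U → ∃ (f : ℕ → MvPolynomial (Fin n) ℝ) (c : ℝ), c ≠ 0 ∧
        (∀ i, (f i).IsHomogeneous i) ∧ f 0 = MvPolynomial.C c ∧
        (∀ N, ∑ i ∈ Finset.range N, wnorm w (f i) ≤ C * |c|) ∧
        ∀ x : En n, (∀ i, |x i| ≤ w i) → u x = polySum f x * v x := by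
  obtain ⟨m, hv0, hvm⟩ := hv.exists_taylorPoly_ne_zero h0 hne
  obtain ⟨s, hs, C, hC, hsU, hbound⟩ := hv.exists_abs_le_leading_coeff h0 hv0 hvm
  obtain ⟨w, hw, hwU, D, hD, H⟩ := hv.exists_factor_series_of_bound h0 hv0 hvm hs hsU
  refine ⟨w, hw, hwU, D * C, by positivity, fun u hu => ?_⟩
  obtain ⟨f, hf, -, hfk⟩ := exists_quotient_seq hu.isHarm hv h0
    (fun x hx => (hu.zero_iff x hx).1) hv0 hvm
  obtain ⟨c, hc⟩ : ∃ c, f 0 = MvPolynomial.C c := ⟨_, MvPolynomial.totalDegree_eq_zero_iff_eq_C.1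
    ((MvPolynomial.totalDegree_zero_iff_isHomogeneous _).2 (hf 0))⟩
  have hum : taylorPoly m u = MvPolynomial.C c * taylorPoly m v := by
    rw [taylorPoly_eq_C_mul hv0 hfk, hc]
  have hub := hbound u c hu.isHarm hu.sign hum
  have hc0 : c ≠ 0 := by
    rintro rfl
    obtain ⟨x, hx, hx'⟩ := hne s hs
    refine hx' ((hu.zero_iff x (hsU hx)).2 (abs_nonpos_iff.1 ?_))
    simpa using hub x hx
  obtain ⟨h1, h2⟩ := H u _ hu.isHarm hub f hf hfk
  exact ⟨f, c, hc0, hf, hc, fun N => (h1 N).trans (le_of_eq (by ring)), h2⟩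

theorem abs_polySum_le {q : ℕ → MvPolynomial (Fin n) ℝ} {w : Fin n → ℝ} {S : ℝ}
    (hw : ∀ i, 0 ≤ w i) (hq : ∀ N, ∑ i ∈ Finset.range N, wnorm w (q i) ≤ S) {x : En n}
    (hx : ∀ i, |x i| ≤ w i) : |polySum q x| ≤ S := by
  have hs := summable_of_sum_wnorm_le hw hq
  exact (tsum_of_norm_bounded hs.hasSum fun j => by
    rw [Real.norm_eq_abs]
    exact abs_peval_le_wnorm hx (q j)).trans
    (Real.tsum_le_of_sum_range_le (fun _ => wnorm_nonneg hw _) hq)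

theorem IsHarm.exists_ratio_series {v₀ : En n → ℝ} (hv₀ : IsHarm v₀ U) (h0 : (0 : En n) ∈ U)
    (hne : ∀ r > 0, ∃ x ∈ ball (0 : En n) r, v₀ x ≠ 0) :
    ∃ w : Fin n → ℝ, (∀ i, 0 < w i) ∧ (∀ x : En n, (∀ i, |x i| ≤ w i) → x ∈ U) ∧
      ∃ K > 0, ∀ u v, IsNodalMate v₀ u U → IsNodalMate v₀ v U →
        ∃ (g : ℕ → MvPolynomial (Fin n) ℝ) (q : ℝ), 0 < q ∧
        (∀ N, ∑ i ∈ Finset.range N, wnorm w (g i) ≤ K * q) ∧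
        ∀ x : En n, (∀ i, |x i| ≤ w i) → v₀ x ≠ 0 →
          u x / v x = polySum g x ∧ |u x / v x| ≤ K * q ∧ q ≤ K * |u x / v x| := by
  obtain ⟨w, hw, hwU, C, hC, H⟩ := hv₀.exists_factor_series h0 hne
  have hw0 : ∀ i, 0 ≤ w i := fun i => (hw i).le
  set C' := max C 1 with hC'
  have hC'1 : 1 ≤ C' := le_max_right _ _
  have hCC' : C ≤ C' := le_max_left _ _
  set τ := 1 / (2 * C') with hτ
  have hτ0 : 0 < τ := by positivity
  have hτ1 : τ ≤ 1 := by
    rw [hτ, div_le_one (by positivity)]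
    linarith
  set w' : Fin n → ℝ := fun i => τ * w i with hw'
  have hw'0 : ∀ i, 0 ≤ w' i := fun i => mul_nonneg hτ0.le (hw0 i)
  have hww' : ∀ i, w' i ≤ w i := fun i => mul_le_of_le_one_left (hw0 i) hτ1
  have key : ∀ (f h : ℕ → MvPolynomial (Fin n) ℝ) (c d : ℝ), d ≠ 0 →
      (∀ i, (h i).IsHomogeneous i) → h 0 = MvPolynomial.C d →
      (∀ N, ∑ i ∈ Finset.range N, wnorm w (f i) ≤ C * |c|) →
      (∀ N, ∑ i ∈ Finset.range N, wnorm w (h i) ≤ C * |d|) →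
      ∃ g : ℕ → MvPolynomial (Fin n) ℝ,
        (∀ N, ∑ i ∈ Finset.range N, wnorm w' (g i) ≤ 2 * C' * |c / d|) ∧
        ∀ x : En n, (∀ i, |x i| ≤ w' i) → polySum f x = polySum g x * polySum h x := by
    intro f h c d hd hh hh0 hfs hhs
    obtain ⟨g, hg⟩ := exists_series_div (f := f) hd hh0
    have hd0 : 0 < |d| := abs_pos.2 hd
    have hmono : ∀ (q : ℕ → MvPolynomial (Fin n) ℝ) (a : ℝ),
        (∀ N, ∑ i ∈ Finset.range N, wnorm w (q i) ≤ a) →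
        ∀ N, ∑ i ∈ Finset.range N, wnorm w' (q i) ≤ a := fun q a hq N =>
      (Finset.sum_le_sum fun i _ => wnorm_mono hw'0 hww' _).trans (hq N)
    have hgs : ∀ N, ∑ i ∈ Finset.range N, wnorm w' (g i) ≤ 2 * (C * |c|) / |d| := by
      refine sum_wnorm_quotient_le (m := 0) hw'0 hd0 hg (fun s hs => by omega) ?_ ?_
        (hmono f _ hfs)
      · intro i
        have := le_wnorm_monomial_mul hw'0 0 d (g i)
        rw [hh0, MvPolynomial.C_apply]
        simpa using this
      · intro N
        have h1 : ∀ j ∈ Finset.range N, wnorm w' (h (0 + 1 + j)) ≤ τ * wnorm w (h (j + 1)) := by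
          intro j _
          rw [show 0 + 1 + j = j + 1 by ring, hw', wnorm_smul_of_isHomogeneous (hh _), pow_succ]
          refine mul_le_mul_of_nonneg_right ?_ (wnorm_nonneg hw0 _)
          exact mul_le_of_le_one_left hτ0.le (pow_le_one₀ hτ0.le hτ1)
        refine (Finset.sum_le_sum h1).trans ?_
        rw [← Finset.mul_sum]
        have h2 := hhs (N + 1)
        rw [Finset.sum_range_succ'] at h2
        have h3 : ∑ j ∈ Finset.range N, wnorm w (h (j + 1)) ≤ C' * |d| := by
          have := wnorm_nonneg hw0 (h 0)
          nlinarith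
        refine (mul_le_mul_of_nonneg_left h3 hτ0.le).trans (le_of_eq ?_)
        rw [hτ]
        field_simp
    refine ⟨g, fun N => (hgs N).trans ?_, fun x hx => polySum_eq_mul hg
      (summable_of_sum_wnorm_le hw'0 hgs) (summable_of_sum_wnorm_le hw'0 (hmono h _ hhs)) hx⟩
    rw [abs_div, mul_div_assoc', mul_assoc 2]
    gcongr
  refine ⟨w', fun i => mul_pos hτ0 (hw i), fun x hx => hwU x fun i => (hx i).trans (hww' i),
    2 * C', by positivity, fun u v hu hv => ?_⟩
  obtain ⟨f, c, hc, hf, hf0, hfs, hux⟩ := H u hu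
  obtain ⟨h, d, hd, hh, hh0, hhs, hvx⟩ := H v hv
  obtain ⟨g, hgs, hgx⟩ := key f h c d hd hh hh0 hfs hhs
  obtain ⟨k, hks, hkx⟩ := key h f d c hc hf hf0 hhs hfs
  refine ⟨g, |c / d|, abs_pos.2 (div_ne_zero hc hd), hgs, fun x hx hx0 => ?_⟩
  have hxw : ∀ i, |x i| ≤ w i := fun i => (hx i).trans (hww' i)
  have hu0 : u x ≠ 0 := fun h => hx0 ((hu.zero_iff x (hwU x hxw)).2 h)
  have hv0 : v x ≠ 0 := fun h => hx0 ((hv.zero_iff x (hwU x hxw)).2 h)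
  have e1 : u x = polySum g x * v x := by
    rw [hux x hxw, hvx x hxw, hgx x hx, mul_assoc]
  have e2 : v x = polySum k x * u x := by
    rw [hux x hxw, hvx x hxw, hkx x hx, mul_assoc]
  have e3 : u x / v x = polySum g x := by rw [e1, mul_div_cancel_right₀ _ hv0]
  have e4 : v x / u x = polySum k x := by
    rw [div_eq_iff hu0]
    exact e2
  refine ⟨e3, e3 ▸ abs_polySum_le hw'0 hgs hx, ?_⟩
  have h5 : |v x / u x| ≤ 2 * C' * |d / c| := e4 ▸ abs_polySum_le hw'0 hks hx
  rw [abs_div, abs_div, div_le_iff₀ (abs_pos.2 hu0), mul_div_assoc', div_mul_eq_mul_div,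
    le_div_iff₀ (abs_pos.2 hc)] at h5
  rw [abs_div, abs_div, mul_div_assoc', div_le_div_iff₀ (abs_pos.2 hd) (abs_pos.2 hv0)]
  linarith

end local_quotient

/-! ### Sign constancy of the ratio -/

section sign_constancy

variable {n : ℕ} {U : Set (En n)}

/-- The open coordinate box with half side lengths `w`. -/
def openBox (w : Fin n → ℝ) : Set (En n) := {x | ∀ i, |x i| < w i}

theorem isOpen_openBox (w : Fin n → ℝ) : IsOpen (openBox w) := by
  have : openBox w = ⋂ i, {x : En n | |x i| < w i} := by
    ext x
    simp [openBox]
  rw [this]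
  exact isOpen_iInter_of_finite fun i => isOpen_lt (by fun_prop) continuous_const

theorem zero_mem_openBox {w : Fin n → ℝ} (hw : ∀ i, 0 < w i) : (0 : En n) ∈ openBox w := by
  simpa [openBox] using hw

theorem exists_ball_subset_openBox {w : Fin n → ℝ} (hw : ∀ i, 0 < w i) :
    ∃ r > 0, ball (0 : En n) r ⊆ openBox w :=
  Metric.mem_nhds_iff.1 ((isOpen_openBox w).mem_nhds (zero_mem_openBox hw))

theorem continuousOn_polySum {q : ℕ → MvPolynomial (Fin n) ℝ} {w : Fin n → ℝ}
    (hq : Summable fun j => wnorm w (q j)) : ContinuousOn (polySum q) (openBox w) :=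
  continuousOn_tsum (fun j => (continuous_peval (q j)).continuousOn) hq fun j x hx => by
    rw [Real.norm_eq_abs]
    exact abs_peval_le_wnorm (fun i => (hx i).le) (q j)

theorem polySum_zero {q : ℕ → MvPolynomial (Fin n) ℝ} (hq : ∀ i, (q i).IsHomogeneous i) {c : ℝ}
    (hc : q 0 = MvPolynomial.C c) : polySum q 0 = c := by
  have h : ∀ j, j ≠ 0 → peval (q j) 0 = 0 := fun j hj => by
    have := peval_smul_of_isHomogeneous (hq j) 0 0
    rwa [zero_smul, zero_pow hj, zero_mul] at this
  rw [polySum, tsum_eq_single 0 h, hc, peval_C]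

theorem IsHarm.exists_local_sign {u v : En n → ℝ} (hu : IsHarm u U) (hv : IsHarm v U)
    (h0 : (0 : En n) ∈ U) (hzero : ∀ x ∈ U, v x = 0 ↔ u x = 0)
    (hne : ∀ r > 0, ∃ x ∈ ball (0 : En n) r, v x ≠ 0) :
    (∀ᶠ x in 𝓝 (0 : En n), 0 ≤ u x * v x) ∨ ∀ᶠ x in 𝓝 (0 : En n), u x * v x ≤ 0 := by
  obtain ⟨m, hv0, hvm⟩ := hv.exists_taylorPoly_ne_zero h0 hne
  obtain ⟨s, hs, M, -, hsU, hub⟩ := hu.exists_bound h0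
  obtain ⟨w, hw, hwU, C, -, H⟩ := hv.exists_factor_series_of_bound h0 hv0 hvm hs hsU
  obtain ⟨f, hf, -, hfk⟩ := exists_quotient_seq hu hv h0 (fun x hx => (hzero x hx).1) hv0 hvm
  have hneu : ∀ r > 0, ∃ x ∈ ball (0 : En n) r, u x ≠ 0 := fun r hr => by
    obtain ⟨ε, hε, hεU⟩ := Metric.isOpen_iff.1 hu.isOpen 0 h0
    obtain ⟨x, hx, hx'⟩ := hne (min r ε) (lt_min hr hε)
    exact ⟨x, ball_subset_ball (min_le_left _ _) hx, fun h =>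
      hx' ((hzero x (hεU (ball_subset_ball (min_le_right _ _) hx))).2 h)⟩
  obtain ⟨k, -, hk⟩ := hu.exists_taylorPoly_ne_zero h0 hneu
  obtain ⟨c, hc, hfc⟩ := quotient_seq_zero_ne_zero hu hv h0 hzero hv0 hvm hf hfk ⟨k, hk⟩
  obtain ⟨hsum, hux⟩ := H u M hu hub f hf hfk
  have hcont : ContinuousAt (polySum f) 0 :=
    (continuousOn_polySum (summable_of_sum_wnorm_le (fun i => (hw i).le) hsum)).continuousAt
      ((isOpen_openBox w).mem_nhds (zero_mem_openBox hw))
  have hbox : ∀ᶠ x in 𝓝 (0 : En n), x ∈ openBox w :=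
    (isOpen_openBox w).mem_nhds (zero_mem_openBox hw)
  have heq : ∀ x ∈ openBox w, u x * v x = polySum f x * (v x * v x) := fun x hx => by
    rw [hux x fun i => (hx i).le, mul_assoc]
  rw [ContinuousAt, polySum_zero hf hfc] at hcont
  rcases hc.lt_or_gt with hc | hc
  · right
    filter_upwards [hbox, hcont.eventually (gt_mem_nhds hc)] with x hx hx'
    rw [heq x hx]
    exact mul_nonpos_of_nonpos_of_nonneg hx'.le (mul_self_nonneg _)
  · left
    filter_upwards [hbox, hcont.eventually (lt_mem_nhds hc)] with x hx hx'
    rw [heq x hx]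
    exact mul_nonneg hx'.le (mul_self_nonneg _)

theorem IsHarm.sign_mul {u v : En n → ℝ} (hu : IsHarm u U) (hv : IsHarm v U)
    (hU : IsPreconnected U) (hzero : ∀ x ∈ U, v x = 0 ↔ u x = 0) (hne : ∃ x ∈ U, v x ≠ 0) :
    (∀ x ∈ U, 0 ≤ u x * v x) ∨ ∀ x ∈ U, u x * v x ≤ 0 := by
  have hloc : ∀ p ∈ U, (∀ᶠ x in 𝓝 p, 0 ≤ u x * v x) ∨ ∀ᶠ x in 𝓝 p, u x * v x ≤ 0 := by
    intro p hp
    obtain ⟨ρ, hρ, hρU⟩ := Metric.isOpen_iff.1 hu.isOpen p hp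
    have hmap : Tendsto (fun x : En n => x - p) (𝓝 p) (𝓝 0) := by
      have : Tendsto (fun x : En n => x - p) (𝓝 p) (𝓝 (p - p)) := tendsto_id.sub_const p
      rwa [sub_self] at this
    have key := (hu.translate hρU).exists_local_sign (hv.translate hρU) (mem_ball_self hρ)
      (fun x hx => hzero _ (hρU ((ball_eq_add p ρ).2 hx))) fun r hr => by
        obtain ⟨x, hx, hx'⟩ := hv.exists_ne_zero_of_ball hU hne hr hp
        refine ⟨x - p, ?_, by simpa using hx'⟩
        rwa [← ball_eq_add p r, add_sub_cancel]
    refine key.imp (fun h => ?_) fun h => ?_ <;>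
      exact (hmap.eventually h).mono fun x hx => by simpa using hx
  set P := {p : En n | ∀ᶠ x in 𝓝 p, 0 ≤ u x * v x} with hP
  set N := {p : En n | ∀ᶠ x in 𝓝 p, u x * v x ≤ 0} with hN
  have hPo : IsOpen P := isOpen_setOfPred_eventually_nhds
  have hNo : IsOpen N := isOpen_setOfPred_eventually_nhds
  by_cases h1 : (U ∩ P).Nonempty
  · by_cases h2 : (U ∩ N).Nonempty
    · obtain ⟨p, hpU, hpP, hpN⟩ := hU P N hPo hNo hloc h1 h2
      have hev : ∀ᶠ x in 𝓝 p, x ∈ U ∧ u x * v x = 0 := by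
        filter_upwards [hpP, hpN, hu.isOpen.mem_nhds hpU] with x hx hx' hxU
        exact ⟨hxU, le_antisymm hx' hx⟩
      obtain ⟨r, hr, hball⟩ := Metric.eventually_nhds_iff_ball.1 hev
      obtain ⟨x, hx, hx'⟩ := hv.exists_ne_zero_of_ball hU hne hr hpU
      obtain ⟨hxU, hx0⟩ := hball x hx
      rcases mul_eq_zero.1 hx0 with h | h
      · exact absurd ((hzero x hxU).2 h) hx'
      · exact absurd h hx'
    · left
      intro x hx
      rcases hloc x hx with h | h
      · exact h.self_of_nhds
      · exact absurd ⟨x, hx, h⟩ h2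
  · right
    intro x hx
    rcases hloc x hx with h | h
    · exact absurd ⟨x, hx, h⟩ h1
    · exact h.self_of_nhds

end sign_constancy

/-! ### Differentiating series of polynomials -/

section polynomial_series_derivatives

variable {n : ℕ}

theorem iterate_pderiv_monomial (i : Fin n) (k : ℕ) (β : Fin n →₀ ℕ) (c : ℝ) :
    (MvPolynomial.pderiv i)^[k] (MvPolynomial.monomial β c)
      = MvPolynomial.monomial (β - Finsupp.single i k) (c * (β i).descFactorial k) := by
  induction k with
  | zero => simp
  | succ k ih =>
    rw [Function.iterate_succ_apply', ih, MvPolynomial.pderiv_monomial, tsub_tsub,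
      ← Finsupp.single_add]
    congr 1
    rw [Nat.descFactorial_succ]
    push_cast
    simp only [Pi.sub_apply, Finsupp.single_eq_same]
    ring

theorem descFactorial_mul_half_pow_le (b k : ℕ) {a : ℝ} (ha : 0 < a) :
    (b.descFactorial k : ℝ) * (a / 2) ^ (b - k) ≤ k.factorial * (2 / a) ^ k * a ^ b := by
  rcases lt_or_ge b k with h | h
  · rw [Nat.descFactorial_of_lt h]
    simp only [Nat.cast_zero, zero_mul]
    positivity
  · rw [Nat.descFactorial_eq_factorial_mul_choose]
    obtain ⟨l, rfl⟩ := Nat.exists_eq_add_of_le h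
    rw [Nat.add_sub_cancel_left]
    push_cast
    have h1 : ((k + l).choose k : ℝ) ≤ 2 ^ (k + l) := by
      exact_mod_cast Nat.choose_le_two_pow (k + l) k
    have h2 : (2 / a) ^ k * a ^ (k + l) = 2 ^ (k + l) * (a / 2) ^ l := by
      rw [pow_add, pow_add, div_pow, div_pow]
      field_simp
    rw [mul_assoc, mul_assoc, h2]
    gcongr

theorem wnorm_map_le_of_monomial {w w' : Fin n → ℝ} (hw' : ∀ i, 0 ≤ w' i) {κ : ℝ}
    (D : MvPolynomial (Fin n) ℝ →ₗ[ℝ] MvPolynomial (Fin n) ℝ)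
    (hD : ∀ β c, wnorm w' (D (MvPolynomial.monomial β c))
      ≤ κ * (|c| * ∏ i, w i ^ β i)) (q : MvPolynomial (Fin n) ℝ) :
    wnorm w' (D q) ≤ κ * wnorm w q := by
  conv_lhs => rw [q.as_sum, map_sum]
  refine (wnorm_sum_le hw' _ _).trans ?_
  rw [wnorm, Finset.mul_sum]
  exact Finset.sum_le_sum fun β _ => hD β _

theorem wnorm_iterate_pderiv_le {w w' : Fin n → ℝ} (hw : ∀ i, 0 < w i) {i : Fin n}
    (hi : w' i = w i / 2) (hj : ∀ j, j ≠ i → w' j = w j) (k : ℕ)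
    (q : MvPolynomial (Fin n) ℝ) :
    wnorm w' ((MvPolynomial.pderiv i)^[k] q) ≤ k.factorial * (2 / w i) ^ k * wnorm w q := by
  have hw' : ∀ j, 0 ≤ w' j := fun j => by
    by_cases h : j = i
    · subst h
      rw [hi]
      exact (half_pos (hw j)).le
    · rw [hj j h]
      exact (hw j).le
  have hiter : ∀ q, (MvPolynomial.pderiv i)^[k] q
      = ((MvPolynomial.pderiv (R := ℝ) i).toLinearMap ^ k) q := fun q => by
    rw [Module.End.pow_apply]
    rfl
  rw [hiter]
  refine wnorm_map_le_of_monomial hw' _ (fun β c => ?_) q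
  rw [← hiter, iterate_pderiv_monomial, wnorm_monomial, abs_mul, Nat.abs_cast,
    ← Finset.mul_prod_erase _ _ (Finset.mem_univ i), ← Finset.mul_prod_erase _ _
    (Finset.mem_univ i)]
  have h1 : ∏ j ∈ Finset.univ.erase i, w' j ^ (β - Finsupp.single i k) j
      = ∏ j ∈ Finset.univ.erase i, w j ^ β j := by
    refine Finset.prod_congr rfl fun j hj' => ?_
    have hne := Finset.ne_of_mem_erase hj'
    rw [hj j hne, Finsupp.tsub_apply, Finsupp.single_eq_of_ne hne, tsub_zero]
  rw [h1, Finsupp.tsub_apply, Finsupp.single_eq_same, hi]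
  have h2 := descFactorial_mul_half_pow_le (β i) k (hw i)
  have h3 : 0 ≤ ∏ j ∈ Finset.univ.erase i, w j ^ β j :=
    Finset.prod_nonneg fun j _ => pow_nonneg (hw j).le _
  have := mul_le_mul_of_nonneg_left h2 (mul_nonneg (abs_nonneg c) h3)
  linarith

/-- The formal partial derivative of a polynomial along a multi-index, restricted to the
coordinates in a list. -/
def pderivAlong (α : Fin n → ℕ) (l : List (Fin n)) (q : MvPolynomial (Fin n) ℝ) :
    MvPolynomial (Fin n) ℝ :=
  l.foldr (fun i g => (MvPolynomial.pderiv i)^[α i] g) q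

theorem wnorm_pderivAlong_le {w : Fin n → ℝ} (hw : ∀ i, 0 < w i) (α : Fin n → ℕ)
    (q : MvPolynomial (Fin n) ℝ) {l : List (Fin n)} (hl : l.Nodup) :
    wnorm (fun i => if i ∈ l then w i / 2 else w i) (pderivAlong α l q)
      ≤ (l.map fun i => ((α i).factorial : ℝ) * (2 / w i) ^ α i).prod * wnorm w q := by
  induction l with
  | nil => simp [pderivAlong]
  | cons i t ih =>
    obtain ⟨hit, ht⟩ := List.nodup_cons.1 hl
    have hpos : ∀ j, 0 < if j ∈ t then w j / 2 else w j := fun j => by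
      split_ifs
      · exact half_pos (hw j)
      · exact hw j
    have h1 := wnorm_iterate_pderiv_le (w' := fun j => if j ∈ i :: t then w j / 2 else w j) hpos
      (i := i) (by simp [hit]) (fun j hj => by simp [hj]) (α i) (pderivAlong α t q)
    rw [if_neg hit] at h1
    refine h1.trans ?_
    rw [List.map_cons, List.prod_cons, mul_assoc _ _ (wnorm w q)]
    have := hw i
    exact mul_le_mul_of_nonneg_left (ih ht) (by positivity)

theorem wnorm_pderivAlong_finRange_le {w : Fin n → ℝ} (hw : ∀ i, 0 < w i) {R : ℝ}
    (hR : ∀ i, 2 / w i ≤ R) (α : Fin n → ℕ) (q : MvPolynomial (Fin n) ℝ) :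
    wnorm (fun i => w i / 2) (pderivAlong α (List.finRange n) q)
      ≤ (∏ i, (α i).factorial : ℕ) * R ^ (∑ i, α i) * wnorm w q := by
  have h := wnorm_pderivAlong_le hw α q (List.nodup_finRange n)
  simp only [List.mem_finRange, if_true] at h
  refine h.trans (mul_le_mul_of_nonneg_right ?_ (wnorm_nonneg (fun i => (hw i).le) q))
  rw [← Fin.prod_univ_def, Finset.prod_mul_distrib, ← Finset.prod_pow_eq_pow_sum]
  push_cast
  refine mul_le_mul_of_nonneg_left (Finset.prod_le_prod (fun i _ => ?_) fun i _ => ?_)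
    (by positivity)
  · exact pow_nonneg (div_nonneg two_pos.le (hw i).le) _
  · exact pow_le_pow_left₀ (div_nonneg two_pos.le (hw i).le) (hR i) _

theorem mul_pow_pred_mul_le {a d : ℝ} (ha : 0 ≤ a) (hd : 0 ≤ d) (b : ℕ) :
    b * a ^ (b - 1) * d ≤ (a + d) ^ b := by
  rcases b with _ | b
  · simp
  · rw [Nat.add_sub_cancel]
    induction b with
    | zero => simpa using ha
    | succ b ih =>
      rw [pow_succ (a + d)]
      have h1 : a ^ (b + 1) ≤ (a + d) ^ (b + 1) := by gcongr; linarith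
      have h2 := mul_le_mul_of_nonneg_right ih ha
      have h3 := mul_le_mul_of_nonneg_right h1 hd
      push_cast at *
      rw [pow_succ a b] at *
      nlinarith

theorem wnorm_pderiv_le {w w' : Fin n → ℝ} (hw : ∀ i, 0 ≤ w i) (hww' : ∀ i, w i < w' i)
    (i : Fin n) (q : MvPolynomial (Fin n) ℝ) :
    wnorm w (MvPolynomial.pderiv i q) ≤ (w' i - w i)⁻¹ * wnorm w' q := by
  have hd : 0 < w' i - w i := sub_pos.2 (hww' i)
  refine wnorm_map_le_of_monomial hw (MvPolynomial.pderiv (R := ℝ) i).toLinearMap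
    (fun β c => ?_) q
  change wnorm w (MvPolynomial.pderiv i (MvPolynomial.monomial β c)) ≤ _
  rw [MvPolynomial.pderiv_monomial, wnorm_monomial, abs_mul, Nat.abs_cast,
    ← Finset.mul_prod_erase _ _ (Finset.mem_univ i), ← Finset.mul_prod_erase _ _
    (Finset.mem_univ i)]
  have h1 : ∏ j ∈ Finset.univ.erase i, w j ^ (β - Finsupp.single i 1 : Fin n →₀ ℕ) j
      ≤ ∏ j ∈ Finset.univ.erase i, w' j ^ β j := by
    refine Finset.prod_le_prod (fun j _ => pow_nonneg (hw j) _) fun j hj' => ?_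
    rw [Finsupp.tsub_apply, Finsupp.single_eq_of_ne (Finset.ne_of_mem_erase hj'), tsub_zero]
    exact pow_le_pow_left₀ (hw j) (hww' j).le _
  have h0 : 0 ≤ ∏ j ∈ Finset.univ.erase i, w j ^ (β - Finsupp.single i 1 : Fin n →₀ ℕ) j :=
    Finset.prod_nonneg fun j _ => pow_nonneg (hw j) _
  rw [Finsupp.tsub_apply, Finsupp.single_eq_same]
  have h2 := mul_pow_pred_mul_le (hw i) hd.le (β i)
  rw [add_sub_cancel, ← le_div_iff₀ hd] at h2
  calc |c| * β i * (w i ^ (β i - 1)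
        * ∏ j ∈ Finset.univ.erase i, w j ^ (β - Finsupp.single i 1 : Fin n →₀ ℕ) j)
      = |c| * ((β i * w i ^ (β i - 1))
        * ∏ j ∈ Finset.univ.erase i, w j ^ (β - Finsupp.single i 1 : Fin n →₀ ℕ) j) := by ring
    _ ≤ |c| * ((w' i ^ β i / (w' i - w i)) * ∏ j ∈ Finset.univ.erase i, w' j ^ β j) := by
        have : 0 ≤ w' i := (hw i).trans (hww' i).le
        gcongr
    _ = _ := by ring

/-- On `V`, the function `f` is the sum of the series of polynomials `q`, which converges
absolutely in every box smaller than `w`. -/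
structure IsPolySumOn (V : Set (En n)) (w : Fin n → ℝ) (f : En n → ℝ)
    (q : ℕ → MvPolynomial (Fin n) ℝ) : Prop where
  summable : ∀ w' : Fin n → ℝ, (∀ i, 0 ≤ w' i) → (∀ i, w' i < w i) →
    Summable fun j => wnorm w' (q j)
  eqOn : EqOn f (polySum q) V

theorem summable_wnorm_pderiv {w : Fin n → ℝ} {q : ℕ → MvPolynomial (Fin n) ℝ}
    (hq : ∀ w' : Fin n → ℝ, (∀ i, 0 ≤ w' i) → (∀ i, w' i < w i) →
      Summable fun j => wnorm w' (q j)) (i : Fin n) (w' : Fin n → ℝ) (h0 : ∀ i, 0 ≤ w' i)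
    (hw : ∀ i, w' i < w i) : Summable fun j => wnorm w' (MvPolynomial.pderiv i (q j)) := by
  have h1 : ∀ i, w' i < (w' i + w i) / 2 := fun i => by linarith [hw i]
  refine Summable.of_nonneg_of_le (fun j => wnorm_nonneg h0 _)
    (fun j => wnorm_pderiv_le h0 h1 i (q j))
    ((hq _ (fun i => ?_) fun i => ?_).mul_left _)
  · linarith [h0 i, hw i]
  · linarith [hw i]

theorem convex_openBox (w : Fin n → ℝ) : Convex ℝ (openBox w) := by
  intro x hx y hy a b ha hb hab i
  have h1 : |a * x i + b * y i| ≤ a * |x i| + b * |y i| := by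
    refine (abs_add_le _ _).trans ?_
    rw [abs_mul, abs_mul, abs_of_nonneg ha, abs_of_nonneg hb]
  have h2 : a * |x i| + b * |y i| < w i := by
    rcases ha.eq_or_lt with rfl | ha
    · rw [zero_add] at hab
      subst hab
      simpa using hy i
    · have := mul_lt_mul_of_pos_left (hx i) ha
      have := mul_le_mul_of_nonneg_left (hy i).le hb
      have h : a * w i + b * w i = w i := by rw [← add_mul, hab, one_mul]
      linarith
  simpa using h1.trans_lt h2

theorem partialDeriv1_polySum {w : Fin n → ℝ} {q : ℕ → MvPolynomial (Fin n) ℝ}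
    (hq : ∀ w' : Fin n → ℝ, (∀ i, 0 ≤ w' i) → (∀ i, w' i < w i) →
      Summable fun j => wnorm w' (q j)) (i : Fin n) :
    EqOn (partialDeriv1 i (polySum q)) (polySum fun j => MvPolynomial.pderiv i (q j))
      (openBox w) := by
  intro x hx
  set w' : Fin n → ℝ := fun i => (|x i| + w i) / 2 with hw'
  have hxw' : x ∈ openBox w' := fun i => by
    have := hx i
    simp only [hw']
    linarith
  have hw'w : ∀ i, w' i < w i := fun i => by
    have := hx i
    simp only [hw']
    linarith
  have hw'0 : ∀ i, 0 ≤ w' i := fun i => (abs_nonneg _).trans (hxw' i).le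
  have hsd : ∀ i, Summable fun j => wnorm w' (MvPolynomial.pderiv i (q j)) := fun i =>
    summable_wnorm_pderiv hq i w' hw'0 hw'w
  have hbound : ∀ j, ∀ y ∈ openBox w', ‖fderiv ℝ (peval (q j)) y‖
      ≤ ∑ i, wnorm w' (MvPolynomial.pderiv i (q j)) := by
    intro j y hy
    refine ContinuousLinearMap.opNorm_le_bound _
      (Finset.sum_nonneg fun i _ => wnorm_nonneg hw'0 _) fun z => ?_
    rw [fderiv_apply_eq_sum_partialDeriv1, Real.norm_eq_abs, Finset.sum_mul]
    refine (Finset.abs_sum_le_sum_abs _ _).trans (Finset.sum_le_sum fun i _ => ?_)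
    rw [abs_mul, mul_comm, partialDeriv1_peval]
    exact mul_le_mul (abs_peval_le_wnorm (fun i => (hy i).le) _) (abs_apply_le_norm z i)
      (abs_nonneg _) (wnorm_nonneg hw'0 _)
  have hsum : Summable fun j => ∑ i, wnorm w' (MvPolynomial.pderiv i (q j)) :=
    summable_sum fun i _ => hsd i
  have hfd := hasFDerivAt_tsum_of_isPreconnected hsum (isOpen_openBox w')
    (convex_openBox w').isPreconnected
    (fun j y _ => (differentiable_peval (q j) y).hasFDerivAt) hbound hxw'
    (summable_norm_peval (hq w' hw'0 hw'w) fun i => (hxw' i).le).of_norm hxw'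
  have hs : Summable fun j => fderiv ℝ (peval (q j)) x :=
    Summable.of_norm_bounded hsum fun j => hbound j x hxw'
  have h1 : partialDeriv1 i (polySum q) x
      = (∑' j, fderiv ℝ (peval (q j)) x) (EuclideanSpace.single i 1) := by
    rw [partialDeriv1, ← hfd.fderiv]
    rfl
  rw [h1]
  simp only [polySum, ← partialDeriv1_peval]
  exact ((ContinuousLinearMap.apply ℝ ℝ (EuclideanSpace.single i (1 : ℝ))).hasSum
    hs.hasSum).tsum_eq.symm

theorem IsPolySumOn.pderiv {V : Set (En n)} {w : Fin n → ℝ} {f : En n → ℝ}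
    {q : ℕ → MvPolynomial (Fin n) ℝ} (h : IsPolySumOn V w f q) (hV : IsOpen V)
    (hVw : V ⊆ openBox w) (i : Fin n) :
    IsPolySumOn V w (partialDeriv1 i f) fun j => MvPolynomial.pderiv i (q j) :=
  ⟨summable_wnorm_pderiv h.summable i, fun _ hx =>
    (partialDeriv1_congr hV h.eqOn i hx).trans (partialDeriv1_polySum h.summable i (hVw hx))⟩

theorem IsPolySumOn.multiPartialDeriv {V : Set (En n)} {w : Fin n → ℝ} {f : En n → ℝ}
    {q : ℕ → MvPolynomial (Fin n) ℝ} (h : IsPolySumOn V w f q) (hV : IsOpen V)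
    (hVw : V ⊆ openBox w) (α : Fin n → ℕ) :
    IsPolySumOn V w (multiPartialDeriv α f) fun j => pderivAlong α (List.finRange n) (q j) := by
  have hiter : ∀ (i : Fin n) (k : ℕ) {f : En n → ℝ} {q : ℕ → MvPolynomial (Fin n) ℝ},
      IsPolySumOn V w f q → IsPolySumOn V w ((partialDeriv1 i)^[k] f)
        fun j => (MvPolynomial.pderiv i)^[k] (q j) := by
    intro i k f q h
    induction k with
    | zero => exact h
    | succ k ih =>
      simp only [Function.iterate_succ_apply']
      exact ih.pderiv hV hVw i
  have hlist : ∀ l : List (Fin n), IsPolySumOn V w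
      (l.foldr (fun i g => (partialDeriv1 i)^[α i] g) f) fun j => pderivAlong α l (q j) := by
    intro l
    induction l with
    | nil => exact h
    | cons i t ih => exact hiter i (α i) ih
  exact hlist _

theorem multiPartialDeriv_comp_add (f : En n → ℝ) (a : En n) (α : Fin n → ℕ) :
    multiPartialDeriv α (fun x => f (a + x)) = fun x => multiPartialDeriv α f (a + x) := by
  have hiter : ∀ (i : Fin n) (k : ℕ) (f : En n → ℝ),
      (partialDeriv1 i)^[k] (fun x => f (a + x)) = fun x => (partialDeriv1 i)^[k] f (a + x) := by
    intro i k f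
    induction k with
    | zero => rfl
    | succ k ih => rw [Function.iterate_succ_apply', ih, partialDeriv1_comp_add,
        Function.iterate_succ_apply']
  unfold multiPartialDeriv
  induction List.finRange n with
  | nil => rfl
  | cons i t ih => rw [List.foldr_cons, ih, hiter, List.foldr_cons]

theorem multiPartialDeriv_zero (f : En n → ℝ) : multiPartialDeriv (fun _ => 0) f = f := by
  unfold multiPartialDeriv
  induction List.finRange n with
  | nil => rfl
  | cons i t ih => rw [List.foldr_cons, ih, Function.iterate_zero, id]

end polynomial_series_derivatives

/-! ### Local and global estimates for the ratio -/

section ratio_estimates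

variable {n : ℕ} {U : Set (En n)}

theorem IsNodalMate.translate {v u : En n → ℝ} (h : IsNodalMate v u U) {p : En n} {ρ : ℝ}
    (hρ : ball p ρ ⊆ U) :
    IsNodalMate (fun y => v (p + y)) (fun y => u (p + y)) (ball 0 ρ) where
  isHarm := h.isHarm.translate hρ
  zero_iff _ hx := h.zero_iff _ (hρ ((ball_eq_add p ρ).2 hx))
  sign := h.sign.imp (fun H _ hx => H _ (hρ ((ball_eq_add p ρ).2 hx)))
    fun H _ hx => H _ (hρ ((ball_eq_add p ρ).2 hx))

theorem IsHarm.exists_ratio_bound_zero {v₀ : En n → ℝ} (hv₀ : IsHarm v₀ U) (h0 : (0 : En n) ∈ U)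
    (hne : ∀ r > 0, ∃ x ∈ ball (0 : En n) r, v₀ x ≠ 0) :
    ∃ ε > 0, ∃ A > 0, ∃ R > 0, ∀ u v, IsNodalMate v₀ u U → IsNodalMate v₀ v U →
      ∀ α : Fin n → ℕ, ∀ x ∈ ball (0 : En n) ε, v₀ x ≠ 0 → ∀ y ∈ ball (0 : En n) ε, v₀ y ≠ 0 →
        |multiPartialDeriv α (fun z => u z / v z) x| ≤
          (∏ i, Nat.factorial (α i) : ℕ) * A * R ^ (∑ i, α i) * |u y / v y| := by
  obtain ⟨w, hw, hwU, K, hK, H⟩ := hv₀.exists_ratio_series h0 hne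
  have hw0 : ∀ i, 0 ≤ w i := fun i => (hw i).le
  have hwh : ∀ i, 0 < w i / 2 := fun i => half_pos (hw i)
  obtain ⟨ε, hε, hεw⟩ := exists_ball_subset_openBox hwh
  have hR0 : ∀ i, 0 ≤ 2 / w i := fun i => div_nonneg two_pos.le (hw0 i)
  have hR : ∀ i, 2 / w i ≤ ∑ i, 2 / w i + 1 := fun i =>
    (Finset.single_le_sum (f := fun i => 2 / w i) (fun i _ => hR0 i) (Finset.mem_univ i)).trans
      (by linarith)
  have hRpos : 0 < ∑ i, 2 / w i + 1 := by
    have := Finset.sum_nonneg fun i (_ : i ∈ Finset.univ) => hR0 i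
    linarith
  refine ⟨ε, hε, K * K, by positivity, _, hRpos, fun u v hu hv α x hx hx0 y hy hy0 => ?_⟩
  obtain ⟨g, q, hq, hgs, hg⟩ := H u v hu hv
  have hin : ∀ z ∈ ball (0 : En n) ε, ∀ i, |z i| ≤ w i / 2 := fun z hz i => (hεw hz i).le
  have hin' : ∀ z ∈ ball (0 : En n) ε, ∀ i, |z i| < w i := fun z hz i =>
    (hin z hz i).trans_lt (half_lt_self (hw i))
  set V := openBox w ∩ {z | v₀ z ≠ 0} with hVdef
  have hbU : openBox w ⊆ U := fun z hz => hwU z fun i => (hz i).le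
  have hV : IsOpen V := (hv₀.continuousOn.mono hbU).isOpen_inter_preimage (isOpen_openBox w)
    (t := {0}ᶜ) isOpen_compl_singleton
  have hsw := summable_of_sum_wnorm_le hw0 hgs
  have hser : IsPolySumOn V w (fun z => u z / v z) g :=
    ⟨fun w' h0' hlt => Summable.of_nonneg_of_le (fun j => wnorm_nonneg h0' _)
      (fun j => wnorm_mono h0' (fun i => (hlt i).le) _) hsw,
      fun z hz => (hg z (fun i => (hz.1 i).le) hz.2).1⟩
  rw [(hser.multiPartialDeriv hV inter_subset_left α).eqOn ⟨hin' x hx, hx0⟩]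
  set R := ∑ i, 2 / w i + 1
  have hDs : ∀ N, ∑ j ∈ Finset.range N,
      wnorm (fun i => w i / 2) (pderivAlong α (List.finRange n) (g j))
      ≤ (∏ i, (α i).factorial : ℕ) * R ^ (∑ i, α i) * (K * q) := by
    intro N
    refine (Finset.sum_le_sum fun j _ => wnorm_pderivAlong_finRange_le hw hR α (g j)).trans ?_
    rw [← Finset.mul_sum]
    exact mul_le_mul_of_nonneg_left (hgs N) (by positivity)
  refine (abs_polySum_le (fun i => (hwh i).le) hDs (hin x hx)).trans ?_
  have h3 := (hg y (fun i => (hin' y hy i).le) hy0).2.2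
  calc ((∏ i, (α i).factorial : ℕ) : ℝ) * R ^ (∑ i, α i) * (K * q)
      ≤ (∏ i, (α i).factorial : ℕ) * R ^ (∑ i, α i) * (K * (K * |u y / v y|)) := by gcongr
    _ = _ := by ring

theorem IsHarm.exists_local_ratio_bound {v₀ : En n → ℝ} (hv₀ : IsHarm v₀ U)
    (hU : IsPreconnected U) (hne : ∃ x ∈ U, v₀ x ≠ 0) {p : En n} (hp : p ∈ U) :
    ∃ ε > 0, ∃ A > 0, ∃ R > 0, ∀ u v, IsNodalMate v₀ u U → IsNodalMate v₀ v U →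
      ∀ α : Fin n → ℕ, ∀ x ∈ ball p ε, v₀ x ≠ 0 → ∀ y ∈ ball p ε, v₀ y ≠ 0 →
        |multiPartialDeriv α (fun z => u z / v z) x| ≤
          (∏ i, Nat.factorial (α i) : ℕ) * A * R ^ (∑ i, α i) * |u y / v y| := by
  obtain ⟨ρ, hρ, hρU⟩ := Metric.isOpen_iff.1 hv₀.isOpen p hp
  obtain ⟨ε, hε, A, hA, R, hR, H⟩ := (hv₀.translate hρU).exists_ratio_bound_zero
    (mem_ball_self hρ) fun r hr => by
      obtain ⟨x, hx, hx'⟩ := hv₀.exists_ne_zero_of_ball hU hne hr hp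
      refine ⟨x - p, ?_, by simpa using hx'⟩
      rwa [← ball_eq_add p r, add_sub_cancel]
  refine ⟨ε, hε, A, hA, R, hR, fun u v hu hv α x hx hx0 y hy hy0 => ?_⟩
  have hsub : ∀ {z : En n}, z ∈ ball p ε → z - p ∈ ball (0 : En n) ε := fun hz => by
    rwa [← ball_eq_add p ε, add_sub_cancel]
  have := H _ _ (hu.translate hρU) (hv.translate hρU) α (x - p) (hsub hx)
    (by rwa [add_sub_cancel]) (y - p) (hsub hy) (by rwa [add_sub_cancel])
  rw [multiPartialDeriv_comp_add (fun z => u z / v z)] at this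
  simpa only [add_sub_cancel] using this

/-- A Harnack type comparison of the ratios near two points of the domain. -/
theorem IsHarm.exists_ratio_comparison {v₀ : En n → ℝ} (hv₀ : IsHarm v₀ U)
    (hU : IsPreconnected U) (hne : ∃ x ∈ U, v₀ x ≠ 0) {p p' : En n} (hp : p ∈ U) (hp' : p' ∈ U) :
    ∃ ε > 0, ∃ C > 0, ∀ u v, IsNodalMate v₀ u U → IsNodalMate v₀ v U →
      ∀ x ∈ ball p ε, v₀ x ≠ 0 → ∀ y ∈ ball p' ε, v₀ y ≠ 0 → |u x / v x| ≤ C * |u y / v y| := by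
  refine hU.induction₂' (fun p p' : En n => ∃ ε > 0, ∃ C > 0, ∀ u v, IsNodalMate v₀ u U →
    IsNodalMate v₀ v U → ∀ x ∈ ball p ε, v₀ x ≠ 0 → ∀ y ∈ ball p' ε, v₀ y ≠ 0 →
      |u x / v x| ≤ C * |u y / v y|) (fun a ha => ?_) (fun a b c ha hb hc hab hbc => ?_) hp hp'
  · obtain ⟨ε, hε, A, hA, R, -, H⟩ := hv₀.exists_local_ratio_bound hU hne ha
    have key : ∀ u v, IsNodalMate v₀ u U → IsNodalMate v₀ v U →
        ∀ x ∈ ball a ε, v₀ x ≠ 0 → ∀ y ∈ ball a ε, v₀ y ≠ 0 →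
          |u x / v x| ≤ A * |u y / v y| := by
      intro u v hu hv x hx hx0 y hy hy0
      simpa [multiPartialDeriv_zero] using H u v hu hv (fun _ => 0) x hx hx0 y hy hy0
    refine mem_nhdsWithin_of_mem_nhds ?_
    filter_upwards [ball_mem_nhds a (half_pos hε)] with b hb
    have h1 : ball a (ε / 2) ⊆ ball a ε := ball_subset_ball (half_le_self hε.le)
    have h2 : ball b (ε / 2) ⊆ ball a ε := ball_subset_ball' (by
      have := mem_ball.1 hb
      linarith)
    exact ⟨⟨ε / 2, half_pos hε, A, hA, fun u v hu hv x hx hx0 y hy hy0 =>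
      key u v hu hv x (h1 hx) hx0 y (h2 hy) hy0⟩, ⟨ε / 2, half_pos hε, A, hA,
      fun u v hu hv x hx hx0 y hy hy0 => key u v hu hv x (h2 hx) hx0 y (h1 hy) hy0⟩⟩
  · obtain ⟨ε, hε, C, hC, H⟩ := hab
    obtain ⟨ε', hε', C', hC', H'⟩ := hbc
    have hm := lt_min hε hε'
    obtain ⟨z, hz, hz0⟩ := hv₀.exists_ne_zero_of_ball hU hne hm hb
    refine ⟨min ε ε', hm, C * C', by positivity, fun u v hu hv x hx hx0 y hy hy0 => ?_⟩
    have h1 := H u v hu hv x (ball_subset_ball (min_le_left _ _) hx) hx0 z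
      (ball_subset_ball (min_le_left _ _) hz) hz0
    have h2 := H' u v hu hv z (ball_subset_ball (min_le_right _ _) hz) hz0 y
      (ball_subset_ball (min_le_right _ _) hy) hy0
    calc _ ≤ _ := h1
      _ ≤ C * (C' * |u y / v y|) := mul_le_mul_of_nonneg_left h2 hC.le
      _ = _ := by ring

theorem IsHarm.exists_uniform_ratio_bound {v₀ : En n → ℝ} (hv₀ : IsHarm v₀ U)
    (hU : IsPreconnected U) (hne : ∃ x ∈ U, v₀ x ≠ 0) {S : Set (En n)} (hS : IsCompact S)
    (hSU : S ⊆ U) :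
    ∃ A > 0, ∃ R > 0, ∀ u v, IsNodalMate v₀ u U → IsNodalMate v₀ v U →
      ∀ α : Fin n → ℕ, ∀ x ∈ S, v₀ x ≠ 0 → ∀ y ∈ S, v₀ y ≠ 0 →
        |multiPartialDeriv α (fun z => u z / v z) x| ≤
          (∏ i, Nat.factorial (α i) : ℕ) * A * R ^ (∑ i, α i) * |u y / v y| := by
  obtain ⟨o, ho, ho0⟩ := hne
  have hne : ∃ x ∈ U, v₀ x ≠ 0 := ⟨o, ho, ho0⟩
  obtain ⟨A, hA, R, hR, H⟩ : ∃ A > 0, ∃ R > 0, ∀ u v, IsNodalMate v₀ u U → IsNodalMate v₀ v U →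
      ∀ x ∈ S, v₀ x ≠ 0 → (∀ α : Fin n → ℕ, |multiPartialDeriv α (fun z => u z / v z) x| ≤
          (∏ i, Nat.factorial (α i) : ℕ) * A * R ^ (∑ i, α i) * |u o / v o|) ∧
        |u o / v o| ≤ A * |u x / v x| := by
    refine hS.induction_on (p := fun S => ∃ A > 0, ∃ R > 0, ∀ u v, IsNodalMate v₀ u U →
      IsNodalMate v₀ v U → ∀ x ∈ S, v₀ x ≠ 0 →
        (∀ α : Fin n → ℕ, |multiPartialDeriv α (fun z => u z / v z) x| ≤
          (∏ i, Nat.factorial (α i) : ℕ) * A * R ^ (∑ i, α i) * |u o / v o|) ∧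
        |u o / v o| ≤ A * |u x / v x|) ?_ ?_ ?_ ?_
    · exact ⟨1, one_pos, 1, one_pos, fun u v _ _ x hx => absurd hx (notMem_empty x)⟩
    · rintro s t hst ⟨A, hA, R, hR, H⟩
      exact ⟨A, hA, R, hR, fun u v hu hv x hx => H u v hu hv x (hst hx)⟩
    · rintro s t ⟨A, hA, R, hR, H⟩ ⟨A', hA', R', hR', H'⟩
      refine ⟨max A A', lt_max_of_lt_left hA, max R R', lt_max_of_lt_left hR, ?_⟩
      rintro u v hu hv x (hx | hx) hx0
      · obtain ⟨h1, h2⟩ := H u v hu hv x hx hx0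
        refine ⟨fun α => (h1 α).trans ?_, h2.trans ?_⟩ <;> gcongr <;> exact le_max_left _ _
      · obtain ⟨h1, h2⟩ := H' u v hu hv x hx hx0
        refine ⟨fun α => (h1 α).trans ?_, h2.trans ?_⟩ <;> gcongr <;> exact le_max_right _ _
    · intro p hp
      have hpU := hSU hp
      obtain ⟨ε, hε, A, hA, R, hR, H⟩ := hv₀.exists_local_ratio_bound hU hne hpU
      obtain ⟨ε₁, hε₁, C₁, hC₁, H₁⟩ := hv₀.exists_ratio_comparison hU hne hpU ho
      obtain ⟨ε₂, hε₂, C₂, hC₂, H₂⟩ := hv₀.exists_ratio_comparison hU hne ho hpU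
      have hm : 0 < min ε (min ε₁ ε₂) := lt_min hε (lt_min hε₁ hε₂)
      have hs : ball p (min ε (min ε₁ ε₂)) ⊆ ball p ε := ball_subset_ball (min_le_left _ _)
      have hs₁ : ball p (min ε (min ε₁ ε₂)) ⊆ ball p ε₁ :=
        ball_subset_ball ((min_le_right _ _).trans (min_le_left _ _))
      have hs₂ : ball p (min ε (min ε₁ ε₂)) ⊆ ball p ε₂ :=
        ball_subset_ball ((min_le_right _ _).trans (min_le_right _ _))
      obtain ⟨z, hz, hz0⟩ := hv₀.exists_ne_zero_of_ball hU hne hm hpU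
      refine ⟨_, mem_nhdsWithin_of_mem_nhds (ball_mem_nhds p hm), max (A * C₁) C₂,
        lt_max_of_lt_right hC₂, R, hR, fun u v hu hv x hx hx0 => ⟨fun α => ?_, ?_⟩⟩
      · have h1 := H u v hu hv α x (hs hx) hx0 z (hs hz) hz0
        have h2 := H₁ u v hu hv z (hs₁ hz) hz0 o (mem_ball_self hε₁) ho0
        calc _ ≤ _ := h1
          _ ≤ (∏ i, Nat.factorial (α i) : ℕ) * A * R ^ (∑ i, α i) * (C₁ * |u o / v o|) := by
              gcongr
          _ = (∏ i, Nat.factorial (α i) : ℕ) * (A * C₁) * R ^ (∑ i, α i) * |u o / v o| := by ring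
          _ ≤ _ := by
              gcongr
              exact le_max_left _ _
      · refine (H₂ u v hu hv o (mem_ball_self hε₂) ho0 x (hs₂ hx) hx0).trans ?_
        gcongr
        exact le_max_right _ _
  refine ⟨A * A, by positivity, R, hR, fun u v hu hv α x hx hx0 y hy hy0 => ?_⟩
  have h1 := (H u v hu hv x hx hx0).1 α
  have h2 := (H u v hu hv y hy hy0).2
  calc _ ≤ _ := h1
    _ ≤ (∏ i, Nat.factorial (α i) : ℕ) * A * R ^ (∑ i, α i) * (A * |u y / v y|) := by gcongr
    _ = _ := by ring

end ratio_estimates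

theorem isNodalMate_of_zeroSet_eq {n : ℕ} {U : Set (En n)} {v u : En n → ℝ} (hv : IsHarm v U)
    (hu : IsHarm u U) (hU : IsPreconnected U) (hne : ∃ x ∈ U, v x ≠ 0)
    (h : zeroSet u U = zeroSet v U) : IsNodalMate v u U := by
  have hz : ∀ x ∈ U, v x = 0 ↔ u x = 0 := fun x hx => by
    have := Set.ext_iff.1 h x
    simpa [zeroSet, hx] using this.symm
  exact ⟨hu, hz, hu.sign_mul hv hU hz hne⟩

end nodal_ratio

theorem stmt2 (n : ℕ) (v₀ : En n → ℝ) (h₀ : HarmonicOnSet v₀ (ball 0 1))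
    (hne : ∃ x ∈ ball (0 : En n) 1, v₀ x ≠ 0) :
    ∃ A > (0 : ℝ), ∃ R > (0 : ℝ), ∀ u v : En n → ℝ,
      HarmonicOnSet u (ball 0 1) → HarmonicOnSet v (ball 0 1) →
      zeroSet u (ball 0 1) = zeroSet v₀ (ball 0 1) →
      zeroSet v (ball 0 1) = zeroSet v₀ (ball 0 1) →
      ∀ α : Fin n → ℕ,
      ∀ x ∈ ball (0 : En n) (1/2) \ zeroSet v₀ (ball 0 1),
      ∀ y ∈ ball (0 : En n) (1/2) \ zeroSet v₀ (ball 0 1),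
        |multiPartialDeriv α (fun z => u z / v z) x| ≤
          (∏ i, Nat.factorial (α i) : ℕ) * A * R ^ (∑ i, α i) * |u y / v y| := by
  have hU : IsPreconnected (ball (0 : En n) 1) := (convex_ball 0 1).isPreconnected
  have hv₀ := h₀.isHarm isOpen_ball
  have hSU : closedBall (0 : En n) (1 / 2) ⊆ ball 0 1 := closedBall_subset_ball (by norm_num)
  obtain ⟨A, hA, R, hR, H⟩ := hv₀.exists_uniform_ratio_bound hU hne
    (isCompact_closedBall (0 : En n) (1 / 2)) hSU
  refine ⟨A, hA, R, hR, fun u v hu hv hzu hzv α x hx y hy => ?_⟩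
  have hb : ∀ x ∈ ball (0 : En n) (1 / 2) \ zeroSet v₀ (ball 0 1),
      x ∈ closedBall (0 : En n) (1 / 2) ∧ v₀ x ≠ 0 := fun x hx =>
    ⟨ball_subset_closedBall hx.1, fun h =>
      hx.2 ⟨hSU (ball_subset_closedBall hx.1), h⟩⟩
  exact H u v (isNodalMate_of_zeroSet_eq hv₀ (hu.isHarm isOpen_ball) hU hne hzu)
    (isNodalMate_of_zeroSet_eq hv₀ (hv.isHarm isOpen_ball) hU hne hzv) α x (hb x hx).1
    (hb x hx).2 y (hb y hy).1 (hb y hy).2
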